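/- Suppose a finite group G admits a Frobenius group of automorphisms FH with kernel F and complement H such that C_G(F) = 1. If C_{G'}(H) is nilpotent and C_G(H) is supersoluble, then G is supersoluble. -/

import Mathlib

/-- The subgroup of fixed points of a subgroup `S` of a group `A`
acting on `G` by automorphisms. -/
def autFixed {A G : Type*} [Group A] [Group G] [MulDistribMulAction A G]
    (S : Subgroup A) : Subgroup G where
  carrier := {g | ∀ a ∈ S, a • g = g}
  one_mem' := fun a _ => smul_one a
  mul_mem' := fun {x y} hx hy a ha => by rw [smul_mul', hx a ha, hy a ha]
  inv_mem' := fun {x} hx a ha => by rw [smul_inv', hx a ha]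

/-- `K < N` is a chief factor of `G`: both are normal and there is no normal
subgroup strictly between them. -/
def IsChiefFactor (G : Type*) [Group G] (K N : Subgroup G) : Prop :=
  K.Normal ∧ N.Normal ∧ K < N ∧
    ∀ L : Subgroup G, L.Normal → K ≤ L → L ≤ N → L = K ∨ L = N

/-- The factor `N/K` is cyclic: it is generated by a single coset. -/
def CyclicFactor {G : Type*} [Group G] (K N : Subgroup G) : Prop :=
  ∃ g ∈ N, ∀ x ∈ N, ∃ n : ℤ, (g ^ n)⁻¹ * x ∈ K

/-- A finite group is supersoluble: every chief factor is cyclic. -/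
def Supersoluble (X : Type*) [Group X] : Prop :=
  ∀ K N : Subgroup X, IsChiefFactor X K N → CyclicFactor K N

namespace SS
open Subgroup

/-- elementwise form of p-nilpotency -/
def PC (p : ℕ) (G : Type*) [Group G] : Prop :=
  ∀ x y : G, ¬ p ∣ orderOf x → ¬ p ∣ orderOf y → ¬ p ∣ orderOf (x * y)

section
variable {p : ℕ} {G K : Type*} [Group G] [Group K]

theorem exists_pow_not_dvd [hp : Fact p.Prime] [Finite G] (x : G) :
    ∃ k : ℕ, ¬ p ∣ orderOf (x ^ p ^ k) := by
  have h0 : orderOf x ≠ 0 := (orderOf_pos x).ne'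
  refine ⟨(orderOf x).factorization p, ?_⟩
  rw [orderOf_pow_of_dvd (pow_ne_zero _ hp.out.ne_zero) (Nat.ordProj_dvd _ _)]
  exact Nat.not_dvd_ordCompl hp.out h0

theorem eq_one_of_pgroup [hp : Fact p.Prime] (hG : IsPGroup p G) (x : G) (h : ¬ p ∣ orderOf x) :
    x = 1 := by
  obtain ⟨k, hk⟩ := hG x
  have h1 := orderOf_dvd_of_pow_eq_one hk
  rw [← orderOf_eq_one_iff]
  exact Nat.Coprime.eq_one_of_dvd
    (Nat.Coprime.pow_right k ((hp.out.coprime_iff_not_dvd.2 h).symm)) h1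

theorem eq_one_of_mem_pgroup [hp : Fact p.Prime] {P : Subgroup G} (hP : IsPGroup p P) {x : G}
    (hx : x ∈ P) (h : ¬ p ∣ orderOf x) : x = 1 := by
  have := eq_one_of_pgroup hP ⟨x, hx⟩ (by rwa [← Subgroup.orderOf_coe])
  simpa using congrArg Subtype.val this

theorem not_dvd_map (f : G →* K) {x : G} (h : ¬ p ∣ orderOf x) : ¬ p ∣ orderOf (f x) :=
  fun h' => h (h'.trans (orderOf_map_dvd f x))

theorem PC.of_injective (f : G →* K) (hf : Function.Injective f) (h : PC p K) : PC p G := by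
  intro x y hx hy
  rw [← orderOf_injective f hf] at hx hy ⊢
  rw [map_mul]
  exact h _ _ hx hy

theorem exists_lift_not_dvd [hp : Fact p.Prime] [Finite G] (f : G →* K)
    (x : G) (h : ¬ p ∣ orderOf (f x)) : ∃ y : G, f y = f x ∧ ¬ p ∣ orderOf y := by
  obtain ⟨k, hk⟩ := exists_pow_not_dvd (p := p) x
  have hc : Nat.Coprime (p ^ k) (orderOf (f x)) :=
    Nat.Coprime.pow_left k (hp.out.coprime_iff_not_dvd.2 h)
  obtain ⟨m, hm⟩ := exists_pow_eq_self_of_coprime hc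
  refine ⟨(x ^ p ^ k) ^ m, by simpa using hm, fun h' => hk (h'.trans (orderOf_pow_dvd m))⟩

theorem PC.of_surjective [hp : Fact p.Prime] [Finite G] (f : G →* K) (hf : Function.Surjective f)
    (h : PC p G) : PC p K := by
  intro x y hx hy
  obtain ⟨x, rfl⟩ := hf x
  obtain ⟨y, rfl⟩ := hf y
  obtain ⟨x', hx', hx''⟩ := exists_lift_not_dvd f x hx
  obtain ⟨y', hy', hy''⟩ := exists_lift_not_dvd f y hy
  rw [← hx', ← hy', ← map_mul]
  exact not_dvd_map f (h _ _ hx'' hy'')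

theorem PC.of_le {M N : Subgroup G} (hMN : M ≤ N) (h : PC p N) : PC p M :=
  PC.of_injective (Subgroup.inclusion hMN) (Subgroup.inclusion_injective hMN) h

theorem PC.sub (h : PC p G) (N : Subgroup G) : PC p N :=
  PC.of_injective N.subtype N.subtype_injective h

/-- the normal p-complement -/
def PC.O (h : PC p G) (hp : p ≠ 1) : Subgroup G where
  carrier := {x | ¬ p ∣ orderOf x}
  one_mem' := by simpa using hp
  mul_mem' := fun {x y} hx hy => h x y hx hy
  inv_mem' := fun {x} hx => by simpa using hx

theorem PC.mem_O (h : PC p G) (hp : p ≠ 1) {x : G} : x ∈ h.O hp ↔ ¬ p ∣ orderOf x := Iff.rfl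

theorem PC.O_normal (h : PC p G) (hp : p ≠ 1) : (h.O hp).Normal :=
  ⟨fun x hx g => by
    have := orderOf_injective (MulAut.conj g).toMonoidHom (MulAut.conj g).injective x
    rw [PC.mem_O] at hx ⊢
    rw [← this] at hx
    simpa using hx⟩

theorem PC.not_dvd_card [hp : Fact p.Prime] [Finite G] (h : PC p G) :
    ¬ p ∣ Nat.card (h.O hp.out.ne_one) := by
  intro hd
  obtain ⟨x, hx⟩ := exists_prime_orderOf_dvd_card' p hd
  apply x.2
  rw [Subgroup.orderOf_coe, hx]

theorem PC.quot [hp : Fact p.Prime] [Finite G] (h : PC p G) (N : Subgroup G) [N.Normal]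
    (hN : h.O hp.out.ne_one ≤ N) : IsPGroup p (G ⧸ N) := by
  intro x
  obtain ⟨x, rfl⟩ := QuotientGroup.mk_surjective x
  obtain ⟨k, hk⟩ := exists_pow_not_dvd (p := p) x
  refine ⟨k, ?_⟩
  rw [← QuotientGroup.mk_pow, QuotientGroup.eq_one_iff]
  exact hN hk

theorem mem_of_quot [hp : Fact p.Prime] {N : Subgroup G} [N.Normal] (h : IsPGroup p (G ⧸ N))
    {x : G} (hx : ¬ p ∣ orderOf x) : x ∈ N := by
  rw [← QuotientGroup.eq_one_iff]
  exact eq_one_of_pgroup h _ (not_dvd_map (QuotientGroup.mk' N) hx)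

theorem PC.of_quot [hp : Fact p.Prime] {N : Subgroup G} [N.Normal] (h : IsPGroup p (G ⧸ N))
    (hN : PC p N) : PC p G := by
  intro x y hx hy
  have h1 := hN ⟨x, mem_of_quot h hx⟩ ⟨y, mem_of_quot h hy⟩
  rw [← Subgroup.orderOf_coe, ← Subgroup.orderOf_coe, ← Subgroup.orderOf_coe] at h1
  exact h1 hx hy

theorem PC.exists_mul [hp : Fact p.Prime] [Finite G] (h : PC p G) (S : Sylow p G) (g : G) :
    ∃ o ∈ h.O hp.out.ne_one, ∃ s ∈ S, o * s = g := by
  have hn := h.O_normal hp.out.ne_one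
  have htop : h.O hp.out.ne_one ⊔ S = ⊤ := by
    rw [← Subgroup.index_eq_one]
    have h1 := Subgroup.index_dvd_of_le (le_sup_left : h.O hp.out.ne_one ≤ h.O hp.out.ne_one ⊔ S)
    have h2 := Subgroup.index_dvd_of_le (le_sup_right : (S : Subgroup G) ≤ h.O hp.out.ne_one ⊔ S)
    obtain ⟨k, hk⟩ := (IsPGroup.iff_card).1 (h.quot _ le_rfl)
    rw [← Subgroup.index_eq_card] at hk
    rw [hk] at h1
    refine Nat.Coprime.eq_one_of_dvd ?_ h1
    exact Nat.Coprime.pow_right k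
      ((hp.out.coprime_iff_not_dvd.2 (fun h3 => S.not_dvd_index (h3.trans h2))).symm)
  have : g ∈ h.O hp.out.ne_one ⊔ S := htop ▸ Subgroup.mem_top g
  exact Subgroup.mem_sup_of_normal_left.1 this

/-- O commutes with normal p-subgroups -/
theorem PC.comm [hp : Fact p.Prime] (h : PC p G) {D : Subgroup G} [hD : D.Normal]
    (hDp : IsPGroup p D) {x d : G} (hx : ¬ p ∣ orderOf x) (hd : d ∈ D) : x * d = d * x := by
  have hn := h.O_normal hp.out.ne_one
  have h1 : x * d * x⁻¹ * d⁻¹ ∈ D := D.mul_mem (hD.conj_mem d hd x) (D.inv_mem hd)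
  have h2 : x * d * x⁻¹ * d⁻¹ ∈ h.O hp.out.ne_one := by
    have := mul_mem (show x ∈ h.O hp.out.ne_one from hx)
      (hn.conj_mem _ (inv_mem (show x ∈ h.O hp.out.ne_one from hx)) d)
    simpa [mul_assoc] using this
  have h3 := eq_one_of_mem_pgroup hDp h1 h2
  have := mul_inv_eq_one.1 h3
  exact mul_inv_eq_iff_eq_mul.1 this

theorem PC_of_isPGroup [hp : Fact p.Prime] (h : IsPGroup p G) : PC p G := by
  intro x y hx hy
  rw [eq_one_of_pgroup h x hx, eq_one_of_pgroup h y hy]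
  simpa using hp.out.ne_one

theorem PC_of_nilpotent [hp : Fact p.Prime] [Finite G] (h : Group.IsNilpotent G) : PC p G := by
  obtain ⟨e⟩ := (Group.isNilpotent_of_finite_tfae.out 0 4).1 h
  refine PC.of_injective e.symm.toMonoidHom e.symm.injective ?_
  have key : ∀ z : ((q : (Nat.card G).primeFactors) → (P : Sylow (q : ℕ) G) → P),
      ¬ p ∣ orderOf z ↔ ∀ q : (Nat.card G).primeFactors, (q : ℕ) = p → z q = 1 := by
    intro z
    constructor
    · rintro hz q rfl
      funext P
      have := not_dvd_map ((Pi.evalMonoidHom (fun P : Sylow (q:ℕ) G => P) P).comp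
        (Pi.evalMonoidHom (fun q : (Nat.card G).primeFactors =>
          ((P : Sylow (q : ℕ) G) → P)) q)) hz
      exact eq_one_of_pgroup P.2 _ this
    · intro hz hd
      have hw : orderOf (z ^ (orderOf z / p)) = p := by
        rw [orderOf_pow_of_dvd (Nat.div_pos (Nat.le_of_dvd (orderOf_pos z) hd) hp.out.pos).ne'
          (Nat.div_dvd_of_dvd hd), Nat.div_div_self hd (orderOf_pos z).ne']
      have h1 : z ^ (orderOf z / p) = 1 := by
        funext q P
        by_cases hq : (q : ℕ) = p
        · have := hz q hq
          rw [Pi.pow_apply, this]; simp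
        · have hqp : (q:ℕ).Prime := Nat.prime_of_mem_primeFactors q.2
          haveI : Fact (q:ℕ).Prime := ⟨hqp⟩
          refine eq_one_of_pgroup P.2 _ ?_
          have h2 : ¬ (q:ℕ) ∣ orderOf (z ^ (orderOf z / p)) := by
            rw [hw]
            intro h3
            exact hq ((Nat.prime_dvd_prime_iff_eq hqp hp.out).1 h3)
          exact not_dvd_map ((Pi.evalMonoidHom (fun P : Sylow (q:ℕ) G => P) P).comp
            (Pi.evalMonoidHom (fun q : (Nat.card G).primeFactors =>
            ((P : Sylow (q : ℕ) G) → P)) q)) h2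
      rw [h1, orderOf_one] at hw
      exact hp.out.ne_one hw.symm
  intro x y hx hy
  rw [key] at *
  intro q hq
  have := hx q hq
  have := hy q hq
  simp_all

end
end SS

namespace SS
open Subgroup
section
variable {p : ℕ} {G : Type*} [Group G]

theorem card_lt_of_lt [Finite G] {D E : Subgroup G} (hE : D < E) : Nat.card D < Nat.card E := by
  refine lt_of_le_of_ne (Subgroup.card_le_of_le hE.le) ?_
  intro h2
  exact hE.ne (Subgroup.eq_of_le_of_card_ge hE.le h2.ge)

theorem card_lt_of_ne_top [Finite G] {D : Subgroup G} (hE : D ≠ ⊤) :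
    Nat.card D < Nat.card G := by
  refine lt_of_le_of_ne (Subgroup.card_le_card_group D) ?_
  intro h2
  exact hE ((Subgroup.card_eq_iff_eq_top D).1 h2)

theorem PC_normalizer_of_map {K : Type*} [Group K] (f : G →* K) (hf : Function.Injective f)
    {X : Subgroup G} (h : PC p (normalizer ((X.map f : Subgroup K) : Set K))) :
    PC p (normalizer (X : Set G)) := by
  refine PC.of_injective ((f.comp (normalizer (X : Set G)).subtype).codRestrict _ ?_) ?_ h
  · intro x
    exact le_normalizer_map f ⟨x, x.2, rfl⟩
  · intro a b hab
    exact Subtype.ext (hf (congrArg Subtype.val hab))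

open Pointwise in
theorem mem_smul_sylow {g x : G} {P : Sylow p G} : x ∈ g • P ↔ g⁻¹ * x * g ∈ P := by
  change x ∈ MulAut.conj g • (P : Subgroup G) ↔ _
  rw [Subgroup.mem_pointwise_smul_iff_inv_smul_mem]
  change (MulAut.conj g)⁻¹ x ∈ (P : Subgroup G) ↔ _
  rw [MulAut.conj_inv_apply]
  rfl

theorem lt_inf_normalizer [Finite G] [hp : Fact p.Prime] {D P : Subgroup G} (hP : IsPGroup p P)
    (h : D < P) : D < P ⊓ normalizer (D : Set G) := by
  have hnil : Group.IsNilpotent P := hP.isNilpotent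
  have h1 := Group.normalizerCondition_of_isNilpotent (G := P) (D.subgroupOf P) (by
    rw [lt_top_iff_ne_top]
    intro h2
    rw [Subgroup.subgroupOf_eq_top] at h2
    exact absurd h2 (not_le_of_gt h))
  obtain ⟨x, hx, hx'⟩ := SetLike.exists_of_lt h1
  have hle : D ≤ P ⊓ normalizer (D : Set G) := le_inf h.le le_normalizer
  refine lt_of_le_of_ne hle ?_
  intro heq
  apply hx'
  rw [Subgroup.mem_subgroupOf, heq]
  refine ⟨x.2, ?_⟩
  rw [Subgroup.mem_normalizer_iff] at hx
  refine Subgroup.mem_normalizer_iff.2 ?_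
  intro y
  constructor
  · intro hy
    exact (hx ⟨y, h.le hy⟩).1 hy
  · intro hy
    have hyP : y ∈ P := by
      have := P.mul_mem (P.mul_mem (P.inv_mem x.2) (h.le hy)) x.2
      simpa [mul_assoc] using this
    exact (hx ⟨y, hyP⟩).2 hy

theorem fusion [Finite G] [hp : Fact p.Prime]
    (hyp : ∀ X : Subgroup G, IsPGroup p X → X ≠ ⊥ → PC p (normalizer (X : Set G))) :
    ∀ n : ℕ, ∀ P Q : Sylow p G, Nat.card G - Nat.card (P ⊓ Q : Subgroup G) ≤ n →
      ∃ c : G, (∀ d, d ∈ P → d ∈ Q → c * d = d * c) ∧ c • P = Q := by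
  intro n
  induction n with
  | zero =>
    intro P Q h
    have h1 : Nat.card G ≤ Nat.card (P ⊓ Q : Subgroup G) := by omega
    have h2 := Subgroup.eq_top_of_le_card _ h1
    have h3 : (P : Subgroup G) = ⊤ := top_le_iff.1 (h2 ▸ inf_le_left)
    have h4 : (Q : Subgroup G) = ⊤ := top_le_iff.1 (h2 ▸ inf_le_right)
    refine ⟨1, by simp, ?_⟩
    rw [one_smul]
    exact Sylow.ext (h3.trans h4.symm)
  | succ n ih =>
    intro P Q h
    by_cases hPQ : P = Q
    · exact ⟨1, by simp, by rw [one_smul, hPQ]⟩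
    by_cases hD : (P ⊓ Q : Subgroup G) = ⊥
    · obtain ⟨c, hc⟩ := MulAction.exists_smul_eq G P Q
      refine ⟨c, fun d hd hd' => ?_, hc⟩
      have : d ∈ (P ⊓ Q : Subgroup G) := ⟨hd, hd'⟩
      rw [hD, Subgroup.mem_bot] at this
      simp [this]
    generalize hDD : (P ⊓ Q : Subgroup G) = D at *
    have hDP : D ≤ P := hDD ▸ inf_le_left
    have hDQ : D ≤ Q := hDD ▸ inf_le_right
    have hDp : IsPGroup p D := P.2.to_le hDP
    have hN := hyp D hDp hD
    have hltP : D < P := lt_of_le_of_ne hDP (by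
      rintro rfl
      exact hPQ (Sylow.ext (P.3 Q.2 hDQ).symm))
    have hltQ : D < Q := lt_of_le_of_ne hDQ (by
      rintro rfl
      exact hPQ (Sylow.ext (Q.3 P.2 hDP)))
    have hP' := lt_inf_normalizer P.2 hltP
    have hQ' := lt_inf_normalizer Q.2 hltQ
    set N := normalizer (D : Set G) with hNdef
    have hSp : IsPGroup p ((P : Subgroup G).subgroupOf N) := P.2.comap_subtype
    have hTp : IsPGroup p ((Q : Subgroup G).subgroupOf N) := Q.2.comap_subtype
    obtain ⟨S, hS⟩ := hSp.exists_le_sylow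
    obtain ⟨T, hT⟩ := hTp.exists_le_sylow
    obtain ⟨m, hm⟩ := MulAction.exists_smul_eq N S T
    obtain ⟨o, ho, s, hs, hos⟩ := hN.exists_mul S m
    have hoS : o • S = T := by
      rw [← hm, ← hos, mul_smul, (Sylow.smul_eq_iff_mem_normalizer (P := S)).2 (le_normalizer hs)]
    have hRp : IsPGroup p (S.1.map N.subtype) := S.2.map _
    obtain ⟨R, hR⟩ := hRp.exists_le_sylow
    have hDcard : ∀ E : Subgroup G, D < E → Nat.card G - Nat.card E ≤ n := by
      intro E hE
      have h1 : Nat.card D < Nat.card E := by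
        refine lt_of_le_of_ne (Subgroup.card_le_of_le hE.le) ?_
        intro h2
        exact hE.ne (Subgroup.eq_of_le_of_card_ge hE.le h2.ge)
      omega
    have hPR : (P : Subgroup G) ⊓ N ≤ (P ⊓ R : Subgroup G) := by
      refine le_inf inf_le_left ?_
      rintro x ⟨hx, hx'⟩
      exact hR ⟨⟨x, hx'⟩, hS (show (⟨x,hx'⟩ : N) ∈ _ from hx), rfl⟩
    have hRQ : (Q : Subgroup G) ⊓ N ≤ (((o : G) • R : Sylow p G) ⊓ Q : Subgroup G) := by
      refine le_inf ?_ inf_le_left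
      rintro x ⟨hx, hx'⟩
      have h1 : (⟨x, hx'⟩ : N) ∈ T := hT (show (⟨x,hx'⟩ : N) ∈ _ from hx)
      rw [← hoS, mem_smul_sylow] at h1
      have : x ∈ ((o : G) • R : Sylow p G) := mem_smul_sylow.2 (hR ⟨_, h1, rfl⟩)
      exact this
    obtain ⟨c1, hc1, hc1'⟩ := ih P R (hDcard _ (lt_of_lt_of_le hP' hPR))
    obtain ⟨c2, hc2, hc2'⟩ := ih ((o:G) • R) Q (hDcard _ (lt_of_lt_of_le hQ' hRQ))
    refine ⟨c2 * o * c1, fun d hdP hdQ => ?_, ?_⟩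
    · have hd : d ∈ D := hDD ▸ ⟨hdP, hdQ⟩
      have e1 := hc1 d hdP (hPR (hP'.le hd)).2
      have e2 := hc2 d (hRQ (hQ'.le hd)).1 hdQ
      have hdN : d ∈ N := le_normalizer hd
      have e3 : (o : G) * d = d * o := by
        have hDN : IsPGroup p (D.subgroupOf N) := hDp.comap_subtype
        have : (D.subgroupOf N).Normal := Subgroup.normal_in_normalizer
        have := hN.comm hDN (x := o) (d := ⟨d, hdN⟩) ho hd
        exact congrArg Subtype.val this
      calc c2 * o * c1 * d = c2 * o * (c1 * d) := by group
        _ = c2 * (o * d) * c1 := by rw [e1]; group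
        _ = (c2 * d) * o * c1 := by rw [e3]; group
        _ = d * (c2 * o * c1) := by rw [e2]; group
    · rw [mul_smul, mul_smul, hc1', hc2']

theorem sylow_fusion [Finite G] [hp : Fact p.Prime]
    (hyp : ∀ X : Subgroup G, IsPGroup p X → X ≠ ⊥ → PC p (normalizer (X : Set G)))
    (P : Sylow p G) (hPne : (P : Subgroup G) ≠ ⊥) {x u : G} (hx : x ∈ P) (hxu : u * x * u⁻¹ ∈ P) :
    ∃ w ∈ P, u * x * u⁻¹ = w * x * w⁻¹ := by
  obtain ⟨c, hc, hcP⟩ := fusion hyp _ P (u • P) le_rfl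
  have h1 : c * (u * x * u⁻¹) = (u * x * u⁻¹) * c :=
    hc _ hxu (mem_smul_sylow.2 (by simpa [mul_assoc] using hx))
  have h2 : (c⁻¹ * u) • P = P := by rw [mul_smul, ← hcP, inv_smul_smul]
  rw [Sylow.smul_eq_iff_mem_normalizer] at h2
  have hN := hyp P P.2 hPne
  set N := normalizer ((P : Subgroup G) : Set G) with hNdef
  have hPN : (P : Subgroup G) ≤ N := le_normalizer
  obtain ⟨o, ho, s, hs, hos⟩ := hN.exists_mul (P.subtype hPN) ⟨c⁻¹ * u, h2⟩
  have hs' : (s : G) ∈ P := hs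
  have hcomm : (o : G) * (s * x * (s : G)⁻¹) = (s * x * (s : G)⁻¹) * o := by
    have : ((P : Subgroup G).subgroupOf N).Normal := Subgroup.normal_in_normalizer
    have hsx : (s:G) * x * (s : G)⁻¹ ∈ (P : Subgroup G) :=
      mul_mem (mul_mem hs' hx) (inv_mem hs')
    have h3 := hN.comm (D := (P : Subgroup G).subgroupOf N) P.2.comap_subtype (x := o)
      (d := ⟨(s:G) * x * (s : G)⁻¹, hPN hsx⟩) ho hsx
    exact congrArg Subtype.val h3
  have e : (o : G) * s = c⁻¹ * u := congrArg Subtype.val hos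
  refine ⟨s, hs', ?_⟩
  have e1 : u * x * u⁻¹ = c⁻¹ * u * x * (c⁻¹ * u)⁻¹ := by
    calc u * x * u⁻¹ = c⁻¹ * (c * (u * x * u⁻¹)) := by group
      _ = c⁻¹ * u * x * (c⁻¹ * u)⁻¹ := by rw [h1]; group
  rw [e1, ← e]
  calc (o : G) * s * x * ((o : G) * s)⁻¹ = (o * (s * x * (s : G)⁻¹)) * (o : G)⁻¹ := by group
    _ = (s:G) * x * (s : G)⁻¹ := by rw [hcomm]; group

theorem frobenius_PC_aux [hp : Fact p.Prime] : ∀ n : ℕ, ∀ (G : Type*) [Group G] [Finite G],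
    Nat.card G ≤ n → 
    (∀ X : Subgroup G, IsPGroup p X → X ≠ ⊥ → PC p (normalizer (X : Set G))) → PC p G := by
  intro n
  induction n with
  | zero =>
    intro G _ _ h
    exact absurd h (by have := Nat.card_pos (α := G); omega)
  | succ n ih =>
    intro G _ _ hcard hyp
    obtain ⟨P⟩ : Nonempty (Sylow p G) := inferInstance
    by_cases hP : (P : Subgroup G) = ⊥
    · intro x y hx hy hxy
      have h1 : p ∣ Nat.card G := hxy.trans (orderOf_dvd_natCard _)
      exact P.ne_bot_of_dvd_card h1 hP
    have hfoc : P.focalSubgroup ≤ ⁅(P : Subgroup G), (P : Subgroup G)⁆ := by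
      rw [Subgroup.focalSubgroup_def, Subgroup.closure_le]
      rintro g ⟨hg, x, hx, u, rfl⟩
      rw [commutatorElement_def] at hg ⊢
      have hux : u * x * u⁻¹ ∈ (P : Subgroup G) := by
        have := mul_mem (inv_mem hg) hx
        simpa [mul_assoc] using this
      obtain ⟨w, hw, hwx⟩ := sylow_fusion hyp P hP hx hux
      have e : x * u * x⁻¹ * u⁻¹ = x * w * x⁻¹ * w⁻¹ := by
        have : x * u * x⁻¹ * u⁻¹ = x * (u * x * u⁻¹)⁻¹ := by group
        rw [this, hwx]; group
      rw [e, ← commutatorElement_def]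
      exact Subgroup.commutator_mem_commutator hx hw
    have hnil : Group.IsNilpotent P := P.2.isNilpotent
    have hne : P.focalSubgroupOf ≠ ⊤ := by
      intro h1
      have h2 : ⁅(P : Subgroup G), (P : Subgroup G)⁆ = P := by
        refine le_antisymm (Subgroup.commutator_le_self _) ?_
        refine le_trans ?_ hfoc
        rw [← Subgroup.map_focalSubgroupOf, h1]
        intro x hx
        exact ⟨⟨x, hx⟩, Subgroup.mem_top _, rfl⟩
      have : Nontrivial P := (Subgroup.nontrivial_iff_ne_bot _).2 hP
      have h3 := Group.IsSolvable.commutator_lt_top_of_nontrivial P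
      apply h3.ne
      apply Subgroup.map_injective (P : Subgroup G).subtype_injective
      rw [Subgroup.map_subtype_commutator, h2]
      rw [← MonoidHom.range_eq_map, Subgroup.range_subtype]
    set M := P.transferFocal.ker with hM
    have hq : IsPGroup p (G ⧸ M) := by
      have := (P.2.to_quotient P.focalSubgroupOf)
      exact this.of_equiv
        (QuotientGroup.quotientKerEquivOfSurjective _ (Subgroup.transferFocal_surjective P)).symm
    refine PC.of_quot hq (ih M ?_ ?_)
    · have hMne : M ≠ ⊤ := by
        intro h1
        apply hne
        rw [eq_top_iff]
        intro x _
        obtain ⟨g, hg⟩ := Subgroup.transferFocal_surjective P (x : P ⧸ P.focalSubgroupOf)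
        have : g ∈ M := h1 ▸ Subgroup.mem_top g
        rw [hM, MonoidHom.mem_ker, hg, QuotientGroup.eq_one_iff] at this
        exact this
      have : Nat.card M < Nat.card G := by
        exact card_lt_of_ne_top hMne
      omega
    · intro X hX hXne
      have h1 := hyp (X.map M.subtype) (hX.map _) (by
        rwa [Ne, Subgroup.map_eq_bot_iff_of_injective _ M.subtype_injective])
      exact PC_normalizer_of_map M.subtype M.subtype_injective h1

theorem frobenius_PC [hp : Fact p.Prime] [Finite G]
    (h : ∀ X : Subgroup G, IsPGroup p X → X ≠ ⊥ → PC p (normalizer (X : Set G))) : PC p G :=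
  frobenius_PC_aux _ G le_rfl h

end
end SS

namespace SS
open Module
set_option linter.style.haveILetI false
set_option linter.unusedSectionVars false

abbrev KK (p : ℕ) [Fact p.Prime] := AlgebraicClosure (ZMod p)

theorem KK_roots (p : ℕ) [Fact p.Prime] (n : ℕ) (h : ¬ p ∣ n) :
    HasEnoughRootsOfUnity (KK p) n := by
  have : NeZero (n : AlgebraicClosure (ZMod p)) := ⟨by rwa [Ne, CharP.cast_eq_zero_iff _ p]⟩
  infer_instance

/-- additive function semi-invariant -/
def Semi {p : ℕ} [Fact p.Prime] {Q V : Type*} [Group Q] [Group V] (ρ : Q →* MulAut V)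
    (χ : Q →* (KK p)ˣ) (f : V → KK p) : Prop :=
  (∀ x y, f (x * y) = f x + f y) ∧ ∀ u v, f (ρ u v) = χ u * f v

section
variable {p : ℕ} [hp : Fact p.Prime]

theorem exists_functional_mod {M : Type*} [AddCommGroup M] [Module (ZMod p) M] {v : M}
    (hv : v ≠ 0) : ∃ f : M →+ KK p, f v ≠ 0 := by
  have h1 := (Module.forall_dual_apply_eq_zero_iff (ZMod p) v).not.2 hv
  push Not at h1
  obtain ⟨g, hg⟩ := h1
  refine ⟨(algebraMap (ZMod p) (KK p)).toAddMonoidHom.comp g.toAddMonoidHom, ?_⟩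
  change algebraMap (ZMod p) (KK p) (g v) ≠ 0
  rw [Ne, map_eq_zero]
  exact hg

theorem exists_functional_add {M : Type*} [AddCommGroup M] (hM : ∀ x : M, p • x = 0) {v : M}
    (hv : v ≠ 0) : ∃ f : M →+ KK p, f v ≠ 0 :=
  @exists_functional_mod p _ M _ (AddCommGroup.zmodModule hM) v hv

theorem exists_points_mod {M : Type*} [AddCommGroup M] [Finite M] [Module (ZMod p) M] :
    ∃ d : ℕ, Nat.card M = p ^ d ∧ ∃ b : Fin d → M, ∀ f : M →+ KK p, (∀ i, f (b i) = 0) → f = 0 := by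
  letI : Fintype M := Fintype.ofFinite _
  have hc := Module.card_eq_pow_finrank (K := ZMod p) (V := M)
  rw [ZMod.card, ← Nat.card_eq_fintype_card] at hc
  have b := Module.finBasis (ZMod p) M
  refine ⟨finrank (ZMod p) M, hc, b, fun f hf => ?_⟩
  have h3 : f.toZModLinearMap p = 0 := by
    apply b.ext
    intro i
    exact hf i
  ext x
  exact LinearMap.congr_fun h3 x

theorem exists_points_add {M : Type*} [AddCommGroup M] [Finite M] (hM : ∀ x : M, p • x = 0) :
    ∃ d : ℕ, Nat.card M = p ^ d ∧ ∃ b : Fin d → M, ∀ f : M →+ KK p, (∀ i, f (b i) = 0) → f = 0 :=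
  @exists_points_mod p _ M _ _ (AddCommGroup.zmodModule hM)

variable {V : Type*} [CommGroup V]

theorem exists_functional (hV : ∀ v : V, v ^ p = 1) {v : V} (hv : v ≠ 1) :
    ∃ f : V → KK p, (∀ x y, f (x * y) = f x + f y) ∧ f v ≠ 0 := by
  obtain ⟨f, hf⟩ := exists_functional_add (p := p) (M := Additive V) (v := Additive.ofMul v)
    (fun x => hV x) hv
  exact ⟨fun x => f (Additive.ofMul x), fun x y => map_add f _ _, hf⟩

theorem add_one' {f : V → KK p} (h : ∀ x y, f (x * y) = f x + f y) : f 1 = 0 := by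
  have := h 1 1
  simpa using this

theorem exists_points [Finite V] (hV : ∀ v : V, v ^ p = 1) (W : Subgroup V) :
    ∃ d : ℕ, W.index = p ^ d ∧ ∃ w : Fin d → V, ∀ f : V → KK p, (∀ x y, f (x * y) = f x + f y) →
      (∀ x ∈ W, f x = 0) → (∀ i, f (w i) = 0) → ∀ x, f x = 0 := by
  have : Finite (Additive (V ⧸ W)) := inferInstanceAs (Finite (V ⧸ W))
  obtain ⟨d, hd, b, hb⟩ := exists_points_add (p := p) (M := Additive (V ⧸ W)) (fun x => by
      obtain ⟨y, hy⟩ := QuotientGroup.mk_surjective x.toMul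
      have : x.toMul ^ p = 1 := by rw [← hy, ← QuotientGroup.mk_pow, hV]; rfl
      exact congrArg Additive.ofMul this)
  refine ⟨d, hd, ?_⟩
  choose w hw using fun i => QuotientGroup.mk_surjective (b i).toMul
  refine ⟨w, fun f hf hfW hfw => ?_⟩
  let f0 : V →* Multiplicative (KK p) :=
    MonoidHom.mk' (fun v => Multiplicative.ofAdd (f v)) (fun x y => by rw [hf]; rfl)
  have hker : W ≤ f0.ker := fun x hx => by
    rw [MonoidHom.mem_ker]
    change Multiplicative.ofAdd (f x) = 1
    rw [hfW x hx]; rfl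
  let f1 : (V ⧸ W) →* Multiplicative (KK p) := QuotientGroup.lift W f0 hker
  let f2 : Additive (V ⧸ W) →+ KK p := MonoidHom.toAdditiveLeft f1
  have h3 : f2 = 0 := by
    apply hb
    intro i
    have : f2 (b i) = f (w i) := by
      have : b i = Additive.ofMul ((w i : V) : V ⧸ W) := by rw [hw]; rfl
      rw [this]; rfl
    rw [this, hfw]
  intro x
  exact DFunLike.congr_fun h3 (Additive.ofMul (x : V ⧸ W))

theorem card_le_of_indep [Finite V] (hV : ∀ v : V, v ^ p = 1) (W : Subgroup V) {ι : Type*} [Fintype ι]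
    (φ : ι → V → KK p) (hadd : ∀ i, ∀ x y, φ i (x * y) = φ i x + φ i y)
    (hW : ∀ i, ∀ x ∈ W, φ i x = 0)
    (hind : ∀ c : ι → KK p, (∀ v, ∑ i, c i * φ i v = 0) → ∀ i, c i = 0) :
    ∃ d : ℕ, W.index = p ^ d ∧ Fintype.card ι ≤ d := by
  obtain ⟨d, hd, w, hw⟩ := exists_points hV W
  refine ⟨d, hd, ?_⟩
  have : LinearIndependent (KK p) (fun i => (fun j => φ i (w j) : Fin d → KK p)) := by
    rw [Fintype.linearIndependent_iff]
    intro c hc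
    apply hind
    apply hw (fun v => ∑ i, c i * φ i v)
    · intro x y
      simp only [hadd, mul_add, Finset.sum_add_distrib]
    · intro x hx
      exact Finset.sum_eq_zero fun i _ => by rw [hW i x hx, mul_zero]
    · intro j
      have := congrFun hc j
      simpa using this
  have := this.fintype_card_le_finrank
  simpa using this

end

section
variable {p : ℕ} [hp : Fact p.Prime] {Q V : Type*} [CommGroup Q] [Finite Q] [CommGroup V]
variable (ρ : Q →* MulAut V)

theorem finite_chars (hQ : ¬ p ∣ Nat.card Q) : Finite (Q →* (KK p)ˣ) := by
  have hroots := KK_roots p (Monoid.exponent Q) (fun h => hQ (h.trans Group.exponent_dvd_nat_card))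
  refine Nat.finite_of_card_ne_zero ?_
  rw [CommGroup.card_monoidHom_of_hasEnoughRootsOfUnity]
  exact Nat.card_pos.ne'

theorem cardQ_ne (hQ : ¬ p ∣ Nat.card Q) : (Nat.card Q : KK p) ≠ 0 := by
  rwa [Ne, CharP.cast_eq_zero_iff _ p]

theorem sum_char [Fintype Q] (χ ψ : Q →* (KK p)ˣ) (h : χ ≠ ψ) :
    ∑ u, ((ψ u)⁻¹ : (KK p)ˣ) * (χ u : KK p) = 0 := by
  have := sum_hom_units_eq_zero ((Units.coeHom (KK p)).comp (ψ⁻¹ * χ)) (by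
    intro h1
    apply h
    ext u
    have h2 := DFunLike.congr_fun h1 u
    simp only [MonoidHom.comp_apply, Units.coeHom_apply, MonoidHom.one_apply, Units.val_eq_one,
      MonoidHom.mul_apply, MonoidHom.inv_apply] at h2
    rw [inv_mul_eq_one] at h2
    rw [h2])
  simpa using this

theorem semi_indep (hQ : ¬ p ∣ Nat.card Q) {ι : Type*} [Fintype ι] (χ : ι → Q →* (KK p)ˣ)
    (hχ : Function.Injective χ) (φ : ι → V → KK p) (hφ : ∀ i, Semi ρ (χ i) (φ i))
    (hne : ∀ i, ∃ v, φ i v ≠ 0) (c : ι → KK p) (hc : ∀ v, ∑ i, c i * φ i v = 0) : ∀ i, c i = 0 := by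
  classical
  letI : Fintype Q := Fintype.ofFinite Q
  intro j
  obtain ⟨v, hv⟩ := hne j
  have h1 : ∑ u, ((χ j u)⁻¹ : (KK p)ˣ) * (∑ i, c i * φ i (ρ u v)) = 0 :=
    Finset.sum_eq_zero fun u _ => by rw [hc, mul_zero]
  have h2 : ∑ u, (((χ j u)⁻¹ : (KK p)ˣ) : KK p) * (∑ i, c i * φ i (ρ u v)) =
      ∑ i, (c i * φ i v) * ∑ u, ((χ j u)⁻¹ : (KK p)ˣ) * (χ i u : KK p) := by
    simp only [Finset.mul_sum]
    rw [Finset.sum_comm]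
    refine Finset.sum_congr rfl fun i _ => Finset.sum_congr rfl fun u _ => ?_
    rw [(hφ i).2]; ring
  rw [h2, Finset.sum_eq_single j] at h1
  · simp only [Units.inv_mul, Finset.sum_const, Finset.card_univ, nsmul_eq_mul, mul_one] at h1
    rw [← Nat.card_eq_fintype_card] at h1
    rcases mul_eq_zero.1 h1 with h | h
    · exact (mul_eq_zero.1 h).resolve_right hv
    · exact absurd h (cardQ_ne hQ)
  · intro i _ hi
    rw [sum_char _ _ (fun h => hi (hχ h)), mul_zero]
  · simp

theorem exists_semi (hQ : ¬ p ∣ Nat.card Q) (f : V → KK p) (hf : ∀ x y, f (x * y) = f x + f y)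
    {u0 : Q} {v0 : V} (h0 : f (ρ u0 v0) ≠ f v0) :
    ∃ (χ : Q →* (KK p)ˣ) (φ : V → KK p), Semi ρ χ φ ∧ (∃ v, φ v ≠ 0) ∧ χ u0 ≠ 1 := by
  classical
  letI : Fintype Q := Fintype.ofFinite Q
  have := finite_chars hQ
  letI : Fintype (Q →* (KK p)ˣ) := Fintype.ofFinite _
  let e : (Q →* (KK p)ˣ) → V → KK p := fun χ v => ∑ u, ((χ u)⁻¹ : (KK p)ˣ) * f (ρ u v)
  have he : ∀ χ, Semi ρ χ (e χ) := by
    intro χ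
    constructor
    · intro x y
      simp only [e, map_mul, hf, mul_add, Finset.sum_add_distrib]
    · intro w v
      simp only [e]
      rw [Finset.mul_sum]
      refine Fintype.sum_equiv (Equiv.mulRight w) _ _ fun u => ?_
      simp only [Equiv.coe_mulRight, map_mul, MulAut.mul_apply, mul_inv, Units.val_mul]
      have : (χ w : KK p) * ((χ w)⁻¹ : (KK p)ˣ) = 1 := Units.mul_inv _
      linear_combination -(↑(χ u)⁻¹ * f ((ρ u) ((ρ w) v))) * this
  by_contra hcon
  push Not at hcon
  apply h0
  have hsum : ∀ v, ∑ χ, e χ v = Nat.card Q * f v := by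
    intro v
    simp only [e]
    rw [Finset.sum_comm]
    simp only [← Finset.sum_mul]
    have hroots := KK_roots p (Monoid.exponent Q) (fun h => hQ (h.trans Group.exponent_dvd_nat_card))
    rw [Finset.sum_eq_single 1]
    · simp only [map_one, inv_one, Units.val_one, Finset.sum_const, Finset.card_univ, nsmul_eq_mul, mul_one, MulAut.one_apply]
      rw [← Nat.card_eq_fintype_card, CommGroup.card_monoidHom_of_hasEnoughRootsOfUnity]
    · intro u _ hu
      have h1 : ∑ χ : Q →* (KK p)ˣ, (((χ u)⁻¹ : (KK p)ˣ) : KK p) = 0 := by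
        let ev : (Q →* (KK p)ˣ) →* KK p :=
          (Units.coeHom (KK p)).comp ((MonoidHom.eval u)⁻¹)
        have h2 := sum_hom_units_eq_zero ev (by
          intro h1
          obtain ⟨χ, hχ⟩ := CommGroup.exists_apply_ne_one_of_hasEnoughRootsOfUnity Q (KK p) hu
          apply hχ
          have := DFunLike.congr_fun h1 χ
          simpa [ev] using this)
        simpa [ev] using h2
      rw [h1, zero_mul]
    · simp
  have hinv : ∀ χ v, e χ (ρ u0 v) = e χ v := by
    intro χ v
    rw [(he χ).2]
    by_cases h : ∃ v, e χ v ≠ 0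
    · have := hcon χ (e χ) (he χ) h
      rw [this]; simp
    · push Not at h
      rw [h]; simp
  have h1 := hsum (ρ u0 v0)
  simp only [hinv] at h1
  rw [hsum] at h1
  exact (mul_left_cancel₀ (cardQ_ne hQ) h1).symm

theorem rho_eq_one (hV : ∀ v : V, v ^ p = 1) (hQ : ¬ p ∣ Nat.card Q) (u0 : Q)
    (h : ∀ (χ : Q →* (KK p)ˣ) (φ : V → KK p), Semi ρ χ φ → (∃ v, φ v ≠ 0) → χ u0 = 1) :
    ρ u0 = 1 := by
  by_contra hne
  obtain ⟨v, hv⟩ : ∃ v, ρ u0 v ≠ v := by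
    by_contra h2
    push Not at h2
    exact hne (MulEquiv.ext h2)
  obtain ⟨f, hf, hfv⟩ := exists_functional (p := p) hV (v := ρ u0 v * v⁻¹) (by
    rwa [Ne, mul_inv_eq_one])
  obtain ⟨χ, φ, h1, h2, h3⟩ := exists_semi ρ hQ f hf (u0 := u0) (v0 := v) (by
    intro h4
    apply hfv
    have h5 := hf (ρ u0 v * v⁻¹) v
    rw [inv_mul_cancel_right, h4] at h5
    simpa using h5)
  exact h3 (h χ φ h1 h2)
end
end SS

namespace SS
set_option linter.style.haveILetI false
set_option linter.unusedSectionVars false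
open MulAction

theorem pow_gt_aux {p : ℕ} (hp : 3 ≤ p) {m : ℕ} (hm : 2 ≤ m) : m < p ^ (m - 1) := by
  obtain ⟨k, rfl⟩ := Nat.exists_eq_add_of_le hm
  have h1 : 2 + k - 1 = k + 1 := by omega
  rw [h1]
  have h2 : 3 ^ (k + 1) ≤ p ^ (k+1) := Nat.pow_le_pow_left hp _
  refine lt_of_lt_of_le ?_ h2
  clear hm h1 h2
  induction k with
  | zero => norm_num
  | succ k ih => rw [pow_succ]; omega

theorem comb {p d : ℕ} (hp : 3 ≤ p) {B X : Type*} [CommGroup B] [Finite B] [MulAction B X] [Finite X]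
    (N : Subgroup B) (hN : ∀ b : B, (∀ x : X, b • x = x) → b ∈ N) (hd : p ^ d ≤ N.index)
    (hX : Nat.card X ≤ d + Nat.card (orbitRel.Quotient B X)) : ∀ (b : B) (x : X), b • x = x := by
  classical
  letI : Fintype X := Fintype.ofFinite X
  have : Finite (orbitRel.Quotient B X) := Quotient.finite _
  letI : Fintype (orbitRel.Quotient B X) := Fintype.ofFinite _
  let m : orbitRel.Quotient B X → ℕ := fun ω => Nat.card (orbit B ω.out)
  have hm1 : ∀ ω, 1 ≤ m ω := fun ω => by
    have : Nonempty (orbit B ω.out) := ⟨⟨_, mem_orbit_self _⟩⟩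
    exact Nat.card_pos
  have hcard : Nat.card X = ∑ ω, m ω := by
    rw [Nat.card_congr (selfEquivSigmaOrbits B X), Nat.card_sigma]
  have hidx : N.index ≤ ∏ ω, m ω := by
    have : ∏ ω, m ω = Nat.card ((ω : orbitRel.Quotient B X) → orbit B ω.out) := by
      rw [Nat.card_pi]
    rw [this]
    refine Nat.card_le_card_of_injective (fun q : B ⧸ N => fun ω => ⟨q.out • ω.out, mem_orbit _ _⟩) ?_
    intro q q' h
    have h1 : (q.out)⁻¹ * q'.out ∈ N := by
      apply hN
      intro x
      have hx : ∃ b : B, b • (Quotient.mk'' x : orbitRel.Quotient B X).out = x := by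
        have : (Quotient.mk'' x : orbitRel.Quotient B X).out ∈ orbit B x :=
          Quotient.exact (Quotient.out_eq (s := orbitRel B X) (Quotient.mk'' x))
        obtain ⟨b, hb⟩ := this
        exact ⟨b⁻¹, by rw [← hb]; exact inv_smul_smul _ _⟩
      obtain ⟨b, hb⟩ := hx
      have h2 := congrArg Subtype.val (congrFun h (Quotient.mk'' x : orbitRel.Quotient B X))
      simp only at h2
      calc (q.out⁻¹ * q'.out) • x = (q.out⁻¹ * q'.out) • b • (Quotient.mk'' x : orbitRel.Quotient B X).out := by rw [hb]
        _ = b • (q.out⁻¹ • (q'.out • (Quotient.mk'' x : orbitRel.Quotient B X).out)) := by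
            rw [smul_smul, smul_smul, smul_smul]; congr 1
            rw [mul_comm]; group
        _ = x := by rw [← h2, inv_smul_smul, hb]
    have h3 := QuotientGroup.eq.2 h1
    rw [QuotientGroup.out_eq', QuotientGroup.out_eq'] at h3
    exact h3
  have hall : ∀ ω, m ω ≤ p ^ (m ω - 1) := fun ω => by
    rcases Nat.lt_or_ge (m ω) 2 with h | h
    · have : m ω = 1 := by have := hm1 ω; omega
      rw [this]; simp
    · exact (pow_gt_aux hp h).le
  have hone : ∀ ω, m ω < 2 := by
    intro ω
    by_contra hω
    push Not at hω
    have h1 : ∏ ω, m ω < ∏ ω, p ^ (m ω - 1) :=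
      Finset.prod_lt_prod (fun i _ => hm1 i) (fun i _ => hall i) ⟨ω, Finset.mem_univ _, pow_gt_aux hp hω⟩
    rw [Finset.prod_pow_eq_pow_sum] at h1
    have h2 : ∑ ω, (m ω - 1) ≤ d := by
      have h3 : ∑ ω, (m ω - 1) + Nat.card (orbitRel.Quotient B X) = ∑ ω, m ω := by
        rw [Nat.card_eq_fintype_card, ← Finset.card_univ, Finset.card_eq_sum_ones,
          ← Finset.sum_add_distrib]
        refine Finset.sum_congr rfl fun ω _ => ?_
        have := hm1 ω
        omega
      omega
    have h4 : p ^ (∑ ω, (m ω - 1)) ≤ p ^ d := Nat.pow_le_pow_right (by omega) h2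
    omega
  intro b x
  have h1 := hone (Quotient.mk'' x)
  have h2 : Nat.card (orbit B (Quotient.mk'' x : orbitRel.Quotient B X).out) ≤ 1 := by
    change m _ ≤ 1; omega
  have heq : orbit B (Quotient.mk'' x : orbitRel.Quotient B X).out = orbit B x :=
    orbit_eq_iff.2 (Quotient.exact (Quotient.out_eq (s := orbitRel B X) (Quotient.mk'' x)))
  rw [heq] at h2
  have h3 : Subsingleton (orbit B x) := (Finite.card_le_one_iff_subsingleton).1 h2
  have := @Subsingleton.elim _ h3 ⟨b • x, mem_orbit _ _⟩ ⟨x, mem_orbit_self _⟩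
  exact congrArg Subtype.val this

section
variable {p : ℕ} [hp : Fact p.Prime] {B Q V : Type*} [CommGroup B] [Finite B]
  [CommGroup Q] [Finite Q] [CommGroup V] [Finite V]

/-- occurring characters -/
def Occ (p : ℕ) [hp : Fact p.Prime] {Q V : Type*} [Group Q] [Group V] (ρ : Q →* MulAut V)
    (χ : Q →* (KK p)ˣ) : Prop := ∃ φ : V → KK p, Semi ρ χ φ ∧ ∃ v, φ v ≠ 0

theorem Semi.comp {A Q V : Type*} [Group A] [Group Q] [Group V] {ρ : Q →* MulAut V}
    {θ : A →* MulAut Q} {σ : A →* MulAut V}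
    (hc : ∀ b u v, σ b (ρ u v) = ρ (θ b u) (σ b v)) {χ : Q →* (KK p)ˣ} {φ : V → KK p}
    (h : Semi ρ χ φ) (b : A) : Semi ρ (χ.comp (θ b).toMonoidHom) (fun v => φ (σ b v)) := by
  constructor
  · intro x y; simp only [map_mul, h.1]
  · intro u v
    simp only [hc, h.2]
    rfl

theorem Occ.comp {A Q V : Type*} [Group A] [Group Q] [Group V] {ρ : Q →* MulAut V}
    {θ : A →* MulAut Q} {σ : A →* MulAut V}
    (hc : ∀ b u v, σ b (ρ u v) = ρ (θ b u) (σ b v)) {χ : Q →* (KK p)ˣ}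
    (h : Occ p ρ χ) (b : A) : Occ p ρ (χ.comp (θ b).toMonoidHom) := by
  obtain ⟨φ, hφ, v, hv⟩ := h
  exact ⟨_, hφ.comp hc b, (σ b)⁻¹ v, by simpa using hv⟩

theorem thompson_count (hp3 : 3 ≤ p) (hV : ∀ v : V, v ^ p = 1) (hQ : ¬ p ∣ Nat.card Q)
    (θ : B →* MulAut Q) (σ : B →* MulAut V) (ρ : Q →* MulAut V)
    (hc : ∀ b u v, σ b (ρ u v) = ρ (θ b u) (σ b v))
    (N : Subgroup B) (hN : ∀ b, (∀ u, ρ (θ b u) = ρ u) → b ∈ N)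
    (C : Subgroup V) (hC : ∀ c ∈ C, ∀ b, σ b c = c) (hidx : C.index ≤ N.index) : ∀ b, b ∈ N := by
  classical
  have hfin := finite_chars (p := p) hQ
  let X := {χ : Q →* (KK p)ˣ // Occ p ρ χ}
  letI : MulAction B X :=
    { smul := fun b χ => ⟨χ.1.comp (θ b⁻¹).toMonoidHom, χ.2.comp hc b⁻¹⟩
      one_smul := fun χ => by
        apply Subtype.ext
        change χ.1.comp (θ 1⁻¹).toMonoidHom = χ.1
        ext u; simp
      mul_smul := fun a b χ => by
        apply Subtype.ext
        change χ.1.comp (θ (a * b)⁻¹).toMonoidHom = (χ.1.comp (θ b⁻¹).toMonoidHom).comp (θ a⁻¹).toMonoidHom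
        ext u; simp }
  have hsm : ∀ (b : B) (χ : X), (b • χ).1 = χ.1.comp (θ b⁻¹).toMonoidHom := fun _ _ => rfl
  letI : Fintype X := Fintype.ofFinite X
  let rep : X → X := fun x => (Quotient.mk'' x : orbitRel.Quotient B X).out
  have hrep : ∀ x, ∃ b : B, b • rep x = x := fun x => by
    have : rep x ∈ orbit B x :=
      Quotient.exact (Quotient.out_eq (s := orbitRel B X) (Quotient.mk'' x))
    obtain ⟨b, hb⟩ := this
    exact ⟨b⁻¹, by rw [← hb]; exact inv_smul_smul _ _⟩
  have hrr : ∀ x, rep (rep x) = rep x := fun x => by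
    simp only [rep]
    congr 1
    exact Quotient.out_eq (s := orbitRel B X) (Quotient.mk'' x)
  choose g hg using hrep
  choose φ0 hφ0 hφ0' using fun x : X => x.2
  let φ : X → V → KK p := fun x v => φ0 (rep x) (σ (g x)⁻¹ v)
  have hφ : ∀ x, Semi ρ x.1 (φ x) := fun x => by
    have := (hφ0 (rep x)).comp hc (g x)⁻¹
    rwa [← hsm, hg] at this
  have hφne : ∀ x, ∃ v, φ x v ≠ 0 := fun x => by
    obtain ⟨v, hv⟩ := hφ0' (rep x)
    exact ⟨σ (g x) v, by simpa [φ] using hv⟩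
  let ι := {x : X // rep x ≠ x}
  obtain ⟨d, hd, hdι⟩ := card_le_of_indep (p := p) hV C (ι := ι) (fun x v => φ x.1 v - φ (rep x.1) v)
    (fun i x y => by simp only [(hφ _).1]; ring)
    (fun i x hx => by
      simp only [φ]
      rw [hC x hx, hC x hx, hrr, sub_self])
    (fun c hcc => by
      let c' : X → KK p := fun x => if h : rep x ≠ x then c ⟨x, h⟩ else 0
      have hsum : ∀ v, ∑ x, (c' x - ∑ z, if rep z = x then c' z else 0) * φ x v = 0 := by
        intro v
        have h1 : ∑ x, c' x * (φ x v - φ (rep x) v) = 0 := by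
          rw [← hcc v, ← Fintype.sum_subtype_add_sum_subtype (fun x : X => rep x ≠ x)]
          rw [Finset.sum_eq_zero (s := (Finset.univ : Finset {x // ¬ rep x ≠ x})), add_zero]
          · refine Finset.sum_congr rfl fun i _ => ?_
            simp only [c']
            rw [dif_pos i.2]
          · intro i _
            simp only [c']
            rw [dif_neg i.2, zero_mul]
        refine Eq.trans ?_ h1
        simp only [sub_mul, mul_sub, Finset.sum_sub_distrib]
        congr 1
        simp only [Finset.sum_mul]
        rw [Finset.sum_comm]
        refine Finset.sum_congr rfl fun z _ => ?_
        rw [Finset.sum_eq_single (rep z)]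
        · rw [if_pos rfl]
        · intro x _ hx
          rw [if_neg hx.symm, zero_mul]
        · intro h
          exact absurd (Finset.mem_univ _) h
      have h2 := semi_indep ρ hQ (fun x : X => x.1) Subtype.val_injective φ hφ hφne _ hsum
      intro i
      have h3 := h2 i.1
      rw [Finset.sum_eq_zero, sub_zero] at h3
      · simp only [c'] at h3
        rwa [dif_pos i.2] at h3
      · intro z _
        rw [if_neg]
        intro h4
        apply i.2
        rw [← h4, hrr])
  have key : ∀ b : B, (∀ x : X, b • x = x) → ∀ u, ρ (θ b u) = ρ u := by
    intro b hb u
    have : ρ (θ b u * u⁻¹) = 1 := by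
      apply rho_eq_one (p := p) ρ hV hQ
      intro χ ψ h1 h2
      have h3 := congrArg Subtype.val (hb ⟨χ, ψ, h1, h2⟩)
      rw [hsm] at h3
      have h4 := DFunLike.congr_fun h3 (θ b u)
      simp only [MonoidHom.comp_apply] at h4
      have h5 : (θ b⁻¹) (θ b u) = u := by simp
      have h6 : χ u = χ (θ b u) := by
        rw [← h4]
        exact congrArg χ h5.symm
      rw [map_mul, map_inv, h6, mul_inv_cancel]
    rw [map_mul, map_inv, mul_inv_eq_one] at this
    exact this
  have hfix := comb (d := d) hp3 (B := B) (X := X) N (fun b hb => hN b (key b hb)) (hd ▸ hidx) (by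
      have : Finite (orbitRel.Quotient B X) := Quotient.finite _
      letI : Fintype (orbitRel.Quotient B X) := Fintype.ofFinite _
      have h1 : Nat.card X ≤ Nat.card (ι ⊕ orbitRel.Quotient B X) := by
        refine Nat.card_le_card_of_injective
          (fun x => if h : rep x ≠ x then Sum.inl ⟨x, h⟩ else Sum.inr (Quotient.mk'' x)) ?_
        intro x y hxy
        by_cases h : rep x ≠ x <;> by_cases h' : rep y ≠ y
        · simp only [dif_pos h, dif_pos h'] at hxy
          exact congrArg Subtype.val (Sum.inl_injective hxy)
        · simp only [dif_pos h, dif_neg h'] at hxy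
          exact absurd hxy (by simp)
        · simp only [dif_neg h, dif_pos h'] at hxy
          exact absurd hxy (by simp)
        · simp only [dif_neg h, dif_neg h'] at hxy
          have := Sum.inr_injective hxy
          push Not at h h'
          rw [← h, ← h']
          simp only [rep, this]
      rw [Nat.card_sum, Nat.card_eq_fintype_card (α := ι)] at h1
      omega)
  exact fun b => hN b (key b (hfix b))
end
end SS

set_option linter.style.haveILetI false
set_option linter.unusedSectionVars false
namespace SS
open Subgroup
universe u
section
variable {p : ℕ} {G : Type u} [Group G]

def THyp (p : ℕ) (G : Type*) [Group G] : Prop :=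
  ∀ P : Sylow p G, ∀ K : Subgroup P, K.Characteristic → K ≠ ⊥ →
    PC p (normalizer ((K.map P.1.subtype : Subgroup G) : Set G))

theorem char_map_equiv {P Q : Type*} [Group P] [Group Q] (e : P ≃* Q) (K : Subgroup P)
    (hK : K.Characteristic) : (K.map e.toMonoidHom).Characteristic := by
  rw [characteristic_iff_le_comap] at hK ⊢
  intro φ
  rintro _ ⟨x, hx, rfl⟩
  have h1 := hK ((e.trans φ).trans e.symm) hx
  refine ⟨_, h1, ?_⟩
  simp

theorem mem_char {P : Type*} [Group P] {K : Subgroup P} (hK : K.Characteristic) (φ : P ≃* P) {x : P}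
    (hx : x ∈ K) : φ x ∈ K := by
  rw [characteristic_iff_le_comap] at hK
  exact hK φ hx

/-- element conjugating f.range into itself normalizes the image of char subgroups -/
theorem normalizer_char_le {P0 : Type*} [Group P0] (f : P0 →* G) (hf : Function.Injective f)
    (K : Subgroup P0) (hK : K.Characteristic) :
    normalizer (f.range : Set G) ≤ normalizer ((K.map f : Subgroup G) : Set G) := by
  have key : ∀ g ∈ normalizer (f.range : Set G), ∀ x ∈ K.map f, g * x * g⁻¹ ∈ K.map f := by
    intro g hg x hx
    have e := MonoidHom.ofInjective hf
    let c : f.range ≃* f.range := (normalizerMonoidHom f.range) ⟨g, hg⟩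
    obtain ⟨y, hy, rfl⟩ := hx
    let φ : P0 ≃* P0 := ((MonoidHom.ofInjective hf).trans c).trans (MonoidHom.ofInjective hf).symm
    refine ⟨φ y, mem_char hK φ hy, ?_⟩
    have h1 : (MonoidHom.ofInjective hf) (φ y) = c (MonoidHom.ofInjective hf y) := by simp [φ]
    have h2 := congrArg Subtype.val h1
    exact h2
  intro g hg
  rw [mem_normalizer_iff]
  intro x
  refine ⟨fun hx => key g hg x hx, fun hx => ?_⟩
  have := key g⁻¹ (inv_mem hg) _ hx
  simpa [mul_assoc] using this

theorem THyp.apply (hT : THyp p G) {P0 : Type*} [Group P0] (f : P0 →* G)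
    (hf : Function.Injective f) (P : Sylow p G) (hP : P.1 = f.range) (K : Subgroup P0)
    (hK : K.Characteristic) (hK1 : K ≠ ⊥) : PC p (normalizer ((K.map f : Subgroup G) : Set G)) := by
  let e : P0 ≃* P := (MonoidHom.ofInjective hf).trans (MulEquiv.subgroupCongr hP.symm)
  have h := hT P (K.map e.toMonoidHom) (char_map_equiv e K hK) (by
    rw [Ne, Subgroup.map_eq_bot_iff_of_injective _ e.injective]; exact hK1)
  rw [Subgroup.map_map] at h
  exact h

theorem PC_normalizer_of_map' {N : Subgroup G} {X : Subgroup N}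
    (h : PC p (normalizer ((X.map N.subtype : Subgroup G) : Set G))) :
    PC p (normalizer (X : Set N)) := PC_normalizer_of_map N.subtype N.subtype_injective h

theorem THyp.sub [Finite G] [hp : Fact p.Prime] (hT : THyp p G) (N : Subgroup G)
    (hN : ¬ p ∣ N.index) : THyp p N := by
  intro S K hK hK1
  apply PC_normalizer_of_map'
  rw [Subgroup.map_map]
  have hf : Function.Injective (N.subtype.comp S.1.subtype) :=
    N.subtype_injective.comp S.1.subtype_injective
  have hr : (N.subtype.comp S.1.subtype).range = S.1.map N.subtype := by
    rw [MonoidHom.range_comp, Subgroup.range_subtype]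
  have h1 : IsPGroup p (N.subtype.comp S.1.subtype).range := by
    rw [hr]; exact S.2.map _
  have h2 : ¬ p ∣ (N.subtype.comp S.1.subtype).range.index := by
    rw [hr, Subgroup.index_map_subtype]
    exact fun h => (hp.out.dvd_mul.1 h).elim S.not_dvd_index hN
  exact hT.apply _ hf (h1.toSylow h2) rfl K hK hK1

theorem exists_U [Finite G] [hp : Fact p.Prime]
    (ih : ∀ (H : Type u) [Group H] [Finite H], Nat.card H < Nat.card G → THyp p H → PC p H)
    (hT : THyp p G) (hG : ¬ PC p G) :
    ∃ U : Subgroup G, U.Normal ∧ IsPGroup p U ∧ U ≠ ⊥ ∧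
      (∀ X : Subgroup G, IsPGroup p X → ¬ p ∣ (normalizer (X : Set G)).index →
        Nat.card U < Nat.card X → PC p (normalizer (X : Set G))) ∧
      (∀ X : Subgroup G, X.Normal → IsPGroup p X → X ≤ U) := by
  classical
  let Bad := {X : Subgroup G // IsPGroup p X ∧ X ≠ ⊥ ∧ ¬ PC p (normalizer (X : Set G))}
  haveI : Nonempty Bad := by
    by_contra hc
    apply hG
    apply frobenius_PC
    intro X h1 h2
    by_contra h3
    exact hc ⟨⟨X, h1, h2, h3⟩⟩
  let v : Subgroup G → ℕ := fun X => (Nat.card (normalizer (X : Set G))).factorization p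
  let m : Subgroup G → ℕ := fun X => v X * (Nat.card G + 1) + Nat.card X
  obtain ⟨⟨U, hU1, hU2, hU3⟩, hmax⟩ := Finite.exists_max (fun X : Bad => m X.1)
  have hmax' : ∀ X : Subgroup G, IsPGroup p X → X ≠ ⊥ → ¬ PC p (normalizer (X : Set G)) →
    m X ≤ m U := fun X a b c => hmax ⟨X, a, b, c⟩
  have hlex : ∀ X : Subgroup G, IsPGroup p X → X ≠ ⊥ → ¬ PC p (normalizer (X : Set G)) →
      v X ≤ v U := by
    intro X a b c
    have := hmax' X a b c
    by_contra hlt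
    push Not at hlt
    have h3 : (v U + 1) * (Nat.card G + 1) ≤ v X * (Nat.card G + 1) :=
      Nat.mul_le_mul_right _ hlt
    have h4 : Nat.card U ≤ Nat.card G := Subgroup.card_le_card_group U
    simp only [m] at this
    nlinarith
  have hNtop : normalizer (U : Set G) = ⊤ := by
    by_contra hne
    apply hU3
    obtain ⟨N, hN⟩ : ∃ N, N = normalizer (U : Set G) := ⟨_, rfl⟩
    rw [← hN] at hne ⊢
    apply ih _ (card_lt_of_ne_top hne)
    intro S K hK hK1
    by_contra hbad
    have hbad' : ¬ PC p (normalizer (((K.map S.1.subtype).map N.subtype : Subgroup G) : Set G)) :=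
      fun h => hbad (PC_normalizer_of_map' h)
    rw [Subgroup.map_map] at hbad'
    have hf : Function.Injective (N.subtype.comp S.1.subtype) :=
      N.subtype_injective.comp S.1.subtype_injective
    have hr : (N.subtype.comp S.1.subtype).range = S.1.map N.subtype := by
      rw [MonoidHom.range_comp, Subgroup.range_subtype]
    have hRp : IsPGroup p (N.subtype.comp S.1.subtype).range := by
      rw [hr]; exact S.2.map _
    have hcard : Nat.card (N.subtype.comp S.1.subtype).range = p ^ v U := by
      rw [hr, Subgroup.card_map_of_injective N.subtype_injective, S.card_eq_multiplicity]
      simp only [v, ← hN]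
    set f := N.subtype.comp S.1.subtype with hfdef
    have hX1 : IsPGroup p (K.map f) := (S.2.to_subgroup K).map f
    have hX2 : K.map f ≠ ⊥ := by
      rw [Ne, Subgroup.map_eq_bot_iff_of_injective _ hf]; exact hK1
    have hv := hlex _ hX1 hX2 hbad'
    obtain ⟨P, hP⟩ := hRp.exists_le_sylow
    by_cases hRP : P.1 = f.range
    · exact hbad' (hT.apply f hf P hRP K hK hK1)
    · have hlt : f.range < P.1 := lt_of_le_of_ne hP (Ne.symm hRP)
      have hlt2 := lt_inf_normalizer P.2 hlt
      have hTp : IsPGroup p (P.1 ⊓ normalizer (f.range : Set G) : Subgroup G) :=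
        P.2.to_le inf_le_left
      obtain ⟨k, hk⟩ := IsPGroup.iff_card.1 hTp
      have hc1 := card_lt_of_lt hlt2
      rw [hk, hcard] at hc1
      have hk1 : v U < k := (Nat.pow_lt_pow_iff_right hp.out.one_lt).1 hc1
      have hle : P.1 ⊓ normalizer (f.range : Set G) ≤ normalizer ((K.map f : Subgroup G) : Set G) :=
        inf_le_right.trans (normalizer_char_le f hf K hK)
      have hdvd := Subgroup.card_dvd_of_le hle
      rw [hk] at hdvd
      have := (hp.out.pow_dvd_iff_le_factorization Nat.card_pos.ne').1 hdvd
      exact absurd (this.trans hv) (by omega)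
  have hUn : U.Normal := normalizer_eq_top_iff.1 hNtop
  have hstar : ∀ X : Subgroup G, IsPGroup p X → ¬ p ∣ (normalizer (X : Set G)).index →
        Nat.card U < Nat.card X → PC p (normalizer (X : Set G)) := by
    intro X hX hi hlt
    by_contra hc
    have hX2 : X ≠ ⊥ := by
      rintro rfl
      rw [Subgroup.card_bot] at hlt
      have : 0 < Nat.card U := Nat.card_pos
      omega
    have h1 := hmax' X hX hX2 hc
    have hv : v X = v U := by
      simp only [v]
      rw [hNtop, Subgroup.card_top, ← Subgroup.card_mul_index (normalizer (X : Set G)),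
        Nat.factorization_mul Nat.card_pos.ne' Subgroup.index_ne_zero_of_finite,
        Finsupp.add_apply, Nat.factorization_eq_zero_of_not_dvd hi, add_zero]
    simp only [m, hv] at h1
    omega
  refine ⟨U, hUn, hU1, hU2, hstar, ?_⟩
  intro X hXn hX
  have hs : IsPGroup p (X ⊔ U : Subgroup G) := hX.to_sup_of_normal_right hU1
  by_contra hle
  have hlt : U < X ⊔ U := lt_of_le_of_ne le_sup_right (by
    intro h; apply hle; rw [h]; exact le_sup_left)
  have hn : normalizer ((X ⊔ U : Subgroup G) : Set G) = ⊤ := normalizer_eq_top_iff.2 inferInstance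
  have h2 := hstar _ hs (by rw [hn, Subgroup.index_top]; exact hp.out.not_dvd_one)
    (card_lt_of_lt hlt)
  rw [hn] at h2
  exact hG (PC.of_injective (Subgroup.topEquiv (G := G)).symm.toMonoidHom
    (Subgroup.topEquiv (G := G)).symm.injective h2)

end
end SS

set_option linter.style.haveILetI false
set_option linter.unusedSectionVars false
namespace SS
open Subgroup
universe u
section
variable {p : ℕ} {G : Type u} [Group G]

theorem not_dvd_orderOf_of_quot [hp : Fact p.Prime] {M : Subgroup G} [M.Normal] [Finite G]
    (hM : ¬ p ∣ Nat.card M) {x : G} (h : ¬ p ∣ orderOf (x : G ⧸ M)) : ¬ p ∣ orderOf x := by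
  have h1 : x ^ orderOf (x : G ⧸ M) ∈ M := by
    rw [← QuotientGroup.eq_one_iff, QuotientGroup.mk_pow, pow_orderOf_eq_one]
  have h2 : ¬ p ∣ orderOf (x ^ orderOf (x : G ⧸ M)) := by
    intro h3
    apply hM
    refine h3.trans ?_
    have := orderOf_dvd_natCard (⟨_, h1⟩ : M)
    rwa [← Subgroup.orderOf_coe] at this
  have h3 : orderOf x ∣ orderOf (x : G ⧸ M) * orderOf (x ^ orderOf (x : G ⧸ M)) := by
    apply orderOf_dvd_of_pow_eq_one
    rw [pow_mul, pow_orderOf_eq_one]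
  intro h4
  exact (hp.out.dvd_mul.1 (h4.trans h3)).elim h h2

theorem PC.of_quot' [hp : Fact p.Prime] {M : Subgroup G} [M.Normal] [Finite G]
    (hM : ¬ p ∣ Nat.card M) (h : PC p (G ⧸ M)) : PC p G := by
  intro x y hx hy
  apply not_dvd_orderOf_of_quot hM
  exact h _ _ (not_dvd_map (QuotientGroup.mk' M) hx) (not_dvd_map (QuotientGroup.mk' M) hy)

theorem PC_normalizer_of_image [hp : Fact p.Prime] [Finite G] {K : Type*} [Group K] (f : G →* K)
    {X : Subgroup G} {Y : Subgroup K}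
    (hY : ∀ k ∈ normalizer (Y : Set K), ∃ g ∈ normalizer (X : Set G), f g = k)
    (h : PC p (normalizer (X : Set G))) : PC p (normalizer (Y : Set K)) := by
  have h1 : PC p ((normalizer (X : Set G)).map f) :=
    PC.of_surjective (f.subgroupMap _) (f.subgroupMap_surjective _) h
  refine PC.of_le ?_ h1
  intro k hk
  obtain ⟨g, hg, rfl⟩ := hY k hk
  exact ⟨g, hg, rfl⟩

theorem index_comap_mk (U : Subgroup G) [U.Normal] (S : Subgroup (G ⧸ U)) :
    (S.comap (QuotientGroup.mk' U)).index = S.index :=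
  Subgroup.index_comap_of_surjective _ (QuotientGroup.mk'_surjective U)

theorem isPGroup_comap_mk {U : Subgroup G} [U.Normal] (hU : IsPGroup p U) {S : Subgroup (G ⧸ U)}
    (hS : IsPGroup p S) : IsPGroup p (S.comap (QuotientGroup.mk' U)) := by
  apply hS.comap_of_ker_isPGroup
  rw [QuotientGroup.ker_mk']
  exact hU

theorem normalizer_comap_image {U : Subgroup G} [U.Normal] (Y : Subgroup (G ⧸ U)) :
    ∀ k ∈ normalizer (Y : Set (G ⧸ U)),
      ∃ g ∈ normalizer ((Y.comap (QuotientGroup.mk' U) : Subgroup G) : Set G),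
      (QuotientGroup.mk' U) g = k := by
  intro k hk
  obtain ⟨g, rfl⟩ := QuotientGroup.mk'_surjective U k
  refine ⟨g, ?_, rfl⟩
  rw [mem_normalizer_iff] at hk ⊢
  intro x
  have := hk (QuotientGroup.mk' U x)
  simpa using this

theorem THyp.quotU [hp : Fact p.Prime] [Finite G] {U : Subgroup G} [U.Normal] (hU : IsPGroup p U)
    (hstar : ∀ X : Subgroup G, IsPGroup p X → ¬ p ∣ (normalizer (X : Set G)).index →
        Nat.card U < Nat.card X → PC p (normalizer (X : Set G))) : THyp p (G ⧸ U) := by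
  intro S K hK hK1
  set Y := K.map S.1.subtype with hYd
  have hYS : Y ≤ S.1 := Subgroup.map_subtype_le K
  have hYp : IsPGroup p Y := S.2.to_le hYS
  refine PC_normalizer_of_image (QuotientGroup.mk' U) (normalizer_comap_image Y) ?_
  refine hstar _ (isPGroup_comap_mk hU hYp) ?_ ?_
  · have hSN : S.1 ≤ normalizer (Y : Set (G ⧸ U)) := by
      have := normalizer_char_le S.1.subtype S.1.subtype_injective K hK
      rw [Subgroup.range_subtype] at this
      exact le_normalizer.trans this
    have h1 : S.1.comap (QuotientGroup.mk' U) ≤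
        normalizer ((Y.comap (QuotientGroup.mk' U) : Subgroup G) : Set G) :=
      (Subgroup.comap_mono hSN).trans (le_normalizer_comap _)
    intro h2
    have h3 := h2.trans (Subgroup.index_dvd_of_le h1)
    rw [index_comap_mk] at h3
    exact S.not_dvd_index h3
  · apply card_lt_of_lt
    have h1 : U ≤ Y.comap (QuotientGroup.mk' U) := by
      intro x hx
      have : (QuotientGroup.mk' U) x = 1 := (QuotientGroup.eq_one_iff x).2 hx
      rw [Subgroup.mem_comap, this]
      exact one_mem _
    refine lt_of_le_of_ne h1 ?_
    intro h2
    apply hK1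
    rw [← Subgroup.map_eq_bot_iff_of_injective _ S.1.subtype_injective, eq_bot_iff]
    intro y hy
    obtain ⟨g, rfl⟩ := QuotientGroup.mk'_surjective U y
    have : g ∈ U := by rw [h2]; exact hy
    exact (QuotientGroup.eq_one_iff g).2 this

theorem card_mul_relIndex {H K : Subgroup G} (h : H ≤ K) :
    Nat.card H * H.relIndex K = Nat.card K := by
  have := Subgroup.relIndex_mul_relIndex ⊥ H K bot_le h
  simpa [Subgroup.relIndex_bot_left] using this

theorem card_sup_dvd [Finite G] (X M : Subgroup G) [M.Normal] :
    X.relIndex (X ⊔ M) ∣ Nat.card M := by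
  have h1 := card_mul_relIndex (le_sup_right : M ≤ X ⊔ M)
  have h2 := card_mul_relIndex (le_sup_left : X ≤ X ⊔ M)
  have h3 := card_mul_relIndex (inf_le_right : M ⊓ X ≤ X)
  rw [Subgroup.relIndex_sup_right] at h1
  rw [Subgroup.inf_relIndex_right] at h3
  have h4 : 0 < M.relIndex X := by
    apply Nat.pos_of_ne_zero
    intro h
    rw [h, mul_zero] at h3
    exact Nat.card_pos.ne h3
  refine ⟨Nat.card (M ⊓ X : Subgroup G), ?_⟩
  have h5 : M.relIndex X * Nat.card M =
      M.relIndex X * (X.relIndex (X ⊔ M) * Nat.card (M ⊓ X : Subgroup G)) := by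
    rw [mul_comm, h1, ← h2, ← h3]; ring
  exact Nat.eq_of_mul_eq_mul_left h4 h5

/-- Frattini-type statement -/
theorem frattini' [hp : Fact p.Prime] [Finite G] {M : Subgroup G} [M.Normal]
    (hM : ¬ p ∣ Nat.card M) {X : Subgroup G} (hX : IsPGroup p X) :
    ∀ k ∈ normalizer ((X.map (QuotientGroup.mk' M) : Subgroup (G ⧸ M)) : Set (G ⧸ M)),
      ∃ g ∈ normalizer (X : Set G), (QuotientGroup.mk' M) g = k := by
  intro k hk
  obtain ⟨g, rfl⟩ := QuotientGroup.mk'_surjective M k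
  set T := X ⊔ M with hT
  have hmap : T = (X.map (QuotientGroup.mk' M)).comap (QuotientGroup.mk' M) := by
    rw [Subgroup.comap_map_eq, QuotientGroup.ker_mk']
  have hgT : ∀ x, x ∈ T ↔ g * x * g⁻¹ ∈ T := by
    intro x
    rw [hmap, Subgroup.mem_comap, Subgroup.mem_comap]
    have := mem_normalizer_iff.1 hk (QuotientGroup.mk' M x)
    simpa using this
  have hidx : ¬ p ∣ X.relIndex T := by
    exact fun h => hM (h.trans (card_sup_dvd X M))
  have hXT : X ≤ T := le_sup_left
  let X' := X.map (MulAut.conj g).toMonoidHom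
  have hX'T : X' ≤ T := by
    rintro _ ⟨x, hx, rfl⟩
    exact (hgT x).1 (hXT hx)
  have hX'p : IsPGroup p X' := hX.map _
  have hcard : Nat.card X' = Nat.card X :=
    Subgroup.card_map_of_injective (MulAut.conj g).injective
  have hidx' : ¬ p ∣ X'.relIndex T := by
    have h1 := card_mul_relIndex hXT
    have h2 := card_mul_relIndex hX'T
    rw [hcard, ← h1] at h2
    have := Nat.eq_of_mul_eq_mul_left Nat.card_pos h2
    rwa [this]
  have hs1 : IsPGroup p (X.subgroupOf T) := hX.comap_subtype
  have hs2 : IsPGroup p (X'.subgroupOf T) := hX'p.comap_subtype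
  let S1 : Sylow p T := hs1.toSylow hidx
  let S2 : Sylow p T := hs2.toSylow hidx'
  obtain ⟨t, ht⟩ := MulAction.exists_smul_eq T S1 S2
  -- t X t⁻¹ = g X g⁻¹
  have hconj : ∀ x ∈ X, g⁻¹ * (t * x * (t:G)⁻¹) * g ∈ X := by
    intro x hx
    have h1 : (t * (⟨x, hXT hx⟩ : T) * t⁻¹) ∈ t • S1 := by
      rw [mem_smul_sylow]
      have : t⁻¹ * (t * (⟨x, hXT hx⟩ : T) * t⁻¹) * t = ⟨x, hXT hx⟩ := by group
      rw [this]
      exact hx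
    rw [ht] at h1
    have h2 : (t : G) * x * (t : G)⁻¹ ∈ X' := h1
    obtain ⟨y, hy, hy'⟩ := h2
    have : g * y * g⁻¹ = (t : G) * x * (t : G)⁻¹ := hy'
    rw [← this]
    have : g⁻¹ * (g * y * g⁻¹) * g = y := by group
    rw [this]; exact hy
  have hn : g⁻¹ * t ∈ normalizer (X : Set G) := by
    apply mem_normalizer_fintype
    intro x hx
    have := hconj x hx
    simpa [mul_assoc] using this
  -- t = m x with
  obtain ⟨x, hx, m, hm, hxm⟩ := Subgroup.mem_sup_of_normal_right.1 t.2
  refine ⟨x * (g⁻¹ * t)⁻¹, mul_mem (le_normalizer hx) (inv_mem hn), ?_⟩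
  have hm1 : (QuotientGroup.mk' M) m = 1 := (QuotientGroup.eq_one_iff m).2 hm
  rw [← hxm, map_mul, map_inv, map_mul, map_mul, hm1, map_inv]
  group

theorem THyp.quotM [hp : Fact p.Prime] [Finite G] (hT : THyp p G) {M : Subgroup G} [M.Normal]
    (hM : ¬ p ∣ Nat.card M) : THyp p (G ⧸ M) := by
  intro S K hK hK1
  obtain ⟨P, rfl⟩ := Sylow.mapSurjective_surjective (QuotientGroup.mk'_surjective M) p S
  have hS : (P.mapSurjective (QuotientGroup.mk'_surjective M)).1 =
    ((QuotientGroup.mk' M).comp P.1.subtype).range := by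
    rw [MonoidHom.range_comp, Subgroup.range_subtype]; rfl
  have hinj : Function.Injective ((QuotientGroup.mk' M).comp P.1.subtype) := by
    rw [injective_iff_map_eq_one]
    intro a ha
    have h1 : (a : G) ∈ M := (QuotientGroup.eq_one_iff _).1 ha
    have h2 := eq_one_of_pgroup P.2 a (fun h => hM (h.trans (by
      have := orderOf_dvd_natCard (⟨_, h1⟩ : M)
      rw [← Subgroup.orderOf_coe] at this
      rw [← Subgroup.orderOf_coe]; exact this)))
    exact h2
  let e : P ≃* (P.mapSurjective (QuotientGroup.mk'_surjective M)) :=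
    (MonoidHom.ofInjective hinj).trans (MulEquiv.subgroupCongr hS.symm)
  have hch := char_map_equiv e.symm K hK
  have hne : K.map e.symm.toMonoidHom ≠ ⊥ := by
    rw [Ne, Subgroup.map_eq_bot_iff_of_injective _ e.symm.injective]; exact hK1
  have h := hT P _ hch hne
  have heq : K.map (P.mapSurjective (QuotientGroup.mk'_surjective M)).1.subtype =
    ((K.map e.symm.toMonoidHom).map P.1.subtype).map (QuotientGroup.mk' M) := by
    rw [Subgroup.map_map, Subgroup.map_map]
    congr 1
    ext x
    have h3 : e (e.symm x) = x := e.apply_symm_apply x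
    exact (congrArg Subtype.val h3).symm
  rw [heq]
  exact PC_normalizer_of_image (QuotientGroup.mk' M)
    (frattini' hM (P.2.to_le (Subgroup.map_subtype_le _))) h

end
end SS

set_option linter.style.haveILetI false
set_option linter.unusedSectionVars false
namespace SS
open Subgroup
universe u
section
variable {p : ℕ} {G : Type u} [Group G]

theorem isPGroup_of_eq_one [hp : Fact p.Prime] [Finite G]
    (h : ∀ x : G, ¬ p ∣ orderOf x → x = 1) : IsPGroup p G := by
  intro x
  obtain ⟨k, hk⟩ := exists_pow_not_dvd (p := p) x
  exact ⟨k, h _ hk⟩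

theorem isPGroup_sub_of_eq_one [hp : Fact p.Prime] [Finite G] {H : Subgroup G}
    (h : ∀ x ∈ H, ¬ p ∣ orderOf x → x = 1) : IsPGroup p H := by
  apply isPGroup_of_eq_one
  intro x hx
  rw [← Subgroup.orderOf_coe] at hx
  exact Subtype.ext (h x x.2 hx)

theorem PC_of_center [hp : Fact p.Prime] [Finite G] (h : ¬ p ∣ (center G).index) : PC p G := by
  intro x y hx hy
  have hm : (x * y) ^ (center G).index = x ^ (center G).index * y ^ (center G).index := by
    have h1 := (MonoidHom.transferCenterPow G).map_mul x y
    have h2 := congrArg Subtype.val h1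
    exact h2
  have hc : ∀ z : G, z ^ (center G).index ∈ center G := fun z => Subgroup.pow_index_mem _ z
  intro hd
  have hcomm : Commute (x ^ (center G).index) (y ^ (center G).index) :=
    (Subgroup.mem_center_iff.1 (hc x) _).symm
  have h1 : orderOf ((x * y) ^ (center G).index) ∣ orderOf x * orderOf y := by
    rw [hm]
    refine hcomm.orderOf_mul_dvd_mul_orderOf.trans (mul_dvd_mul ?_ ?_) <;> exact orderOf_pow_dvd _
  have h2 : orderOf (x * y) ∣ (center G).index * orderOf ((x * y) ^ (center G).index) := by
    apply orderOf_dvd_of_pow_eq_one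
    rw [pow_mul, pow_orderOf_eq_one]
  have h3 := hd.trans (h2.trans (mul_dvd_mul_left _ h1))
  rcases hp.out.dvd_mul.1 h3 with h4 | h4
  · exact h h4
  · exact (hp.out.dvd_mul.1 h4).elim hx hy

structure MC (p : ℕ) (G : Type u) [Group G] (U : Subgroup G) [U.Normal] : Prop where
  ih : ∀ (H : Type u) [Group H] [Finite H], Nat.card H < Nat.card G → THyp p H → PC p H
  hT : THyp p G
  hG : ¬ PC p G
  hU : IsPGroup p U
  hU1 : U ≠ ⊥
  hmax : ∀ X : Subgroup G, X.Normal → IsPGroup p X → X ≤ U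
  hC : ∀ M : Subgroup G, M.Normal → ¬ p ∣ Nat.card M → M = ⊥
  hGU : PC p (G ⧸ U)

theorem exists_MC [hp : Fact p.Prime] [Finite G]
    (ih : ∀ (H : Type u) [Group H] [Finite H], Nat.card H < Nat.card G → THyp p H → PC p H)
    (hT : THyp p G) (hG : ¬ PC p G) : ∃ (U : Subgroup G) (_ : U.Normal), MC p G U := by
  obtain ⟨U, hn, hU, hU1, hs, hmax⟩ := exists_U ih hT hG
  have hq : ∀ M : Subgroup G, M.Normal → M ≠ ⊥ → Nat.card (G ⧸ M) < Nat.card G := by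
    intro M _ hM
    rw [Subgroup.card_eq_card_quotient_mul_card_subgroup M]
    have h1 : 1 < Nat.card M := by
      rwa [Subgroup.one_lt_card_iff_ne_bot]
    have h2 : 0 < Nat.card (G ⧸ M) := Nat.card_pos
    nlinarith
  refine ⟨U, hn, ih, hT, hG, hU, hU1, hmax, ?_, ih _ (hq U hn hU1) (THyp.quotU hU hs)⟩
  intro M hM hMp
  by_contra hne
  exact hG (PC.of_quot' hMp (ih _ (hq M hM hne) (hT.quotM hMp)))

variable {U : Subgroup G} [hUn : U.Normal] [hp : Fact p.Prime] [Finite G]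

/-- preimage of the p-complement -/
def MC.K (h : MC p G U) (hp : p ≠ 1) : Subgroup G :=
  (h.hGU.O hp).comap (QuotientGroup.mk' U)

theorem MC.mem_K (h : MC p G U) {x : G} :
    x ∈ h.K hp.out.ne_one ↔ ¬ p ∣ orderOf (x : G ⧸ U) := Iff.rfl

theorem MC.K_normal (h : MC p G U) : (h.K hp.out.ne_one).Normal :=
  (h.hGU.O_normal _).comap _

theorem MC.mem_K_of (h : MC p G U) {x : G} (hx : ¬ p ∣ orderOf x) : x ∈ h.K hp.out.ne_one :=
  not_dvd_map (QuotientGroup.mk' U) hx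

theorem MC.U_le_K (h : MC p G U) : U ≤ h.K hp.out.ne_one := by
  intro x hx
  rw [h.mem_K, (QuotientGroup.eq_one_iff x).2 hx, orderOf_one]
  exact hp.out.not_dvd_one

theorem MC.mem_U (h : MC p G U) {S : Subgroup G} (hS : IsPGroup p S) {x : G} (hx : x ∈ S)
    (hxK : x ∈ h.K hp.out.ne_one) : x ∈ U := by
  rw [← QuotientGroup.eq_one_iff]
  exact eq_one_of_mem_pgroup (hS.map (QuotientGroup.mk' U)) (x := (x : G ⧸ U)) ⟨x, hx, rfl⟩ hxK

theorem MC.cent (h : MC p G U) : centralizer (U : Set G) ≤ U := by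
  have hKn := h.K_normal
  set D := h.K hp.out.ne_one ⊓ centralizer (U : Set G) with hD
  haveI hDn : D.Normal := by
    rw [hD]; infer_instance
  have hle : U.subgroupOf D ≤ center D := by
    intro x hx
    rw [Subgroup.mem_center_iff]
    intro y
    apply Subtype.ext
    exact (mem_centralizer_iff.1 y.2.2 x hx).symm
  have hi : ¬ p ∣ (center D).index := by
    intro hd
    have h1 : p ∣ (U.subgroupOf D).index := hd.trans (Subgroup.index_dvd_of_le hle)
    have h2 : (U.subgroupOf D).index = U.relIndex D := rfl
    have h3 : U.relIndex D = Nat.card (D.map (QuotientGroup.mk' U)) := by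
      rw [← Subgroup.relIndex_ker, QuotientGroup.ker_mk']
    have h4 : D.map (QuotientGroup.mk' U) ≤ h.hGU.O hp.out.ne_one := by
      rintro _ ⟨x, hx, rfl⟩
      exact hx.1
    rw [h2, h3] at h1
    exact h.hGU.not_dvd_card (h1.trans (Subgroup.card_dvd_of_le h4))
  have hPC := PC_of_center hi
  have hOn := hPC.O_normal hp.out.ne_one
  haveI : (hPC.O hp.out.ne_one).Characteristic := by
    rw [characteristic_iff_le_comap]
    intro φ x hx
    exact not_dvd_map φ.toMonoidHom hx
  have hOn2 : ((hPC.O hp.out.ne_one).map D.subtype).Normal :=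
    ConjAct.normal_of_characteristic_of_normal
  have h5 := h.hC _ hOn2 (by
    rw [Subgroup.card_map_of_injective D.subtype_injective]
    exact hPC.not_dvd_card)
  refine h.hmax _ inferInstance (isPGroup_sub_of_eq_one ?_)
  intro x hx hxp
  have h6 : x ∈ (hPC.O hp.out.ne_one).map D.subtype := by
    refine ⟨⟨x, h.mem_K_of hxp, hx⟩, ?_, rfl⟩
    change ¬ p ∣ orderOf _
    rwa [← Subgroup.orderOf_coe]
  rw [h5] at h6
  exact h6

theorem MC.D (h : MC p G U) (P : Sylow p G) (L : Subgroup G) (hUL : U ≤ L)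
    (hLK : L ≤ h.K hp.out.ne_one)
    (hPL : P.1 ≤ normalizer (L : Set G)) : L = U ∨ L = h.K hp.out.ne_one := by
  by_cases htop : L ⊔ P.1 = ⊤
  · right
    refine le_antisymm hLK ?_
    have hLn : L.Normal := by
      rw [← normalizer_eq_top_iff, eq_top_iff, ← htop]
      exact sup_le le_normalizer hPL
    intro k hk
    have : k ∈ L ⊔ P.1 := htop ▸ mem_top k
    obtain ⟨l, hl, s, hs, rfl⟩ := Subgroup.mem_sup_of_normal_left.1 this
    refine mul_mem hl (hUL (h.mem_U P.2 hs ?_))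
    exact ((h.K hp.out.ne_one).mul_mem_cancel_left (hLK hl)).1 hk
  · left
    refine le_antisymm ?_ hUL
    have hi : ¬ p ∣ (L ⊔ P.1).index := fun hd =>
      P.not_dvd_index (hd.trans (Subgroup.index_dvd_of_le le_sup_right))
    have hPC := h.ih _ (card_lt_of_ne_top htop) (h.hT.sub _ hi)
    have hLp : IsPGroup p L := by
      apply isPGroup_sub_of_eq_one
      intro x hx hxp
      refine eq_one_of_mem_pgroup h.hU (h.cent ?_) hxp
      rw [mem_centralizer_iff]
      intro u hu
      have hUp : IsPGroup p (U.subgroupOf (L ⊔ P.1)) := h.hU.comap_subtype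
      have := hPC.comm hUp (x := ⟨x, (le_sup_left : L ≤ L ⊔ P.1) hx⟩)
        (d := ⟨u, (le_sup_left : L ≤ L ⊔ P.1) (hUL hu)⟩) (by rwa [← Subgroup.orderOf_coe]) hu
      exact (congrArg Subtype.val this).symm
    intro x hx
    exact h.mem_U hLp hx (hLK hx)

theorem MC.U_le_P (h : MC p G U) (P : Sylow p G) : U ≤ P.1 := by
  obtain ⟨Q, hQ⟩ := h.hU.exists_le_sylow
  obtain ⟨g, rfl⟩ := MulAction.exists_smul_eq G P Q
  intro x hx
  have := hQ (hUn.conj_mem x hx g)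
  have h2 := mem_smul_sylow.1 this
  have h3 : x ∈ P := by simpa [mul_assoc] using h2
  exact h3

/-- p-elements centralizing K mod U lie in U -/
theorem MC.R (h : MC p G U) (P : Sylow p G) {b : G} (hb : b ∈ P)
    (hbK : ∀ k ∈ h.K hp.out.ne_one, (b : G ⧸ U) * (k : G ⧸ U) = k * b) : b ∈ U := by
  set O := h.hGU.O hp.out.ne_one with hO
  haveI hOn : O.Normal := h.hGU.O_normal _
  set R := centralizer (O : Set (G ⧸ U)) with hR
  have hRn : R.Normal := by rw [hR]; infer_instance
  have hRPC : PC p R := h.hGU.sub R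
  have hbR : (b : G ⧸ U) ∈ R := by
    rw [hR, mem_centralizer_iff]
    intro k hk
    obtain ⟨k, rfl⟩ := QuotientGroup.mk_surjective k
    exact (hbK k hk).symm
  have hbp : IsPGroup p ((zpowers b).map (QuotientGroup.mk' U)) :=
    (P.2.to_le (by rw [zpowers_le]; exact hb)).map _
  have hbp2 : IsPGroup p (((zpowers b).map (QuotientGroup.mk' U)).subgroupOf R) :=
    hbp.comap_subtype
  obtain ⟨S, hS⟩ := hbp2.exists_le_sylow
  have hbS : (⟨(b : G ⧸ U), hbR⟩ : R) ∈ S := hS ⟨b, mem_zpowers b, rfl⟩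
  have hSn : S.1.Normal := by
    constructor
    intro s hs g
    obtain ⟨o, ho, t, ht, rfl⟩ := hRPC.exists_mul S g
    have h1 : o * (t * s * t⁻¹) * o⁻¹ = t * s * t⁻¹ := by
      have h2 : o * (t * s * t⁻¹) = (t * s * t⁻¹) * o := by
        apply Subtype.ext
        have h3 := mem_centralizer_iff.1 (hR.le (t * s * t⁻¹).2)
        refine h3 o ?_
        have h4 : ¬ p ∣ orderOf o := ho
        rw [← Subgroup.orderOf_coe] at h4
        exact h4
      rw [h2]; group
    have h2 : o * t * s * (o * t)⁻¹ = o * (t * s * t⁻¹) * o⁻¹ := by group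
    rw [h2, h1]
    exact mul_mem (mul_mem ht hs) (inv_mem ht)
  haveI := S.characteristic_of_normal hSn
  have hSn2 : (S.1.map R.subtype).Normal := ConjAct.normal_of_characteristic_of_normal
  have h5 := h.hmax ((S.1.map R.subtype).comap (QuotientGroup.mk' U)) inferInstance
    (isPGroup_comap_mk h.hU (S.2.map _))
  exact h5 ⟨_, hbS, rfl⟩

/-- irreducibility -/
theorem MC.irr (h : MC p G U) (P : Sylow p G) (T : Subgroup (h.hGU.O hp.out.ne_one))
    (hTP : ∀ g ∈ P, ∀ t ∈ T, ∀ t' : h.hGU.O hp.out.ne_one,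
      (t' : G ⧸ U) = g * (t : G ⧸ U) * (g : G ⧸ U)⁻¹ → t' ∈ T) :
    T = ⊥ ∨ T = ⊤ := by
  haveI hOn : (h.hGU.O hp.out.ne_one).Normal := h.hGU.O_normal _
  set L := (T.map (h.hGU.O hp.out.ne_one).subtype).comap (QuotientGroup.mk' U) with hL
  have h1 := h.D P L ?_ ?_ ?_
  · rcases h1 with h1 | h1
    · left
      rw [eq_bot_iff]
      intro t ht
      obtain ⟨x, hx⟩ := QuotientGroup.mk_surjective (t : G ⧸ U)
      have : x ∈ L := ⟨t, ht, hx.symm⟩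
      rw [h1, ← QuotientGroup.eq_one_iff, hx] at this
      exact Subtype.ext this
    · right
      rw [eq_top_iff]
      intro t _
      obtain ⟨x, hx⟩ := QuotientGroup.mk_surjective (t : G ⧸ U)
      have : x ∈ L := by
        rw [h1, h.mem_K, hx]
        exact t.2
      obtain ⟨t', ht', ht''⟩ := this
      have : t' = t := Subtype.ext (ht''.trans hx)
      rwa [← this]
  · intro x hx
    refine ⟨1, one_mem _, ?_⟩
    exact ((QuotientGroup.eq_one_iff x).2 hx).symm
  · rintro x ⟨t, ht, hx⟩
    have : (t : G ⧸ U) = x := hx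
    rw [h.mem_K, ← this]
    exact t.2
  · intro g hg
    apply mem_normalizer_fintype
    rintro x ⟨t, ht, hx⟩
    have hx' : (t : G ⧸ U) = x := hx
    refine ⟨⟨g * (t : G ⧸ U) * (g : G ⧸ U)⁻¹, hOn.conj_mem _ t.2 _⟩, hTP g hg t ht _ rfl, ?_⟩
    change (g : G ⧸ U) * (t : G ⧸ U) * (g : G ⧸ U)⁻¹ = ((g * x * g⁻¹ : G) : G ⧸ U)
    rw [hx']; rfl

open Pointwise commutatorElement in
theorem MC.Ocomm (h : MC p G U) (P : Sylow p G) (x y : h.hGU.O hp.out.ne_one) :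
    x * y = y * x := by
  haveI hOn : (h.hGU.O hp.out.ne_one).Normal := h.hGU.O_normal _
  obtain ⟨O, hO⟩ : ∃ O, O = h.hGU.O hp.out.ne_one := ⟨_, rfl⟩
  have hirr := h.irr P
  have hcard := h.hGU.not_dvd_card
  revert x y hOn hirr hcard
  rw [← hO]
  intro x y hOn hirr hcard
  by_cases h1 : Nat.card O = 1
  · haveI := (Nat.card_eq_one_iff_unique.1 h1).1
    exact Subsingleton.elim _ _
  set q := (Nat.card O).minFac
  haveI hq : Fact q.Prime := ⟨Nat.minFac_prime h1⟩
  have hqd : q ∣ Nat.card O := Nat.minFac_dvd _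
  let θ : P →* MulAut O := (MulAut.conjNormal).comp ((QuotientGroup.mk' U).comp P.1.subtype)
  have hθ : ∀ (g : P) (o : O), ((θ g o : O) : G ⧸ U) = (g : G) * (o : G ⧸ U) * ((g : G) : G ⧸ U)⁻¹ :=
    fun g o => MulAut.conjNormal_apply _ _
  letI : MulAction P (Sylow q O) := MulAction.compHom _ θ
  have hns : ¬ p ∣ Nat.card (Sylow q O) := by
    intro hd
    obtain ⟨S⟩ : Nonempty (Sylow q O) := inferInstance
    exact hcard (hd.trans (S.card_dvd_index.trans (Subgroup.index_dvd_card _)))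
  obtain ⟨S, hS⟩ := P.2.nonempty_fixed_point_of_prime_not_dvd_card (Sylow q O) hns
  have hSinv : ∀ g ∈ P, ∀ t ∈ S.1, ∀ t' : O,
      (t' : G ⧸ U) = g * (t : G ⧸ U) * (g : G ⧸ U)⁻¹ → t' ∈ S.1 := by
    intro g hg t ht t' ht'
    have h2 : θ ⟨g, hg⟩ • S = S := hS ⟨g, hg⟩
    have h3 : θ ⟨g, hg⟩ t ∈ θ ⟨g, hg⟩ • S := by
      change _ ∈ (θ ⟨g, hg⟩ • S.1 : Subgroup O)
      exact Subgroup.smul_mem_pointwise_smul _ _ _ ht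
    rw [h2] at h3
    have : t' = θ ⟨g, hg⟩ t := Subtype.ext (by rw [ht', hθ])
    rw [this]; exact h3
  have hOq : IsPGroup q O := by
    rcases hirr S.1 hSinv with h2 | h2
    · exact absurd h2 (S.ne_bot_of_dvd_card hqd)
    · have := S.2
      change IsPGroup q S.1 at this
      rw [h2] at this
      exact this.of_equiv Subgroup.topEquiv
  haveI : Nontrivial O := by
    rw [← Finite.one_lt_card_iff_nontrivial]
    have : 0 < Nat.card O := Nat.card_pos
    omega
  have hnil : Group.IsNilpotent O := hOq.isNilpotent
  have hsolv : Group.IsSolvable O := inferInstance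
  have h3 := hirr (commutator O) ?_
  · rcases h3 with h3 | h3
    · have : ⁅x, y⁆ ∈ commutator O := Subgroup.commutator_mem_commutator (mem_top x) (mem_top y)
      rw [h3, Subgroup.mem_bot, commutatorElement_eq_one_iff_mul_comm] at this
      exact this
    · exact absurd h3 (Group.IsSolvable.commutator_lt_top_of_nontrivial O).ne
  · intro g hg t ht t' ht'
    have : t' = θ ⟨g, hg⟩ t := Subtype.ext (by rw [ht', hθ])
    rw [this]
    exact mem_char inferInstance (θ ⟨g, hg⟩) ht

end
end SS

set_option linter.style.haveILetI false
set_option linter.unusedSectionVars false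
namespace SS
open Subgroup
universe u
section
variable {p : ℕ} {G : Type u} [Group G]

/-- maximal-order abelian subgroups -/
def MaxAb {P : Type*} [Group P] (A : Subgroup P) : Prop :=
  (∀ x ∈ A, ∀ y ∈ A, x * y = y * x) ∧
    ∀ B : Subgroup P, (∀ x ∈ B, ∀ y ∈ B, x * y = y * x) → Nat.card B ≤ Nat.card A

theorem MaxAb.map {P : Type*} [Group P] {A : Subgroup P} (h : MaxAb A) (φ : P ≃* P) :
    MaxAb (A.map φ.toMonoidHom) := by
  refine ⟨?_, ?_⟩
  · rintro _ ⟨x, hx, rfl⟩ _ ⟨y, hy, rfl⟩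
    rw [← map_mul, h.1 x hx y hy, map_mul]
  · intro B hB
    rw [Subgroup.card_map_of_injective φ.injective]
    exact h.2 B hB

def JJ (P : Type*) [Group P] : Subgroup P := sSup {A | MaxAb A}

theorem JJ_char (P : Type*) [Group P] : (JJ P).Characteristic := by
  rw [characteristic_iff_le_comap]
  intro φ
  refine sSup_le ?_
  intro A hA
  rw [← Subgroup.map_le_iff_le_comap]
  exact le_sSup (hA.map φ)

theorem exists_maxAb (P : Type*) [Group P] [Finite P] : ∃ A : Subgroup P, MaxAb A := by
  let T := {A : Subgroup P // ∀ x ∈ A, ∀ y ∈ A, x * y = y * x}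
  haveI : Nonempty T := ⟨⟨⊥, by simp⟩⟩
  obtain ⟨A, hA⟩ := Finite.exists_max (fun A : T => Nat.card A.1)
  exact ⟨A.1, A.2, fun B hB => hA ⟨B, hB⟩⟩

theorem JJ_ne_bot (P : Type*) [Group P] [Finite P] [Nontrivial P] : JJ P ≠ ⊥ := by
  obtain ⟨A, hA⟩ := exists_maxAb P
  obtain ⟨x, hx⟩ := exists_ne (1 : P)
  intro h
  have h1 : A ≤ ⊥ := h ▸ le_sSup hA
  have h2 := hA.2 (zpowers x) (by
    rintro _ ⟨a, rfl⟩ _ ⟨b, rfl⟩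
    exact (Commute.refl x).zpow_zpow a b)
  rw [le_bot_iff.1 h1, Subgroup.card_bot] at h2
  have h3 : 1 < Nat.card (zpowers x) := by
    rw [Subgroup.one_lt_card_iff_ne_bot]
    simpa using hx
  omega

variable {U : Subgroup G} [hUn : U.Normal] [hp : Fact p.Prime] [Finite G]

theorem MC.P_nontrivial (h : MC p G U) (P : Sylow p G) : Nontrivial P := by
  have := (Subgroup.nontrivial_iff_ne_bot U).2 h.hU1
  exact Function.Injective.nontrivial (Subgroup.inclusion_injective (h.U_le_P P))

theorem PC_of_normalizer_top {X : Subgroup G} (h : PC p (normalizer (X : Set G)))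
    (hX : ∀ g : G, g ∈ normalizer (X : Set G)) : PC p G := by
  refine PC.of_injective ((MonoidHom.id G).codRestrict _ hX) ?_ h
  intro a b hab
  exact congrArg Subtype.val hab

theorem MC.exists_A (h : MC p G U) (P : Sylow p G) :
    ∃ A : Subgroup P, MaxAb A ∧ ¬ A.map P.1.subtype ≤ U := by
  by_contra hc
  push Not at hc
  haveI := h.P_nontrivial P
  refine h.hG (PC_of_normalizer_top (h.hT P (JJ P) (JJ_char P) (JJ_ne_bot P)) ?_)
  intro g
  apply mem_normalizer_fintype
  rintro _ ⟨x, hx, rfl⟩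
  have key : JJ P ≤ (((JJ P).map P.1.subtype).comap (MulAut.conj g).toMonoidHom).comap P.1.subtype := by
    refine sSup_le ?_
    intro A hA a ha
    have hA' : (A.map P.1.subtype).map (MulAut.conj g).toMonoidHom ≤ P.1 := by
      refine le_trans ?_ (h.U_le_P P)
      rintro _ ⟨x, hx, rfl⟩
      exact hUn.conj_mem x (hc A hA hx) g
    have hM : MaxAb (((A.map P.1.subtype).map (MulAut.conj g).toMonoidHom).subgroupOf P.1) := by
      refine ⟨?_, ?_⟩
      · rintro x ⟨_, ⟨x', hx', rfl⟩, hx⟩ y ⟨_, ⟨y', hy', rfl⟩, hy⟩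
        apply Subtype.ext
        change P.1.subtype x * P.1.subtype y = P.1.subtype y * P.1.subtype x
        rw [← hx, ← hy, ← map_mul, ← map_mul, ← map_mul, ← map_mul, hA.1 x' hx' y' hy']
      · intro B hB
        rw [Nat.card_congr (Subgroup.subgroupOfEquivOfLe hA').toEquiv,
          Subgroup.card_map_of_injective (MulAut.conj g).injective,
          Subgroup.card_map_of_injective P.1.subtype_injective]
        exact hA.2 B hB
    have hle := le_sSup (show _ ∈ {A | MaxAb A} from hM)
    refine ⟨⟨MulAut.conj g a, hA' ⟨_, ⟨a, ha, rfl⟩, rfl⟩⟩, hle ?_, rfl⟩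
    exact ⟨_, ⟨a, ha, rfl⟩, rfl⟩
  exact key hx

/-- Ω₁(Z(U)) -/
def OmZ (p : ℕ) (U : Subgroup G) : Subgroup G where
  carrier := {x | x ∈ U ∧ x ^ p = 1 ∧ ∀ u ∈ U, u * x = x * u}
  one_mem' := by simp
  mul_mem' := by
    rintro x y ⟨h1, h2, h3⟩ ⟨h4, h5, h6⟩
    refine ⟨mul_mem h1 h4, ?_, ?_⟩
    · rw [(show Commute x y from h6 x h1).mul_pow, h2, h5, one_mul]
    · intro u hu
      rw [← mul_assoc, h3 u hu, mul_assoc, h6 u hu, mul_assoc]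
  inv_mem' := by
    rintro x ⟨h1, h2, h3⟩
    refine ⟨inv_mem h1, by rw [inv_pow, h2, inv_one], ?_⟩
    intro u hu
    exact ((show Commute u x from h3 u hu).inv_right).eq

theorem OmZ_normal : (OmZ p U).Normal := by
  constructor
  rintro x ⟨h1, h2, h3⟩ g
  refine ⟨hUn.conj_mem x h1 g, ?_, ?_⟩
  · rw [conj_pow, h2]; group
  · intro u hu
    have h4 := h3 (g⁻¹ * u * g) (by simpa using hUn.conj_mem u hu g⁻¹)
    have h5 : u * (g * x * g⁻¹) = g * ((g⁻¹ * u * g) * x) * g⁻¹ := by group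
    rw [h5, h4]; group

theorem MC.centV (h : MC p G U) (P : Sylow p G) : centralizer (OmZ p U : Set G) ≤ U := by
  haveI := OmZ_normal (p := p) (U := U)
  haveI := h.K_normal
  have hUC : U ≤ centralizer (OmZ p U : Set G) := by
    intro u hu
    rw [mem_centralizer_iff]
    intro x hx
    exact (hx.2.2 u hu).symm
  rcases h.D P (h.K hp.out.ne_one ⊓ centralizer (OmZ p U : Set G)) (le_inf h.U_le_K hUC) inf_le_left
    (by
      have : normalizer ((h.K hp.out.ne_one ⊓ centralizer (OmZ p U : Set G) : Subgroup G) : Set G)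
        = ⊤ := normalizer_eq_top_iff.2 inferInstance
      rw [this]; exact le_top) with h1 | h1
  · refine h.hmax _ inferInstance (isPGroup_sub_of_eq_one ?_)
    intro x hx hxp
    refine eq_one_of_mem_pgroup h.hU ?_ hxp
    rw [← h1]
    exact ⟨h.mem_K_of hxp, hx⟩
  · exfalso
    have hK : h.K hp.out.ne_one ≤ centralizer (OmZ p U : Set G) := inf_eq_left.1 h1
    haveI := h.P_nontrivial P
    let W : Subgroup P := OmZ p ⊤
    have hWc : W.Characteristic := by
      rw [characteristic_iff_le_comap]
      rintro φ x ⟨_, h2, h3⟩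
      refine ⟨mem_top _, ?_, ?_⟩
      · rw [← map_pow]; change φ (x ^ p) = 1
        rw [h2, map_one]
      · intro u _
        have := congrArg φ (h3 (φ.symm u) (mem_top _))
        simpa using this
    have hWne : W ≠ ⊥ := by
      haveI := (IsPGroup.center_nontrivial P.2)
      have h3 : IsPGroup p (center P) := P.2.to_subgroup _
      obtain ⟨k, hk0, hk⟩ := h3.nontrivial_iff_card.1 inferInstance
      have hd : p ∣ Nat.card (center P) := by rw [hk]; exact dvd_pow_self p hk0.ne'
      obtain ⟨z, hz⟩ := exists_prime_orderOf_dvd_card' p hd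
      intro hW
      have hzW : (z : P) ∈ W := by
        refine ⟨mem_top _, ?_, ?_⟩
        · have h4 : z ^ p = 1 := orderOf_dvd_iff_pow_eq_one.1 hz.dvd
          exact congrArg Subtype.val h4
        · intro u _
          exact Subgroup.mem_center_iff.1 z.2 u
      rw [hW, Subgroup.mem_bot] at hzW
      have : z = 1 := Subtype.ext hzW
      rw [this, orderOf_one] at hz
      exact hp.out.ne_one hz.symm
    have hWV : W.map P.1.subtype ≤ OmZ p U := by
      rintro _ ⟨x, ⟨_, h2, h3⟩, rfl⟩
      have h4 : ∀ u ∈ P.1, u * (x : G) = x * u :=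
        fun u hu => congrArg Subtype.val (h3 ⟨u, hu⟩ (mem_top _))
      refine ⟨h.cent ?_, ?_, ?_⟩
      · rw [mem_centralizer_iff]
        intro u hu
        exact h4 u (h.U_le_P P hu)
      · exact congrArg Subtype.val h2
      · intro u hu
        exact h4 u (h.U_le_P P hu)
    refine h.hG (PC_of_normalizer_top (h.hT P W hWc hWne) ?_)
    have hN : normalizer ((W.map P.1.subtype : Subgroup G) : Set G) = ⊤ := by
      have hPN : P.1 ≤ normalizer ((W.map P.1.subtype : Subgroup G) : Set G) := by
        have := normalizer_char_le P.1.subtype P.1.subtype_injective W hWc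
        rw [Subgroup.range_subtype] at this
        exact le_normalizer.trans this
      have hKN : h.K hp.out.ne_one ≤ normalizer ((W.map P.1.subtype : Subgroup G) : Set G) := by
        intro k hk
        apply mem_normalizer_fintype
        intro x hx
        have := mem_centralizer_iff.1 (hK hk) x (hWV hx)
        rw [← this, mul_inv_cancel_right]; exact hx
      have hi1 := Subgroup.index_dvd_of_le hPN
      have hi2 := Subgroup.index_dvd_of_le hKN
      have hi3 : (h.K hp.out.ne_one).index = (h.hGU.O hp.out.ne_one).index := index_comap_mk _ _
      haveI := h.hGU.O_normal hp.out.ne_one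
      obtain ⟨k, hk⟩ := IsPGroup.iff_card.1 (h.hGU.quot _ le_rfl)
      rw [← Subgroup.index_eq_card] at hk
      rw [hi3, hk] at hi2
      rw [← Subgroup.index_eq_one]
      exact Nat.Coprime.eq_one_of_dvd (Nat.Coprime.pow_right k
        ((hp.out.coprime_iff_not_dvd.2 (fun h3 => P.not_dvd_index (h3.trans hi1))).symm)) hi2
    intro g
    rw [hN]; exact mem_top g

theorem thompson_count' {B Q V : Type*} [Group B] [Group Q] [Group V] [Finite B] [Finite Q]
    [Finite V] (hB : ∀ x y : B, x * y = y * x) (hQc : ∀ x y : Q, x * y = y * x)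
    (hVc : ∀ x y : V, x * y = y * x)
    (hp3 : 3 ≤ p) (hV : ∀ v : V, v ^ p = 1) (hQ : ¬ p ∣ Nat.card Q)
    (θ : B →* MulAut Q) (σ : B →* MulAut V) (ρ : Q →* MulAut V)
    (hc : ∀ b u v, σ b (ρ u v) = ρ (θ b u) (σ b v))
    (N : Subgroup B) (hN : ∀ b, (∀ u, ρ (θ b u) = ρ u) → b ∈ N)
    (C : Subgroup V) (hC : ∀ c ∈ C, ∀ b, σ b c = c) (hidx : C.index ≤ N.index) : ∀ b, b ∈ N := by
  letI : CommGroup B := { ‹Group B› with mul_comm := hB }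
  letI : CommGroup Q := { ‹Group Q› with mul_comm := hQc }
  letI : CommGroup V := { ‹Group V› with mul_comm := hVc }
  exact thompson_count hp3 hV hQ θ σ ρ hc N hN C hC hidx

theorem MC.false (h : MC p G U) (hp3 : 3 ≤ p) : False := by
  obtain ⟨P⟩ : Nonempty (Sylow p G) := inferInstance
  obtain ⟨A0, hA0, hA0U⟩ := h.exists_A P
  apply hA0U
  set A := A0.map P.1.subtype with hA
  have hAP : A ≤ P.1 := Subgroup.map_subtype_le _
  have hAc : ∀ x ∈ A, ∀ y ∈ A, x * y = y * x := by
    rintro _ ⟨x, hx, rfl⟩ _ ⟨y, hy, rfl⟩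
    rw [← map_mul, hA0.1 x hx y hy, map_mul]
  have hAm : ∀ B : Subgroup G, B ≤ P.1 → (∀ x ∈ B, ∀ y ∈ B, x * y = y * x) →
      Nat.card B ≤ Nat.card A := by
    intro B hB hBc
    rw [hA, Subgroup.card_map_of_injective P.1.subtype_injective,
      ← Nat.card_congr (Subgroup.subgroupOfEquivOfLe hB).toEquiv]
    apply hA0.2
    intro x hx y hy
    exact Subtype.ext (hBc x hx y hy)
  set V := OmZ p U with hVd
  haveI hVn : V.Normal := OmZ_normal
  have hVU : V ≤ U := fun x hx => hx.1
  have hOcomm := h.Ocomm P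
  haveI hOn : (h.hGU.O hp.out.ne_one).Normal := h.hGU.O_normal _
  have hUker : U ≤ (MulAut.conjNormal (H := V)).ker := by
    intro u hu
    rw [MonoidHom.mem_ker]
    ext v
    rw [MulAut.conjNormal_apply, v.2.2.2 u hu]; simp
  let ρ0 : G ⧸ U →* MulAut V := QuotientGroup.lift U (MulAut.conjNormal (H := V))
    (fun u hu => hUker hu)
  have hρ0 : ∀ (g : G) (v : V), ((ρ0 (g : G ⧸ U) v : V) : G) = g * v * g⁻¹ :=
    fun g v => MulAut.conjNormal_apply _ _
  let θ : A →* MulAut (h.hGU.O hp.out.ne_one) :=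
    (MulAut.conjNormal).comp ((QuotientGroup.mk' U).comp A.subtype)
  have hθ : ∀ (a : A) (o : h.hGU.O hp.out.ne_one),
      ((θ a o : h.hGU.O hp.out.ne_one) : G ⧸ U) =
        ((a : G) : G ⧸ U) * (o : G ⧸ U) * ((a : G) : G ⧸ U)⁻¹ :=
    fun g o => MulAut.conjNormal_apply _ _
  let σ : A →* MulAut V := (MulAut.conjNormal (H := V)).comp A.subtype
  have hσ : ∀ (a : A) (v : V), ((σ a v : V) : G) = a * v * (a : G)⁻¹ :=
    fun g v => MulAut.conjNormal_apply _ _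
  let ρ : h.hGU.O hp.out.ne_one →* MulAut V := ρ0.comp (h.hGU.O hp.out.ne_one).subtype
  have key := thompson_count' (p := p) (B := A) (Q := h.hGU.O hp.out.ne_one) (V := V)
    (fun x y => Subtype.ext (hAc x x.2 y y.2)) hOcomm
    (fun x y => Subtype.ext (y.2.2.2 x x.2.1)) hp3 (fun v => Subtype.ext v.2.2.1)
    h.hGU.not_dvd_card θ σ ρ ?_ (U.subgroupOf A) ?_ (A.subgroupOf V) ?_ ?_
  · intro a ha
    exact key ⟨a, ha⟩
  · intro b u v
    obtain ⟨g, hg⟩ := QuotientGroup.mk_surjective (u : G ⧸ U)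
    apply Subtype.ext
    have h1 : ρ u = ρ0 (g : G ⧸ U) := by rw [hg]; rfl
    have h2 : ρ (θ b u) = ρ0 ((b * g * (b : G)⁻¹ : G) : G ⧸ U) := by
      change ρ0 (θ b u : h.hGU.O hp.out.ne_one) = _
      rw [hθ, ← hg]; rfl
    rw [h1, h2, hσ, hρ0, hρ0, hσ]
    group
  · intro b hb
    refine h.R P (hAP b.2) ?_
    intro k hk
    have h1 := hb ⟨(k : G ⧸ U), hk⟩
    have h2 : ρ0 (((b : G) * k * (b : G)⁻¹ : G) : G ⧸ U) = ρ0 (k : G ⧸ U) := by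
      have : ρ (θ b ⟨(k : G ⧸ U), hk⟩) = ρ0 (((b : G) * k * (b : G)⁻¹ : G) : G ⧸ U) := by
        change ρ0 ((θ b ⟨(k : G ⧸ U), hk⟩ : h.hGU.O hp.out.ne_one) : G ⧸ U) = _
        rw [hθ]; rfl
      rw [← this, h1]; rfl
    have h3 : k⁻¹ * ((b : G) * k * (b : G)⁻¹) ∈ U := by
      apply h.centV P
      rw [mem_centralizer_iff]
      intro v hv
      have h4 := DFunLike.congr_fun h2 ⟨v, hv⟩
      have h5 := congrArg Subtype.val h4
      rw [hρ0, hρ0] at h5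
      change (b : G) * k * (b : G)⁻¹ * v * ((b : G) * k * (b : G)⁻¹)⁻¹ = k * v * k⁻¹ at h5
      have h6 := mul_inv_eq_iff_eq_mul.1 h5
      rw [mul_assoc k⁻¹, h6]
      group
    have h4 := (QuotientGroup.eq (s := U)).2 h3
    rw [QuotientGroup.mk_mul, QuotientGroup.mk_mul] at h4
    rw [QuotientGroup.mk_inv] at h4
    exact (eq_mul_inv_iff_mul_eq.1 h4).symm
  · intro c hc b
    apply Subtype.ext
    rw [hσ, hAc b b.2 c hc, mul_inv_cancel_right]
  · have hVc : ∀ v ∈ V, ∀ u ∈ U, u * v = v * u := fun v hv => hv.2.2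
    set X := A ⊓ U with hX
    have hTc := hAm (X ⊔ V) (sup_le (inf_le_left.trans hAP) (hVU.trans (h.U_le_P P))) (by
      intro x hx y hy
      obtain ⟨a, ha, v, hv, rfl⟩ := Subgroup.mem_sup_of_normal_right.1 hx
      obtain ⟨b, hb, w, hw, rfl⟩ := Subgroup.mem_sup_of_normal_right.1 hy
      have c1 : Commute a b := hAc a ha.1 b hb.1
      have c2 : Commute a w := hVc w hw a ha.2
      have c3 : Commute b v := hVc v hv b hb.2
      have c4 : Commute v w := hVc w hw v (hVU hv)
      exact ((c1.mul_right c2).mul_left (c3.symm.mul_right c4)).eq)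
    have e1 := card_mul_relIndex (le_sup_right : V ≤ X ⊔ V)
    have e2 := card_mul_relIndex (inf_le_right : V ⊓ X ≤ X)
    rw [Subgroup.relIndex_sup_right] at e1
    rw [Subgroup.inf_relIndex_right] at e2
    have e3 := card_mul_relIndex (inf_le_right : A ⊓ V ≤ V)
    rw [Subgroup.inf_relIndex_right] at e3
    have e4 := card_mul_relIndex (inf_le_right : U ⊓ A ≤ A)
    rw [Subgroup.inf_relIndex_right] at e4
    have e5 : V ⊓ X = A ⊓ V := by
      rw [hX]; ext x
      simp only [Subgroup.mem_inf]
      exact ⟨fun hx => ⟨hx.2.1, hx.1⟩, fun hx => ⟨hx.2, hx.1, hVU hx.2⟩⟩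
    rw [e5] at e2
    rw [inf_comm, ← hX] at e4
    change A.relIndex V ≤ U.relIndex A
    have p1 : 0 < Nat.card X := Nat.card_pos
    have p2 : 0 < Nat.card (A ⊓ V : Subgroup G) := Nat.card_pos
    rw [← e1, ← e4, ← e3] at hTc
    rw [← e2] at hTc p1
    have p3 : 0 < Nat.card (A ⊓ V : Subgroup G) * V.relIndex X := p1
    have : (Nat.card (A ⊓ V : Subgroup G) * V.relIndex X) * A.relIndex V ≤
      (Nat.card (A ⊓ V : Subgroup G) * V.relIndex X) * U.relIndex A := by
      calc _ = _ := by ring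
        _ ≤ _ := hTc
    exact Nat.le_of_mul_le_mul_left this p3

end

theorem thompson_PC_aux {p : ℕ} [hp : Fact p.Prime] (hp3 : 3 ≤ p) : ∀ n : ℕ,
    ∀ (G : Type u) [Group G] [Finite G], Nat.card G = n → THyp p G → PC p G := by
  intro n
  induction n using Nat.strong_induction_on with
  | _ n ih =>
    intro G _ _ hn hT
    by_contra hG
    obtain ⟨U, hU, hM⟩ := exists_MC (p := p) (G := G)
      (fun H _ _ hlt hH => ih _ (hn ▸ hlt) H rfl hH) hT hG
    exact hM.false hp3

theorem thompson_PC {p : ℕ} [hp : Fact p.Prime] (hp3 : 3 ≤ p) {G : Type u} [Group G] [Finite G]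
    (hT : THyp p G) : PC p G := thompson_PC_aux hp3 _ G rfl hT

end SS

set_option linter.style.haveILetI false
set_option linter.unusedSectionVars false
namespace SS
open Subgroup
universe u v
section
variable {A : Type v} [Group A] {G : Type u} [Group G]

def Inv (θ : A →* MulAut G) (N : Subgroup G) : Prop := ∀ a, ∀ n ∈ N, θ a n ∈ N

theorem Inv.mem_iff {θ : A →* MulAut G} {N : Subgroup G} (h : Inv θ N) (a : A) {n : G} :
    θ a n ∈ N ↔ n ∈ N := by
  refine ⟨fun hn => ?_, h a n⟩
  have := h a⁻¹ _ hn
  rwa [map_inv, MulAut.inv_apply_self] at this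

theorem th_inv_apply (θ : A →* MulAut G) (a : A) (x : G) : θ a⁻¹ (θ a x) = x := by
  rw [map_inv, MulAut.inv_apply_self]

theorem th_apply_inv (θ : A →* MulAut G) (a : A) (x : G) : θ a (θ a⁻¹ x) = x := by
  rw [map_inv, MulAut.apply_inv_self]

theorem th_mul (θ : A →* MulAut G) (a b : A) (x : G) : θ (a * b) x = θ a (θ b x) := by
  rw [map_mul]; rfl

theorem th_one (θ : A →* MulAut G) (x : G) : θ 1 x = x := by
  rw [map_one]; rfl

def res (θ : A →* MulAut G) (N : Subgroup G) (h : Inv θ N) : A →* MulAut N where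
  toFun a :=
    { toFun := fun x => ⟨θ a x, h a x x.2⟩
      invFun := fun x => ⟨θ a⁻¹ x, h a⁻¹ x x.2⟩
      left_inv := fun x => Subtype.ext (th_inv_apply θ a x)
      right_inv := fun x => Subtype.ext (th_apply_inv θ a x)
      map_mul' := fun x y => Subtype.ext (map_mul (θ a) (x : G) y) }
  map_one' := by ext x; exact th_one θ x
  map_mul' a b := by ext x; exact th_mul θ a b x

@[simp] theorem res_coe (θ : A →* MulAut G) (N : Subgroup G) (h : Inv θ N) (a : A) (x : N) :
    ((res θ N h a x : N) : G) = θ a x := rfl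

def quo (θ : A →* MulAut G) (N : Subgroup G) [N.Normal] (h : Inv θ N) : A →* MulAut (G ⧸ N) where
  toFun a :=
    { toFun := QuotientGroup.map N N (θ a).toMonoidHom (h a)
      invFun := QuotientGroup.map N N (θ a⁻¹).toMonoidHom (h a⁻¹)
      left_inv := by
        intro x
        obtain ⟨x, rfl⟩ := QuotientGroup.mk_surjective x
        exact congrArg QuotientGroup.mk (th_inv_apply θ a x)
      right_inv := by
        intro x
        obtain ⟨x, rfl⟩ := QuotientGroup.mk_surjective x
        exact congrArg QuotientGroup.mk (th_apply_inv θ a x)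
      map_mul' := map_mul _ }
  map_one' := by
    ext x
    obtain ⟨x, rfl⟩ := QuotientGroup.mk_surjective x
    exact congrArg QuotientGroup.mk (th_one θ x)
  map_mul' a b := by
    ext x
    obtain ⟨x, rfl⟩ := QuotientGroup.mk_surjective x
    exact congrArg QuotientGroup.mk (th_mul θ a b x)

@[simp] theorem quo_mk (θ : A →* MulAut G) (N : Subgroup G) [N.Normal] (h : Inv θ N) (a : A)
    (x : G) : quo θ N h a (x : G ⧸ N) = ((θ a x : G) : G ⧸ N) := rfl

theorem Inv.map_char {θ : A →* MulAut G} {N : Subgroup G} (h : Inv θ N) {K : Subgroup N}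
    (hK : K.Characteristic) : Inv θ (K.map N.subtype) := by
  rintro a _ ⟨x, hx, rfl⟩
  exact ⟨res θ N h a x, mem_char hK _ hx, rfl⟩

theorem Inv.map_res {θ : A →* MulAut G} {N : Subgroup G} (h : Inv θ N) {K : Subgroup N}
    (hK : Inv (res θ N h) K) : Inv θ (K.map N.subtype) := by
  rintro a _ ⟨x, hx, rfl⟩
  exact ⟨res θ N h a x, hK a x hx, rfl⟩

theorem Inv.comap_quo {θ : A →* MulAut G} {N : Subgroup G} [N.Normal] (h : Inv θ N)
    {K : Subgroup (G ⧸ N)}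
    (hK : Inv (quo θ N h) K) : Inv θ (K.comap (QuotientGroup.mk' N)) := by
  intro a x hx
  exact hK a _ hx

theorem Inv.normalizer {θ : A →* MulAut G} {N : Subgroup G} (h : Inv θ N) :
    Inv θ (normalizer (N : Set G)) := by
  intro a g hg
  rw [mem_normalizer_iff] at hg ⊢
  intro x
  have h1 := hg (θ a⁻¹ x)
  rw [h.mem_iff a⁻¹] at h1
  rw [h1, ← h.mem_iff a]
  simp

theorem Inv_char {θ : A →* MulAut G} {K : Subgroup G} (hK : K.Characteristic) : Inv θ K :=
  fun a _ hx => mem_char hK (θ a) hx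

theorem OmZ_inv {p : ℕ} {θ : A →* MulAut G} {N : Subgroup G} (h : Inv θ N) : Inv θ (OmZ p N) := by
  rintro a x ⟨h1, h2, h3⟩
  refine ⟨h a x h1, by rw [← map_pow, h2, map_one], ?_⟩
  intro u hu
  have := congrArg (θ a) (h3 (θ a⁻¹ u) (h _ _ hu))
  simpa using this

theorem OmZ_ne_bot {p : ℕ} [hp : Fact p.Prime] [Finite G] {N : Subgroup G} (hN : IsPGroup p N)
    (h1 : N ≠ ⊥) : OmZ p N ≠ ⊥ := by
  haveI := (Subgroup.nontrivial_iff_ne_bot N).2 h1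
  haveI := hN.center_nontrivial
  have h3 : IsPGroup p (center N) := hN.to_subgroup _
  obtain ⟨k, hk0, hk⟩ := h3.nontrivial_iff_card.1 inferInstance
  have hd : p ∣ Nat.card (center N) := by rw [hk]; exact dvd_pow_self p hk0.ne'
  obtain ⟨z, hz⟩ := exists_prime_orderOf_dvd_card' p hd
  intro hW
  have hzW : ((z : N) : G) ∈ OmZ p N := by
    refine ⟨(z : N).2, ?_, ?_⟩
    · have h4 : z ^ p = 1 := orderOf_dvd_iff_pow_eq_one.1 hz.dvd
      exact congrArg (fun t : center N => ((t : N) : G)) h4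
    · intro u hu
      exact congrArg Subtype.val (Subgroup.mem_center_iff.1 z.2 ⟨u, hu⟩)
  rw [hW, Subgroup.mem_bot] at hzW
  have : z = 1 := Subtype.ext (Subtype.ext hzW)
  rw [this, orderOf_one] at hz
  exact hp.out.ne_one hz.symm

variable [Finite G]

theorem nil_sylow_normal {q : ℕ} [hq : Fact q.Prime] (h : Group.IsNilpotent G) (S : Sylow q G) :
    S.1.Normal := by
  have h0 : Group.IsNilpotent G ↔ ∀ (p : ℕ) (_hp : Fact p.Prime) (P : Sylow p G),
      (↑P : Subgroup G).Normal := Group.isNilpotent_of_finite_tfae.out 0 3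
  exact h0.1 h q hq S

theorem nil_sylow_char {q : ℕ} [hq : Fact q.Prime] (h : Group.IsNilpotent G) (S : Sylow q G) :
    S.1.Characteristic := S.characteristic_of_normal (nil_sylow_normal h S)

theorem le_sylow_of_normal {q : ℕ} [hq : Fact q.Prime] {S : Sylow q G} (hS : S.1.Normal)
    {X : Subgroup G} (hX : IsPGroup q X) : X ≤ S.1 := by
  obtain ⟨T, hT⟩ := hX.exists_le_sylow
  have := S.unique_of_normal hS
  have : T = S := Subsingleton.elim _ _
  rwa [this] at hT

/-- normal nilpotent invariant subgroup with q | order gives an invariant normal q-subgroup -/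
theorem exists_normal_q {q : ℕ} [hq : Fact q.Prime] {θ : A →* MulAut G} {N : Subgroup G}
    (hN : N.Normal) (hi : Inv θ N) (hnil : Group.IsNilpotent N) (hd : q ∣ Nat.card N) :
    ∃ Q : Subgroup G, Q.Normal ∧ Inv θ Q ∧ IsPGroup q Q ∧ Q ≠ ⊥ ∧ Q ≤ N := by
  obtain ⟨S⟩ : Nonempty (Sylow q N) := inferInstance
  haveI := nil_sylow_char hnil S
  refine ⟨S.1.map N.subtype, ConjAct.normal_of_characteristic_of_normal, hi.map_char this,
    S.2.map _, ?_, Subgroup.map_subtype_le _⟩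
  rw [Ne, Subgroup.map_eq_bot_iff_of_injective _ N.subtype_injective]
  exact S.ne_bot_of_dvd_card hd

/-- normal, invariant, elementary abelian -/
structure Elem (p : ℕ) (θ : A →* MulAut G) (V : Subgroup G) : Prop where
  normal : V.Normal
  inv : Inv θ V
  comm : ∀ x ∈ V, ∀ y ∈ V, x * y = y * x
  exp : ∀ x ∈ V, x ^ p = 1

theorem Elem_OmZ {p : ℕ} [Fact p.Prime] {θ : A →* MulAut G} {N : Subgroup G} (hN : N.Normal) (hi : Inv θ N) :
    Elem p θ (OmZ p N) :=
  ⟨OmZ_normal, OmZ_inv hi, fun x hx _ hy => (hy.2.2 x hx.1), fun _ hx => hx.2.1⟩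

theorem Elem.isPGroup {p : ℕ} {θ : A →* MulAut G} {V : Subgroup G} (h : Elem p θ V) :
    IsPGroup p V := fun x => ⟨1, by rw [pow_one]; exact Subtype.ext (h.exp x x.2)⟩

theorem card_quot_lt {M : Subgroup G} (hM : M ≠ ⊥) : Nat.card (G ⧸ M) < Nat.card G := by
  rw [Subgroup.card_eq_card_quotient_mul_card_subgroup M]
  have h1 : 1 < Nat.card M := by
    rwa [Subgroup.one_lt_card_iff_ne_bot]
  have h2 : 0 < Nat.card (G ⧸ M) := Nat.card_pos
  nlinarith

theorem THyp_of_one {p : ℕ} [hp : Fact p.Prime] (P : Sylow p G)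
    (h : ∀ K : Subgroup P, K.Characteristic → K ≠ ⊥ →
    PC p (normalizer ((K.map P.1.subtype : Subgroup G) : Set G))) : THyp p G := by
  intro Q K hK hK1
  obtain ⟨g, hg⟩ := MulAction.exists_smul_eq G P Q
  have hf : Function.Injective ((MulAut.conj g).toMonoidHom.comp P.1.subtype) :=
    (MulAut.conj g).injective.comp P.1.subtype_injective
  have hr : Q.1 = ((MulAut.conj g).toMonoidHom.comp P.1.subtype).range := by
    rw [MonoidHom.range_comp, Subgroup.range_subtype, ← hg]; rfl
  let e : P ≃* Q := (MonoidHom.ofInjective hf).trans (MulEquiv.subgroupCongr hr.symm)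
  have h1 := h _ (char_map_equiv e.symm K hK) (by
    rw [Ne, Subgroup.map_eq_bot_iff_of_injective _ e.symm.injective]; exact hK1)
  refine PC_normalizer_of_map (MulAut.conj g⁻¹).toMonoidHom (MulAut.conj g⁻¹).injective ?_
  rw [Subgroup.map_map] at h1 ⊢
  have : (MulAut.conj g⁻¹).toMonoidHom.comp Q.1.subtype =
      P.1.subtype.comp e.symm.toMonoidHom := by
    ext x
    have h3 : e (e.symm x) = x := e.apply_symm_apply x
    have h4 : g * (e.symm x : G) * g⁻¹ = x := congrArg Subtype.val h3
    change g⁻¹ * (x : G) * g⁻¹⁻¹ = (e.symm x : G)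
    rw [← h4]; group
  rw [this]; exact h1

theorem nilp_of_injective {G' : Type*} [Group G'] (h : Group.IsNilpotent G') (f : G →* G')
    (hf : Function.Injective f) : Group.IsNilpotent G := by
  haveI := h
  haveI : Group.IsNilpotent f.range := inferInstance
  exact Group.nilpotent_of_mulEquiv (MonoidHom.ofInjective hf).symm

theorem nilp_of_pgroup_quot {p : ℕ} [hp : Fact p.Prime] {V : Subgroup G} [V.Normal]
    (hV : IsPGroup p V) (h : IsPGroup p (G ⧸ V)) : IsPGroup p G := by
  have h1 : IsPGroup p (⊤ : Subgroup (G ⧸ V)) := h.to_subgroup _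
  have h2 := isPGroup_comap_mk hV h1
  rw [Subgroup.comap_top] at h2
  exact h2.of_equiv Subgroup.topEquiv

end

theorem thmX {A : Type v} [Group A]
    (PP : ∀ (G : Type u) [Group G] [Finite G], (A →* MulAut G) → Prop)
    (hsub : ∀ (G : Type u) [Group G] [Finite G] (θ : A →* MulAut G), PP G θ →
      ∀ (N : Subgroup G) (h : Inv θ N), PP N (res θ N h))
    (hquo : ∀ (G : Type u) [Group G] [Finite G] (θ : A →* MulAut G), PP G θ →
      ∀ (p : ℕ) (_ : p.Prime) (V : Subgroup G) [V.Normal] (h : Elem p θ V),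
        PP (G ⧸ V) (quo θ V h.inv))
    (h3 : ∀ (G : Type u) [Group G] [Finite G] (θ : A →* MulAut G), PP G θ →
      (∀ N : Subgroup G, Inv θ N → N ≠ ⊤ → Group.IsNilpotent N) → ¬ Group.IsNilpotent G →
      ∃ p : ℕ, p.Prime ∧ 3 ≤ p ∧ ∃ P : Subgroup G, IsPGroup p P ∧ P ≠ ⊥ ∧ Inv θ P)
    (h4 : ∀ (G : Type u) [Group G] [Finite G] (θ : A →* MulAut G), PP G θ →
      ∀ (p q : ℕ) (_ : p.Prime) (_ : q.Prime) (_ : p ≠ q) (V : Subgroup G) (_ : Elem p θ V)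
        (_ : ∀ x y : G, x * y * x⁻¹ * y⁻¹ ∈ V) (_ : ∀ x : G, x ^ q ∈ V)
        (_ : ∀ N : Subgroup G, Inv θ N → V ≤ N → N = V ∨ N = ⊤),
        ∀ v ∈ V, ∀ g : G, g * v = v * g) :
    ∀ n : ℕ, ∀ (G : Type u) [Group G] [Finite G] (θ : A →* MulAut G), Nat.card G = n → PP G θ →
      Group.IsNilpotent G := by
  intro n
  induction n using Nat.strong_induction_on with
  | _ n ih =>
  intro G _ _ θ hn hP
  by_contra hG
  have hprop : ∀ N : Subgroup G, Inv θ N → N ≠ ⊤ → Group.IsNilpotent N := by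
    intro N hN hne
    exact ih _ (hn ▸ card_lt_of_ne_top hne) N (res θ N hN) rfl (hsub G θ hP N hN)
  -- Step 1
  obtain ⟨N, hNn, hNi, hN1, hN2⟩ : ∃ N : Subgroup G, N.Normal ∧ Inv θ N ∧ N ≠ ⊥ ∧ N ≠ ⊤ := by
    by_contra hcon
    have hsimple : ∀ N : Subgroup G, N.Normal → Inv θ N → N = ⊥ ∨ N = ⊤ := by
      intro N a b
      by_contra hc
      push Not at hc
      exact hcon ⟨N, a, b, hc.1, hc.2⟩
    obtain ⟨p, hp, hp3, P0, hP0, hP0ne, hP0i⟩ := h3 G θ hP hprop hG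
    haveI : Fact p.Prime := ⟨hp⟩
    let T := {P : Subgroup G // IsPGroup p P ∧ P ≠ ⊥ ∧ Inv θ P}
    haveI : Nonempty T := ⟨⟨P0, hP0, hP0ne, hP0i⟩⟩
    obtain ⟨⟨P, hPp, hPne, hPi⟩, hmax⟩ := Finite.exists_max (fun P : T => Nat.card P.1)
    have hmax' : ∀ Q : Subgroup G, IsPGroup p Q → Inv θ Q → P ≤ Q → Q = P := by
      intro Q a b c
      refine (Subgroup.eq_of_le_of_card_ge c (hmax ⟨Q, a, ?_, b⟩)).symm
      rintro rfl
      exact hPne (le_bot_iff.1 c)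
    have hPtop : P ≠ ⊤ := by
      rintro rfl
      exact hG (hPp.of_equiv Subgroup.topEquiv).isNilpotent
    have hNP : normalizer (P : Set G) ≠ ⊤ := by
      intro h
      rcases hsimple P (normalizer_eq_top_iff.1 h) hPi with h1 | h1
      · exact hPne h1
      · exact hPtop h1
    have hNnil := hprop _ hPi.normalizer hNP
    obtain ⟨S, hS⟩ := hPp.exists_le_sylow
    have hPS : P = S.1 := by
      by_contra hne
      have hlt := lt_inf_normalizer S.2 (lt_of_le_of_ne hS hne)
      obtain ⟨N, hN⟩ : ∃ N, N = normalizer (P : Set G) := ⟨_, rfl⟩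
      have hPi' := hPi.normalizer
      have hPN : P ≤ normalizer (P : Set G) := le_normalizer
      rw [← hN] at hNnil hlt hPi' hPN
      obtain ⟨Q⟩ : Nonempty (Sylow p N) := inferInstance
      have hX : (S.1 ⊓ N).subgroupOf N ≤ Q.1 :=
        le_sylow_of_normal (nil_sylow_normal hNnil Q)
          ((S.2.to_le inf_le_left : IsPGroup p (S.1 ⊓ N : Subgroup G)).comap_subtype)
      have hX' : S.1 ⊓ N ≤ Q.1.map N.subtype := by
        intro x hx
        exact ⟨⟨x, hx.2⟩, hX hx, rfl⟩
      have h5 := hmax' (Q.1.map N.subtype) (Q.2.map _) (hPi'.map_char (nil_sylow_char hNnil Q))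
        (hlt.le.trans hX')
      rw [h5] at hX'
      exact absurd (lt_of_lt_of_le hlt hX') (lt_irrefl _)
    subst hPS
    have hT : THyp p G := by
      refine THyp_of_one S ?_
      intro K hK hK1
      have hKi := hPi.map_char hK
      have hKne : K.map S.1.subtype ≠ ⊥ := by
        rw [Ne, Subgroup.map_eq_bot_iff_of_injective _ S.1.subtype_injective]; exact hK1
      refine PC_of_nilpotent (hprop _ hKi.normalizer ?_)
      intro h
      rcases hsimple _ (normalizer_eq_top_iff.1 h) hKi with h1 | h1
      · exact hKne h1
      · apply hPtop
        rw [eq_top_iff, ← h1]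
        exact Subgroup.map_subtype_le _
    have hPC := thompson_PC hp3 hT
    have hOi : Inv θ (hPC.O hp.ne_one) := fun a x hx => not_dvd_map (θ a).toMonoidHom hx
    rcases hsimple _ (hPC.O_normal hp.ne_one) hOi with h1 | h1
    · apply hG
      refine IsPGroup.isNilpotent (p := p) (isPGroup_of_eq_one ?_)
      intro x hx
      have : x ∈ hPC.O hp.ne_one := hx
      rw [h1] at this; exact this
    · apply hPne
      rw [eq_bot_iff]
      intro x hx
      refine eq_one_of_mem_pgroup S.2 hx ?_
      have : x ∈ hPC.O hp.ne_one := h1 ▸ mem_top x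
      exact this
  -- Step 2
  obtain ⟨p, hp, V, hV, hVne⟩ : ∃ p : ℕ, p.Prime ∧ ∃ V, Elem p θ V ∧ V ≠ ⊥ := by
    have hc : Nat.card N ≠ 1 := by rwa [Ne, Subgroup.card_eq_one]
    haveI hp : Fact (Nat.card N).minFac.Prime := ⟨Nat.minFac_prime hc⟩
    obtain ⟨Q, hQ1, hQ2, hQ3, hQ4, -⟩ := exists_normal_q hNn hNi (hprop N hNi hN2)
      (Nat.minFac_dvd (Nat.card N))
    exact ⟨_, hp.out, OmZ _ Q, Elem_OmZ hQ1 hQ2, OmZ_ne_bot hQ3 hQ4⟩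
  haveI : Fact p.Prime := ⟨hp⟩
  have hquonil : ∀ (p : ℕ) (_ : p.Prime) (V : Subgroup G) [V.Normal] (_ : Elem p θ V),
      V ≠ ⊥ → Group.IsNilpotent (G ⧸ V) := by
    intro p hp V _ hV hVne
    exact ih _ (hn ▸ card_quot_lt hVne) (G ⧸ V) (quo θ V hV.inv) rfl (hquo G θ hP p hp V hV)
  haveI := hV.normal
  have hGV := hquonil p hp V hV hVne
  have hstar : ∀ q : ℕ, q.Prime → p ≠ q → ∀ Q : Subgroup G, Q.Normal → Inv θ Q → IsPGroup q Q →
      Q = ⊥ := by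
    intro q hq hpq Q hQn hQi hQq
    by_contra hQne
    haveI : Fact q.Prime := ⟨hq⟩
    have hW := Elem_OmZ (p := q) hQn hQi
    have hWne := OmZ_ne_bot hQq hQne
    haveI := hW.normal
    have hGW := hquonil q hq _ hW hWne
    apply hG
    haveI := hGV
    haveI := hGW
    have hprod : Group.IsNilpotent ((G ⧸ V) × (G ⧸ OmZ q Q)) := inferInstance
    refine nilp_of_injective hprod ((QuotientGroup.mk' V).prod (QuotientGroup.mk' (OmZ q Q))) ?_
    rw [injective_iff_map_eq_one]
    intro x hx
    have hx1 : x ∈ V := (QuotientGroup.eq_one_iff x).1 (congrArg Prod.fst hx)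
    have hx2 : x ∈ OmZ q Q := (QuotientGroup.eq_one_iff x).1 (congrArg Prod.snd hx)
    have d1 := orderOf_dvd_of_pow_eq_one (hV.exp x hx1)
    have d2 := orderOf_dvd_of_pow_eq_one hx2.2.1
    rw [← orderOf_eq_one_iff]
    exact Nat.eq_one_of_dvd_coprimes ((Nat.coprime_primes hp hq).2 hpq) d1 d2
  -- Step 3
  obtain ⟨q, hq, hpq, hqd⟩ : ∃ q : ℕ, q.Prime ∧ p ≠ q ∧ q ∣ Nat.card (G ⧸ V) := by
    by_contra hc
    push Not at hc
    apply hG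
    refine IsPGroup.isNilpotent (p := p) (nilp_of_pgroup_quot hV.isPGroup ?_)
    apply isPGroup_of_eq_one
    intro x hx
    by_contra hx1
    have h5 : orderOf x ≠ 1 := by rwa [Ne, orderOf_eq_one_iff]
    refine hc _ (Nat.minFac_prime h5) ?_ ((Nat.minFac_dvd _).trans (orderOf_dvd_natCard x))
    intro h6
    exact hx (h6 ▸ Nat.minFac_dvd _)
  haveI : Fact q.Prime := ⟨hq⟩
  obtain ⟨Q⟩ : Nonempty (Sylow q (G ⧸ V)) := inferInstance
  have hQc := nil_sylow_char hGV Q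
  haveI hQn := nil_sylow_normal hGV Q
  have hQi : Inv (quo θ V hV.inv) Q.1 := Inv_char hQc
  have hW := Elem_OmZ (p := q) hQn hQi
  have hWne := OmZ_ne_bot Q.2 (Q.ne_bot_of_dvd_card hqd)
  set W := OmZ q Q.1 with hWd
  haveI := hW.normal
  have hTi : Inv θ (W.comap (QuotientGroup.mk' V)) := hV.inv.comap_quo hW.inv
  have hTtop : W.comap (QuotientGroup.mk' V) = ⊤ := by
    by_contra hne
    have hnil := hprop _ hTi hne
    have hd : q ∣ Nat.card (W.comap (QuotientGroup.mk' V)) := by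
      have h5 : W.map (MonoidHom.id _) = W := Subgroup.map_id W
      have h6 : (W.comap (QuotientGroup.mk' V)).map (QuotientGroup.mk' V) = W :=
        Subgroup.map_comap_eq_self_of_surjective (QuotientGroup.mk'_surjective V) W
      have h7 : Nat.card W ∣ Nat.card (W.comap (QuotientGroup.mk' V)) := by
        conv_lhs => rw [← h6]
        exact Subgroup.card_map_dvd _ _
      refine dvd_trans ?_ h7
      haveI := (Subgroup.nontrivial_iff_ne_bot W).2 hWne
      obtain ⟨k, hk0, hk⟩ := hW.isPGroup.nontrivial_iff_card.1 inferInstance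
      rw [hk]; exact dvd_pow_self q hk0.ne'
    obtain ⟨R, hR1, hR2, hR3, hR4, -⟩ := exists_normal_q inferInstance hTi hnil hd
    exact hR4 (hstar q hq hpq R hR1 hR2 hR3)
  have hGW : ∀ x : G, (x : G ⧸ V) ∈ W := by
    intro x
    have : x ∈ W.comap (QuotientGroup.mk' V) := hTtop ▸ mem_top x
    exact this
  have hcomm : ∀ x y : G, x * y * x⁻¹ * y⁻¹ ∈ V := by
    intro x y
    rw [← QuotientGroup.eq_one_iff]
    have := hW.comm _ (hGW x) _ (hGW y)
    change (x : G ⧸ V) * y * (x : G ⧸ V)⁻¹ * (y : G ⧸ V)⁻¹ = 1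
    rw [this]; group
  have hpow : ∀ x : G, x ^ q ∈ V := by
    intro x
    rw [← QuotientGroup.eq_one_iff, QuotientGroup.mk_pow]
    exact hW.exp _ (hGW x)
  have hcent := h4 G θ hP p q hp hq hpq V hV hcomm hpow (by
    intro N hNi hVN
    by_cases hNt : N = ⊤
    · exact Or.inr hNt
    · left
      refine le_antisymm ?_ hVN
      have hnil := hprop N hNi hNt
      have hNn : N.Normal := ⟨fun x hx g => by
        have h5 := mul_mem (hVN (hcomm g x)) hx
        simpa using h5⟩
      have hnd : ¬ q ∣ Nat.card N := by
        intro hd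
        obtain ⟨R, hR1, hR2, hR3, hR4, -⟩ := exists_normal_q hNn hNi hnil hd
        exact hR4 (hstar q hq hpq R hR1 hR2 hR3)
      intro x hx
      have hco : Nat.Coprime q (Nat.card N) := hq.coprime_iff_not_dvd.2 hnd
      have h5 : (x : G) ^ Nat.card N = 1 := by
        have := pow_card_eq_one' (x := (⟨x, hx⟩ : N))
        exact congrArg Subtype.val this
      have h6 : orderOf (x : G ⧸ V) ∣ Nat.card N := by
        apply orderOf_dvd_of_pow_eq_one
        rw [← QuotientGroup.mk_pow, h5]; rfl
      have h7 : orderOf (x : G ⧸ V) ∣ q := by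
        apply orderOf_dvd_of_pow_eq_one
        rw [← QuotientGroup.mk_pow, QuotientGroup.eq_one_iff]
        exact hpow x
      rw [← QuotientGroup.eq_one_iff, ← orderOf_eq_one_iff]
      exact Nat.eq_one_of_dvd_coprimes hco h7 h6)
  apply hG
  haveI := hGV
  refine Subgroup.isNilpotent_of_ker_le_center (QuotientGroup.mk' V) ?_
  rw [QuotientGroup.ker_mk']
  intro v hv
  rw [Subgroup.mem_center_iff]
  exact hcent v hv

end SS

set_option linter.style.haveILetI false
set_option linter.unusedSectionVars false
namespace SS
open Subgroup
universe u v

theorem fpf_inj {G : Type*} [Group G] (φ : MulAut G) (h : ∀ g, φ g = g → g = 1) :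
    Function.Injective (fun g => g⁻¹ * φ g) := by
  intro x y hxy
  have hxy : x⁻¹ * φ x = y⁻¹ * φ y := hxy
  have : φ (x * y⁻¹) = x * y⁻¹ := by
    rw [map_mul, map_inv]
    have : φ x = x * y⁻¹ * φ y := by rw [mul_assoc, ← hxy]; group
    rw [this]; group
  exact mul_inv_eq_one.1 (h _ this)

theorem fpf_surj {G : Type*} [Group G] [Finite G] (φ : MulAut G) (h : ∀ g, φ g = g → g = 1) :
    Function.Surjective (fun g => g⁻¹ * φ g) :=
  Finite.surjective_of_injective (fpf_inj φ h)

theorem frob_act {A U V : Type*} [Group A] [Finite A] [Group U] [Finite U] [CommGroup V]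
    (α : A →* MulAut U) (τ : A →* MulAut V) (ρ : U →* MulAut V)
    (hc : ∀ a u v, τ a (ρ u v) = ρ (α a u) (τ a v))
    (hα : ∀ a, a ≠ 1 → ∀ u, α a u = u → u = 1)
    (hτ : ∀ v, (∀ a, τ a v = v) → v = 1) {n : ℕ} (hn : ∀ v : V, v ^ n = 1)
    (hco : Nat.Coprime (Nat.card U) n) (u : U) (v : V) : ρ u v = v := by
  classical
  haveI := Fintype.ofFinite A
  haveI := Fintype.ofFinite U
  have h1 : ∀ v : V, ∏ a, τ a v = 1 := by
    intro v
    apply hτ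
    intro b
    rw [map_prod]
    exact Fintype.prod_equiv (Equiv.mulLeft b) _ _ (fun a => by
      simp [map_mul, MulAut.mul_apply])
  have h2 : ∏ w : U, ∏ a, ρ (w⁻¹ * α a w) (τ a v) = 1 := by
    apply Finset.prod_eq_one
    intro w _
    have : ∀ a, ρ (w⁻¹ * α a w) (τ a v) = ρ w⁻¹ (τ a (ρ w v)) := by
      intro a; rw [hc, map_mul]; rfl
    simp_rw [this]
    rw [← map_prod, h1, map_one]
  rw [Finset.prod_comm] at h2
  have h3 : ∀ w : V, ρ u (∏ x : U, ρ x w) = ∏ x : U, ρ x w := by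
    intro w
    rw [map_prod]
    exact Fintype.prod_equiv (Equiv.mulLeft u) _ _ (fun a => by
      simp [map_mul, MulAut.mul_apply])
  rw [← Finset.mul_prod_erase _ _ (Finset.mem_univ (1 : A))] at h2
  have h4 : ∏ w : U, ρ (w⁻¹ * α 1 w) (τ 1 v) = v ^ Nat.card U := by
    simp
  have h5 : ρ u (∏ a ∈ Finset.univ.erase (1 : A), ∏ w : U, ρ (w⁻¹ * α a w) (τ a v)) =
      ∏ a ∈ Finset.univ.erase (1 : A), ∏ w : U, ρ (w⁻¹ * α a w) (τ a v) := by
    rw [map_prod]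
    apply Finset.prod_congr rfl
    intro a ha
    have ha1 : a ≠ 1 := (Finset.mem_erase.1 ha).1
    have : ∏ w : U, ρ (w⁻¹ * α a w) (τ a v) = ∏ w : U, ρ w (τ a v) :=
      Function.Bijective.prod_comp
        (⟨fpf_inj _ (hα a ha1), fpf_surj _ (hα a ha1)⟩ :
          Function.Bijective (fun w => w⁻¹ * α a w)) (fun w => ρ w (τ a v))
    rw [this, h3]
  rw [h4] at h2
  have h6 : ρ u (v ^ Nat.card U) = v ^ Nat.card U := by
    rw [eq_inv_of_mul_eq_one_left h2, map_inv, h5]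
  rw [map_pow] at h6
  have h7 : (ρ u v * v⁻¹) ^ Nat.card U = 1 := by
    rw [mul_pow, h6, inv_pow, mul_inv_cancel]
  have h8 : orderOf (ρ u v * v⁻¹) = 1 :=
    Nat.eq_one_of_dvd_coprimes hco (orderOf_dvd_of_pow_eq_one h7)
      (orderOf_dvd_of_pow_eq_one (hn _))
  exact mul_inv_eq_one.1 (orderOf_eq_one_iff.1 h8)

/-- conjugation action of `G/V` on abelian normal `V` -/
def cact {G : Type*} [Group G] (V : Subgroup G) [V.Normal]
    (hV : ∀ x ∈ V, ∀ y ∈ V, x * y = y * x) : G ⧸ V →* MulAut V :=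
  QuotientGroup.lift V MulAut.conjNormal (by
    intro x hx
    ext y
    change x * (y : G) * x⁻¹ = y
    rw [hV x hx y y.2]; group)

theorem cact_mk {G : Type*} [Group G] (V : Subgroup G) [V.Normal]
    (hV : ∀ x ∈ V, ∀ y ∈ V, x * y = y * x) (g : G) (v : V) :
    ((cact V hV (g : G ⧸ V) v : V) : G) = g * v * g⁻¹ := rfl

abbrev commOf {G : Type*} [Group G] (V : Subgroup G)
    (hV : ∀ x ∈ V, ∀ y ∈ V, x * y = y * x) : CommGroup V :=
  { (inferInstance : Group V) with mul_comm := fun x y => Subtype.ext (hV x x.2 y y.2) }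

theorem card_quot_coprime {G : Type*} [Group G] [Finite G] {p q : ℕ} (hp : p.Prime) (hq : q.Prime)
    (hpq : p ≠ q) (V : Subgroup G) [V.Normal] (h : ∀ x : G, x ^ q ∈ V) :
    ¬ p ∣ Nat.card (G ⧸ V) := by
  haveI : Fact q.Prime := ⟨hq⟩
  have h1 : IsPGroup q (G ⧸ V) := by
    intro x
    obtain ⟨x, rfl⟩ := QuotientGroup.mk_surjective x
    exact ⟨1, by rw [pow_one, ← QuotientGroup.mk_pow, QuotientGroup.eq_one_iff]; exact h x⟩
  obtain ⟨k, hk⟩ := IsPGroup.iff_card.1 h1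
  rw [hk]
  intro hd
  exact hpq ((Nat.prime_dvd_prime_iff_eq hp hq).1 (hp.dvd_of_dvd_pow hd))

theorem exists_odd_prime {G : Type*} [Group G] [Finite G] (hG : ¬ Group.IsNilpotent G) :
    ∃ p : ℕ, p.Prime ∧ 3 ≤ p ∧ p ∣ Nat.card G := by
  by_contra hc
  push Not at hc
  apply hG
  haveI : Fact (2 : ℕ).Prime := ⟨Nat.prime_two⟩
  refine IsPGroup.isNilpotent (p := 2) (isPGroup_of_eq_one ?_)
  intro x hx
  by_contra hx1
  have h5 : orderOf x ≠ 1 := by rwa [Ne, orderOf_eq_one_iff]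
  have hp := Nat.minFac_prime h5
  refine hc _ hp ?_ ((Nat.minFac_dvd _).trans (orderOf_dvd_natCard x))
  have := hp.two_le
  rcases this.eq_or_lt with h | h
  · exact absurd (h ▸ Nat.minFac_dvd _) hx
  · exact h

theorem thompson_fpf {A : Type v} [Group A] [Finite A] [Nontrivial A] (a0 : A)
    (ha0 : ∀ a : A, a ∈ zpowers a0) (G : Type u) [Group G] [Finite G] (θ : A →* MulAut G)
    (hθ : ∀ a, a ≠ 1 → ∀ g, θ a g = g → g = 1) : Group.IsNilpotent G := by
  refine thmX (A := A) (fun G _ _ θ => ∀ a, a ≠ 1 → ∀ g, θ a g = g → g = 1) ?_ ?_ ?_ ?_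
    _ G θ rfl hθ
  · intro G _ _ θ h N hN a ha g hg
    exact Subtype.ext (h a ha g (congrArg Subtype.val hg))
  · intro G _ _ θ h p hp V _ hV a ha g hg
    obtain ⟨g, rfl⟩ := QuotientGroup.mk_surjective g
    rw [quo_mk] at hg
    have h1 : g⁻¹ * θ a g ∈ V := QuotientGroup.eq.1 hg.symm
    obtain ⟨v, hv⟩ := fpf_surj (res θ V hV.inv a)
      (fun x hx => Subtype.ext (h a ha x (congrArg Subtype.val hx))) ⟨_, h1⟩
    have h2 : (v : G)⁻¹ * θ a v = g⁻¹ * θ a g := congrArg Subtype.val hv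
    have h3 := fpf_inj (θ a) (h a ha) h2
    rw [← h3]
    exact (QuotientGroup.eq_one_iff _).2 v.2
  · intro G _ _ θ h hprop hG
    obtain ⟨p, hp, hp3, hpd⟩ := exists_odd_prime hG
    haveI : Fact p.Prime := ⟨hp⟩
    obtain ⟨P⟩ : Nonempty (Sylow p G) := inferInstance
    have ha1 : a0 ≠ 1 := by
      rintro rfl
      obtain ⟨b, hb⟩ := exists_ne (1 : A)
      have := ha0 b
      simp at this
      exact hb this
    have hφ : IsPGroup p (P.1.map (θ a0).toMonoidHom) := P.2.map _
    obtain ⟨Q, hQ⟩ := hφ.exists_le_sylow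
    obtain ⟨x, hx⟩ := MulAction.exists_smul_eq G P Q
    obtain ⟨g, hg⟩ := fpf_surj (θ a0) (h a0 ha1) x⁻¹
    have hg : g⁻¹ * θ a0 g = x⁻¹ := hg
    refine ⟨p, hp, hp3, (g • P : Sylow p G).1, (g • P : Sylow p G).2,
      (g • P : Sylow p G).ne_bot_of_dvd_card hpd, ?_⟩
    have key : ∀ y ∈ (g • P : Sylow p G), θ a0 y ∈ (g • P : Sylow p G) := by
      intro y hy
      rw [mem_smul_sylow] at hy ⊢
      have h1 : θ a0 (g⁻¹ * y * g) ∈ Q := hQ ⟨_, hy, rfl⟩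
      rw [← hx, mem_smul_sylow] at h1
      convert h1 using 1
      have h2 : x = (θ a0 g)⁻¹ * g := by rw [← inv_inj, ← hg]; group
      rw [h2]; simp [mul_assoc]
    intro a y hy
    obtain ⟨n, rfl⟩ := (mem_powers_iff_mem_zpowers.2 (ha0 a))
    clear hpd
    induction n with
    | zero => simpa using hy
    | succ n ih =>
      change θ (a0 ^ (n+1)) y ∈ _
      rw [pow_succ', th_mul]; exact key _ ih
  · intro G _ _ θ h p q hp hq hpq V hV hcomm hpow hirr v hv g
    haveI := hV.normal
    letI := commOf V hV.comm
    have h1 := frob_act (quo θ V hV.inv) (res θ V hV.inv) (cact V hV.comm) ?_ ?_ ?_ (n := p)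
      (fun v => Subtype.ext (hV.exp v v.2))
      (((hp.coprime_iff_not_dvd).2 (card_quot_coprime hp hq hpq V hpow)).symm) (g : G ⧸ V) ⟨v, hv⟩
    · have h2 : g * v * g⁻¹ = v := congrArg Subtype.val h1
      rw [mul_inv_eq_iff_eq_mul] at h2; exact h2
    · intro a u v
      obtain ⟨g, rfl⟩ := QuotientGroup.mk_surjective u
      apply Subtype.ext
      change θ a (g * v * g⁻¹) = θ a g * θ a v * (θ a g)⁻¹
      simp
    · intro a ha g hg
      obtain ⟨g, rfl⟩ := QuotientGroup.mk_surjective g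
      rw [quo_mk] at hg
      have h1 : g⁻¹ * θ a g ∈ V := QuotientGroup.eq.1 hg.symm
      obtain ⟨v, hv⟩ := fpf_surj (res θ V hV.inv a)
        (fun x hx => Subtype.ext (h a ha x (congrArg Subtype.val hx))) ⟨_, h1⟩
      have h2 : (v : G)⁻¹ * θ a v = g⁻¹ * θ a g := congrArg Subtype.val hv
      have h3 := fpf_inj (θ a) (h a ha) h2
      rw [← h3]
      exact (QuotientGroup.eq_one_iff _).2 v.2
    · intro v hv
      obtain ⟨b, hb⟩ := exists_ne (1 : A)
      exact Subtype.ext (h b hb v (congrArg Subtype.val (hv b)))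

/-- Thompson: a Frobenius kernel is nilpotent. -/
theorem frob_kernel_nilp {A : Type u} [Group A] [Finite A] (F H : Subgroup A) (hF : F.Normal)
    (hHne : H ≠ ⊥) (hfrob : ∀ h ∈ H, h ≠ 1 → ∀ f ∈ F, h * f * h⁻¹ = f → f = 1) :
    Group.IsNilpotent F := by
  obtain ⟨h, hh, h1⟩ := H.ne_bot_iff_exists_ne_one.1 hHne |>.elim fun x hx =>
    (⟨x.1, x.2, fun h => hx (Subtype.ext h)⟩ : ∃ h, h ∈ H ∧ h ≠ 1)
  haveI : Nontrivial (zpowers h) := ⟨⟨⟨h, mem_zpowers h⟩, 1, fun e => h1 (congrArg Subtype.val e)⟩⟩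
  refine thompson_fpf (A := zpowers h) ⟨h, mem_zpowers h⟩ ?_ F
    ((MulAut.conjNormal : A →* MulAut F).comp (zpowers h).subtype) ?_
  · rintro ⟨a, n, rfl⟩
    exact ⟨n, Subtype.ext (by simp)⟩
  · rintro ⟨a, ha⟩ hne f hf
    have ha' : a ∈ H := (zpowers_le.2 hh) ha
    exact Subtype.ext (hfrob a ha' (fun e => hne (Subtype.ext e)) f f.2 (congrArg Subtype.val hf))

end SS

set_option linter.style.haveILetI false
set_option linter.unusedSectionVars false
namespace SS
open Subgroup
universe u v

theorem nilp_of_le {A : Type*} [Group A] {K E : Subgroup A} (h : K ≤ E)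
    (hE : Group.IsNilpotent E) : Group.IsNilpotent K := by
  haveI := hE
  haveI : Group.IsNilpotent (K.subgroupOf E) := inferInstance
  exact Group.nilpotent_of_mulEquiv (Subgroup.subgroupOfEquivOfLe h)

theorem decomp {A : Type*} [Group A] [Finite A] {E : Subgroup A} (hE : E.Normal)
    (hnil : Group.IsNilpotent E) (s : ℕ) [hs : Fact s.Prime] :
    ∃ P K : Subgroup A, P.Normal ∧ K.Normal ∧ IsPGroup s P ∧ ¬ s ∣ Nat.card K ∧ P ⊔ K = E := by
  obtain ⟨S⟩ : Nonempty (Sylow s E) := inferInstance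
  haveI := nil_sylow_char hnil S
  have hPC : PC s E := PC_of_nilpotent hnil
  haveI : (hPC.O hs.out.ne_one).Characteristic := by
    rw [Subgroup.characteristic_iff_le_comap]
    intro φ x hx
    exact not_dvd_map φ.toMonoidHom hx
  refine ⟨S.1.map E.subtype, (hPC.O hs.out.ne_one).map E.subtype,
    ConjAct.normal_of_characteristic_of_normal, ConjAct.normal_of_characteristic_of_normal,
    S.2.map _, ?_, ?_⟩
  · rw [Subgroup.card_map_of_injective E.subtype_injective]
    exact hPC.not_dvd_card
  · rw [← Subgroup.map_sup]
    have : S.1 ⊔ hPC.O hs.out.ne_one = ⊤ := by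
      rw [eq_top_iff]
      intro x _
      obtain ⟨o, ho, t, ht, rfl⟩ := hPC.exists_mul S x
      exact mul_mem (mem_sup_right ho) (mem_sup_left ht)
    rw [this, ← MonoidHom.range_eq_map, Subgroup.range_subtype]

theorem pfix {A Ω : Type*} [Group A] {s : ℕ} [Fact s.Prime] {P : Subgroup A}
    (hP : IsPGroup s P) (f : A → Ω → Ω) (f1 : ∀ x, f 1 x = x)
    (f2 : ∀ a b x, f (a * b) x = f a (f b x)) (X : Set Ω) [Finite X]
    (hX : ∀ a ∈ P, ∀ x ∈ X, f a x ∈ X) :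
    Nat.card X ≡ Nat.card {x // x ∈ X ∧ ∀ a ∈ P, f a x = x} [MOD s] := by
  letI : MulAction P X :=
    { smul := fun a x => ⟨f a x, hX a a.2 x x.2⟩
      one_smul := fun x => Subtype.ext (f1 x)
      mul_smul := fun a b x => Subtype.ext (f2 a b x) }
  have h := hP.card_modEq_card_fixedPoints X
  have e : MulAction.fixedPoints P X ≃ {x // x ∈ X ∧ ∀ a ∈ P, f a x = x} :=
    { toFun := fun x => ⟨x.1.1, x.1.2, fun a ha => congrArg Subtype.val (x.2 ⟨a, ha⟩)⟩
      invFun := fun x => ⟨⟨x.1, x.2.1⟩, fun a => Subtype.ext (x.2.2 a a.2)⟩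
      left_inv := fun x => rfl
      right_inv := fun x => rfl }
  rwa [Nat.card_congr e] at h

theorem pfix_exists {A Ω : Type*} [Group A] {s : ℕ} [hs : Fact s.Prime] {P : Subgroup A}
    (hP : IsPGroup s P) (f : A → Ω → Ω) (f1 : ∀ x, f 1 x = x)
    (f2 : ∀ a b x, f (a * b) x = f a (f b x)) (X : Set Ω) [Finite X]
    (hX : ∀ a ∈ P, ∀ x ∈ X, f a x ∈ X) (hc : ¬ s ∣ Nat.card X) :
    ∃ x ∈ X, ∀ a ∈ P, f a x = x := by
  have h := pfix hP f f1 f2 X hX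
  by_contra hn
  haveI : IsEmpty {x // x ∈ X ∧ ∀ a ∈ P, f a x = x} := ⟨fun x => hn ⟨x.1, x.2⟩⟩
  have h0 : Nat.card {x // x ∈ X ∧ ∀ a ∈ P, f a x = x} = 0 := Nat.card_of_isEmpty
  rw [h0] at h
  exact hc ((Nat.modEq_zero_iff_dvd).1 h)

section
variable {A : Type v} [Group A] {G : Type u} [Group G]

def Fx (θ : A →* MulAut G) (S : Subgroup A) : Subgroup G where
  carrier := {g | ∀ s ∈ S, θ s g = g}
  one_mem' := fun s _ => map_one _
  mul_mem' := fun {x y} hx hy s hs => by rw [map_mul, hx s hs, hy s hs]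
  inv_mem' := fun {x} hx s hs => by rw [map_inv, hx s hs]

theorem mem_Fx {θ : A →* MulAut G} {S : Subgroup A} {g : G} :
    g ∈ Fx θ S ↔ ∀ s ∈ S, θ s g = g := Iff.rfl

theorem Fx_inv {θ : A →* MulAut G} {S : Subgroup A} (hS : S.Normal) : Inv θ (Fx θ S) := by
  intro a g hg s hs
  have h1 := hg (a⁻¹ * s * a) (by simpa using hS.conj_mem s hs a⁻¹)
  rw [← th_mul, show s * a = a * (a⁻¹ * s * a) by group, th_mul, h1]

theorem Fx_sup {θ : A →* MulAut G} {S T : Subgroup A} : Fx θ (S ⊔ T) = Fx θ S ⊓ Fx θ T := by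
  apply le_antisymm
  · exact fun g hg => ⟨fun s hs => hg s (mem_sup_left hs), fun s hs => hg s (mem_sup_right hs)⟩
  · rintro g ⟨h1, h2⟩
    let C : Subgroup A :=
      { carrier := {a | θ a g = g}
        one_mem' := th_one θ g
        mul_mem' := fun {a b} ha hb => by
          change θ (a * b) g = g
          rw [th_mul, hb, ha]
        inv_mem' := fun {a} ha => by
          change θ a⁻¹ g = g
          conv_lhs => rw [← (show θ a g = g from ha)]
          rw [th_inv_apply] }
    have : S ⊔ T ≤ C := sup_le h1 h2
    exact fun s hs => this hs

theorem Fx_anti {θ : A →* MulAut G} {S T : Subgroup A} (h : S ≤ T) : Fx θ T ≤ Fx θ S :=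
  fun _ hg s hs => hg s (h hs)

theorem Fx_card_mod [Finite G] {θ : A →* MulAut G} {P K : Subgroup A} (hP : K.Normal) {s : ℕ}
    [Fact s.Prime] (hs : IsPGroup s P) :
    Nat.card (Fx θ K) ≡ Nat.card (Fx θ (P ⊔ K)) [MOD s] := by
  have h := pfix hs (fun a g => θ a g) (th_one θ) (th_mul θ) (Fx θ K : Set G)
    (fun a _ x hx => Fx_inv hP a x hx)
  have e : {x // x ∈ (Fx θ K : Set G) ∧ ∀ a ∈ P, θ a x = x} ≃ Fx θ (P ⊔ K) :=
    Equiv.subtypeEquivRight (fun x => by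
      rw [Fx_sup]
      exact ⟨fun h => ⟨h.2, h.1⟩, fun h => ⟨h.2, h.1⟩⟩)
  rw [Nat.card_congr e] at h
  exact h

theorem Fx_bot' {θ : A →* MulAut G} : Fx θ ⊥ = ⊤ := by
  rw [eq_top_iff]
  intro g _ s hs
  rw [mem_bot.1 hs, th_one]

theorem Fx_res {θ : A →* MulAut G} {S : Subgroup A} {N : Subgroup G} (h : Inv θ N) (x : N) :
    x ∈ Fx (res θ N h) S ↔ (x : G) ∈ Fx θ S :=
  ⟨fun hx s hs => congrArg Subtype.val (hx s hs), fun hx s hs => Subtype.ext (hx s hs)⟩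

theorem Fx_res_bot {θ : A →* MulAut G} {S : Subgroup A} {N : Subgroup G} (h : Inv θ N)
    (h0 : Fx θ S = ⊥) : Fx (res θ N h) S = ⊥ := by
  rw [eq_bot_iff]
  intro x hx
  rw [Fx_res, h0] at hx
  exact Subtype.ext hx
end

theorem cocycle {S V : Type*} [Group S] [Finite S] [CommGroup V] (τ : S →* MulAut V)
    (π : V →* V) (T : Finset S) (_hT : ∀ s, s ∈ T) (hπ : ∀ v, ∏ s ∈ T, τ s (π (τ s⁻¹ v)) = v)
    (d : S → V) (hd : ∀ s t, d (s * t) = d s * τ s (d t)) : ∃ w, ∀ s, d s * τ s w = w := by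
  classical
  letI := Fintype.ofFinite S
  have hTu : T = Finset.univ := Finset.eq_univ_iff_forall.2 _hT
  subst hTu
  refine ⟨∏ t, τ t (π (τ t⁻¹ (d t))), fun s => ?_⟩
  have h1 : τ s (∏ t, τ t (π (τ t⁻¹ (d t)))) =
      ∏ t, τ (s * t) (π (τ (s * t)⁻¹ (τ s (d t)))) := by
    rw [map_prod]
    apply Finset.prod_congr rfl
    intro t _
    rw [th_mul, mul_inv_rev, th_mul, th_inv_apply]
  have h2 : ∀ t, τ s (d t) = (d s)⁻¹ * d (s * t) := by
    intro t; rw [hd]; group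
  simp_rw [h2] at h1
  rw [h1, Function.Bijective.prod_comp (Group.mulLeft_bijective s)
    (fun t => τ t (π (τ t⁻¹ ((d s)⁻¹ * d t))))]
  simp_rw [map_mul]
  rw [Finset.prod_mul_distrib, hπ]
  group

theorem higman {S : Type*} {G : Type*} [Group S] [Finite S] [Group G] (θ : S →* MulAut G)
    (V : Subgroup G) (hcomm : ∀ x ∈ V, ∀ y ∈ V, x * y = y * x) (hV : Inv θ V)
    (h : letI := commOf V hcomm
      ∃ π : V →* V, ∃ T : Finset S, (∀ s, s ∈ T) ∧
        ∀ v, ∏ s ∈ T, res θ V hV s (π (res θ V hV s⁻¹ v)) = v)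
    (g : G) (hg : ∀ s, g⁻¹ * θ s g ∈ V) : ∃ v ∈ V, ∀ s, θ s (g * v) = g * v := by
  letI := commOf V hcomm
  obtain ⟨π, T, hT, hπ⟩ := h
  obtain ⟨w, hw⟩ := cocycle (res θ V hV) π T hT hπ (fun s => ⟨_, hg s⟩) (fun s t => by
    apply Subtype.ext
    change g⁻¹ * θ (s * t) g = g⁻¹ * θ s g * θ s (g⁻¹ * θ t g)
    rw [th_mul]; simp [mul_assoc])
  refine ⟨w, w.2, fun s => ?_⟩
  have h1 : g⁻¹ * θ s g * θ s w = w := congrArg Subtype.val (hw s)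
  conv_rhs => rw [← h1]
  simp [mul_assoc]
end SS

set_option linter.style.haveILetI false
set_option linter.unusedSectionVars false
namespace SS
open Subgroup
universe u v

structure Frob {A : Type v} [Group A] (F H : Subgroup A) : Prop where
  normal : F.Normal
  sup : F ⊔ H = ⊤
  frob : ∀ h ∈ H, h ≠ 1 → ∀ f ∈ F, h * f * h⁻¹ = f → f = 1
  nil : Group.IsNilpotent F

theorem bot_of_mod {G : Type*} [Group G] [Finite G] {p : ℕ} [hp : Fact p.Prime] {X : Subgroup G}
    (hX : IsPGroup p X) (h : Nat.card X ≡ 1 [MOD p]) : X = ⊥ := by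
  by_contra hne
  haveI := (Subgroup.nontrivial_iff_ne_bot X).2 hne
  obtain ⟨k, hk0, hk⟩ := hX.nontrivial_iff_card.1 inferInstance
  have h1 : p ∣ Nat.card X := by rw [hk]; exact dvd_pow_self p hk0.ne'
  have h2 := (Nat.ModEq.dvd_iff h dvd_rfl).1 h1
  exact hp.out.one_lt.ne' (Nat.dvd_one.1 h2)

section
variable {A : Type v} [Group A] [Finite A] {G : Type u} [Group G] [Finite G]
  {F H : Subgroup A} {θ : A →* MulAut G} {V : Subgroup G}

theorem exists_E (hA : Frob F H) (hF : Fx θ F = ⊥) {p : ℕ} [Fact p.Prime] (hV : IsPGroup p V)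
    (hi : Inv θ V) : ∃ E : Subgroup A, E.Normal ∧ E ≤ F ∧ ¬ p ∣ Nat.card E ∧
      Fx (res θ V hi) E = ⊥ := by
  obtain ⟨P, K, hP, hK, hPp, hKp, hs⟩ := decomp hA.normal hA.nil p
  refine ⟨K, hK, hs ▸ le_sup_right, hKp, ?_⟩
  have h1 := Fx_card_mod (θ := res θ V hi) (P := P) hK hPp
  rw [hs, Fx_res_bot hi hF, Subgroup.card_bot] at h1
  exact bot_of_mod (hV.to_subgroup _) h1

theorem prod_E_eq_one {E : Subgroup A} {V : Type*} [CommGroup V] {τ : A →* MulAut V} [Fintype E]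
    (h : Fx τ E = ⊥) (v : V) : ∏ f : E, τ f v = 1 := by
  have : ∏ f : E, τ f v ∈ Fx τ E := by
    intro s hs
    rw [map_prod]
    exact Fintype.prod_equiv (Equiv.mulLeft ⟨s, hs⟩) _ _ (fun f => by
      simp [map_mul, MulAut.mul_apply])
  rwa [h] at this

theorem frob_split (hA : Frob F H) {E : Subgroup A} (hE : E.Normal) (hEF : E ≤ F)
    {V : Type*} [CommGroup V] {τ : A →* MulAut V} (h : Fx τ E = ⊥) [Fintype H] :
    ∃ π : V →* V, ∀ v, ∏ s : H, τ s (π (τ (s : A)⁻¹ v)) = v := by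
  classical
  letI := Fintype.ofFinite E
  let X := {f : E // f ≠ 1}
  letI : MulAction H X :=
    { smul := fun s x => ⟨⟨s * x.1 * (s : A)⁻¹, hE.conj_mem _ x.1.2 _⟩, fun h => x.2 (by
        have h1 : (s : A) * x.1 * (s : A)⁻¹ = 1 := congrArg Subtype.val h
        apply Subtype.ext
        rw [mul_inv_eq_one, mul_eq_left] at h1
        exact h1)⟩
      one_smul := fun x => Subtype.ext (Subtype.ext (by
        change ((1 : H) : A) * x.1 * ((1 : H) : A)⁻¹ = x.1
        simp))
      mul_smul := fun s t x => Subtype.ext (Subtype.ext (by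
        change ((s * t : H) : A) * x.1 * ((s * t : H) : A)⁻¹ =
          s * (t * x.1 * (t : A)⁻¹) * (s : A)⁻¹
        push_cast; group)) }
  have hsm : ∀ (s : H) (x : X), ((s • x : X).1 : A) = s * x.1 * (s : A)⁻¹ := fun s x => rfl
  let Y := MulAction.orbitRel.Quotient H X
  haveI : Finite Y := Quotient.finite _
  letI : Fintype Y := Fintype.ofFinite _
  letI : Fintype X := Fintype.ofFinite _
  have hbij : Function.Bijective (fun t : H × Y => (t.1 • t.2.out : X)) := by
    constructor
    · rintro ⟨s, y⟩ ⟨t, z⟩ hst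
      have hst : s • y.out = t • z.out := hst
      have hyz : y = z := by
        rw [← Quotient.out_eq y, ← Quotient.out_eq z]
        apply Quotient.sound
        refine ⟨s⁻¹ * t, ?_⟩
        change (s⁻¹ * t) • z.out = y.out
        rw [mul_smul, ← hst, inv_smul_smul]
      subst hyz
      have h1 : (t⁻¹ * s) • y.out = y.out := by rw [mul_smul, hst, inv_smul_smul]
      by_contra hne
      have hne' : ((t⁻¹ * s : H) : A) ≠ 1 := by
        intro h2
        have h3 : t⁻¹ * s = 1 := Subtype.ext h2
        apply hne
        rw [inv_mul_eq_one] at h3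
        rw [h3]
      have h4 := hA.frob _ (t⁻¹ * s).2 hne' _ (hEF y.out.1.2) (by
        rw [← hsm, h1])
      exact y.out.2 (Subtype.ext h4)
    · intro x
      obtain ⟨s, hs⟩ : ∃ s : H, s • x = (Quotient.mk'' x : Y).out :=
        (Quotient.exact (Quotient.out_eq (Quotient.mk'' x : Y)) : _)
      exact ⟨(s⁻¹, Quotient.mk'' x), by
        change s⁻¹ • (Quotient.mk'' x : Y).out = x
        rw [← hs, inv_smul_smul]⟩
  let π : V →* V := ∏ y : Y, ((τ (y.out.1 : A)).toMonoidHom)⁻¹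
  have hπ : ∀ v, π v = ∏ y : Y, (τ (y.out.1 : A) v)⁻¹ := by
    intro v
    simp [π]
  refine ⟨π, fun v => ?_⟩
  have h1 : ∏ s : H, τ s (π (τ (s : A)⁻¹ v)) = ∏ x : X, (τ (x.1 : A) v)⁻¹ := by
    rw [← hbij.prod_comp (fun x => (τ (x.1 : A) v)⁻¹), Fintype.prod_prod_type]
    apply Finset.prod_congr rfl
    intro s _
    rw [hπ, map_prod]
    apply Finset.prod_congr rfl
    intro y _
    rw [map_inv, hsm, th_mul, th_mul]
  rw [h1]
  have h2 := prod_E_eq_one h v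
  rw [← Finset.mul_prod_erase _ _ (Finset.mem_univ (1 : E))] at h2
  have h3 : ∏ x : X, τ (x.1 : A) v = ∏ f ∈ Finset.univ.erase (1 : E), τ f v := by
    symm
    apply Finset.prod_subtype
    intro x; simp
  rw [← h3] at h2
  rw [Finset.prod_inv_distrib]
  simp only [OneMemClass.coe_one, th_one] at h2
  exact (eq_inv_of_mul_eq_one_left h2).symm


theorem cover_H (hA : Frob F H) (hF : Fx θ F = ⊥) {p : ℕ} [hp : Fact p.Prime] [V.Normal]
    (hV : Elem p θ V) (g : G) (hg : (g : G ⧸ V) ∈ Fx (quo θ V hV.inv) H) :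
    ∃ v ∈ V, g * v ∈ Fx θ H := by
  classical
  letI := Fintype.ofFinite H
  obtain ⟨E, hE, hEF, hEp, hE0⟩ := exists_E hA hF hV.isPGroup hV.inv
  have hinv : Inv (θ.comp H.subtype) V := fun a n hn => hV.inv a n hn
  obtain ⟨v, hv, h⟩ := higman (θ.comp H.subtype) V hV.comm hinv (by
    letI := commOf V hV.comm
    obtain ⟨π, hπ⟩ := frob_split hA hE hEF hE0
    exact ⟨π, Finset.univ, Finset.mem_univ, hπ⟩) g (fun s => QuotientGroup.eq.1 (hg s s.2).symm)
  exact ⟨v, hv, fun s hs => h ⟨s, hs⟩⟩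

theorem cover_F (hA : Frob F H) (hF : Fx θ F = ⊥) {p : ℕ} [hp : Fact p.Prime] [V.Normal]
    (hV : Elem p θ V) : Fx (quo θ V hV.inv) F = ⊥ := by
  classical
  rw [eq_bot_iff]
  intro x hx
  obtain ⟨g, rfl⟩ := QuotientGroup.mk_surjective x
  obtain ⟨E, hE, hEF, hEp, hE0⟩ := exists_E hA hF hV.isPGroup hV.inv
  letI := Fintype.ofFinite E
  have hinv : Inv (θ.comp E.subtype) V := fun a n hn => hV.inv a n hn
  have hmem : ∀ s ∈ F, g⁻¹ * θ s g ∈ V := fun s hs => QuotientGroup.eq.1 (hx s hs).symm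
  obtain ⟨v, hv, h⟩ := higman (θ.comp E.subtype) V hV.comm hinv (by
    letI := commOf V hV.comm
    obtain ⟨m, -, hm⟩ := Nat.exists_mul_mod_eq_one_of_coprime
      ((hp.out.coprime_iff_not_dvd.2 hEp).symm) hp.out.one_lt
    refine ⟨powMonoidHom m, Finset.univ, Finset.mem_univ, fun v => ?_⟩
    simp only [powMonoidHom_apply, map_pow, th_apply_inv, Finset.prod_const, Finset.card_univ]
    have hvp : v ^ p = 1 := Subtype.ext (hV.exp v v.2)
    rw [← pow_mul, mul_comm, ← Nat.card_eq_fintype_card, ← Nat.div_add_mod (Nat.card E * m) p, hm,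
      pow_add, pow_mul, hvp, one_pow, one_mul, pow_one]) g (fun s => hmem s (hEF s.2))
  have h0 : g * v ∈ Fx θ F := by
    intro f hf
    have h1 : g * v ∈ Fx θ E := fun s hs => h ⟨s, hs⟩
    have h2 : (g * v)⁻¹ * θ f (g * v) ∈ Fx θ E :=
      mul_mem (inv_mem h1) (Fx_inv hE f _ h1)
    have h3 : (g * v)⁻¹ * θ f (g * v) ∈ V := by
      have : (g * v)⁻¹ * θ f (g * v) = v⁻¹ * (g⁻¹ * θ f g) * θ f v := by
        simp [mul_assoc]
      rw [this]
      exact mul_mem (mul_mem (inv_mem hv) (hmem f hf)) (hV.inv _ _ hv)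
    have h4 : (⟨_, h3⟩ : V) ∈ Fx (res θ V hV.inv) E := (Fx_res hV.inv _).2 h2
    rw [hE0] at h4
    have h5 : (g * v)⁻¹ * θ f (g * v) = 1 := congrArg Subtype.val (mem_bot.1 h4)
    exact (inv_mul_eq_one.1 h5).symm
  rw [hF] at h0
  have h6 : g * v = 1 := h0
  rw [mem_bot]
  rw [QuotientGroup.eq_one_iff, eq_inv_of_mul_eq_one_left h6]
  exact inv_mem hv
end
end SS

set_option linter.style.haveILetI false
set_option linter.unusedSectionVars false
namespace SS
open Subgroup
universe u v

theorem exists_prime_dvd_of_ne_bot {A : Type*} [Group A] [Finite A] {E : Subgroup A} (h : E ≠ ⊥) :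
    ∃ s : ℕ, s.Prime ∧ s ∣ Nat.card E :=
  Nat.exists_prime_and_dvd (by rwa [Ne, Subgroup.card_eq_one])

theorem lt_of_decomp {A : Type*} [Group A] [Finite A] {K E : Subgroup A} {s : ℕ} (hKE : K ≤ E)
    (hs : s ∣ Nat.card E) (hK : ¬ s ∣ Nat.card K) : K < E :=
  lt_of_le_of_ne hKE (by rintro rfl; exact hK hs)

section
variable {A : Type v} [Group A] [Finite A] {G : Type u} [Group G] [Finite G]

theorem glauberman {θ : A →* MulAut G} {Ω : Type*} [Finite Ω] [Nonempty Ω] [MulAction G Ω]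
    [MulAction.IsPretransitive G Ω] (f : A → Ω → Ω) (f1 : ∀ x, f 1 x = x)
    (f2 : ∀ a b x, f (a * b) x = f a (f b x)) (hf : ∀ a (g : G) x, f a (g • x) = θ a g • f a x) :
    ∀ n : ℕ, ∀ E : Subgroup A, Nat.card E = n → E.Normal → Group.IsNilpotent E →
      (∀ s : ℕ, s.Prime → s ∣ Nat.card E → ¬ s ∣ Nat.card G) →
      (∃ x, ∀ e ∈ E, f e x = x) ∧
      ∀ x y, (∀ e ∈ E, f e x = x) → (∀ e ∈ E, f e y = y) → ∃ c ∈ Fx θ E, c • x = y := by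
  intro n
  induction n using Nat.strong_induction_on with
  | _ n ih =>
  intro E hn hE hnil hco
  by_cases hb : E = ⊥
  · subst hb
    refine ⟨?_, ?_⟩
    · obtain ⟨x⟩ := ‹Nonempty Ω›
      exact ⟨x, fun e he => by rw [mem_bot.1 he, f1]⟩
    · intro x y _ _
      obtain ⟨c, hc⟩ := MulAction.exists_smul_eq G x y
      exact ⟨c, by rw [Fx_bot']; trivial, hc⟩
  obtain ⟨s, hs, hsd⟩ := exists_prime_dvd_of_ne_bot hb
  haveI : Fact s.Prime := ⟨hs⟩
  obtain ⟨P, K, hP, hK, hPs, hKs, hPK⟩ := decomp hE hnil s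
  have hKE : K ≤ E := hPK ▸ le_sup_right
  have hPE : P ≤ E := hPK ▸ le_sup_left
  have hlt := lt_of_decomp hKE hsd hKs
  have hsG := hco s hs hsd
  obtain ⟨⟨x0, hx0⟩, htr⟩ := ih _ (hn ▸ card_lt_of_lt hlt) K rfl hK (nilp_of_le hKE hnil)
    (fun t ht htd => hco t ht (htd.trans (Subgroup.card_dvd_of_le hKE)))
  have hfixE : ∀ x, (∀ e ∈ K, f e x = x) → (∀ e ∈ P, f e x = x) → ∀ e ∈ E, f e x = x := by
    intro x h1 h2
    let C : Subgroup A :=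
      { carrier := {a | f a x = x}
        one_mem' := f1 x
        mul_mem' := fun {a b} ha hb => by
          change f (a * b) x = x
          rw [f2, hb, ha]
        inv_mem' := fun {a} ha => by
          change f a⁻¹ x = x
          conv_lhs => rw [← (show f a x = x from ha)]
          rw [← f2, inv_mul_cancel, f1] }
    have : E ≤ C := hPK ▸ sup_le h2 h1
    exact fun e he => this he
  have hKinv : ∀ a x, (∀ e ∈ K, f e x = x) → ∀ e ∈ K, f e (f a x) = f a x := by
    intro a x h e he
    rw [← f2, show e * a = a * (a⁻¹ * e * a) by group, f2, h]
    simpa using hK.conj_mem e he a⁻¹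
  have hsC : ∀ m, m ∣ Nat.card (Fx θ K) → ¬ s ∣ m :=
    fun m hm hsm => hsG (hsm.trans (hm.trans (Subgroup.card_subgroup_dvd_card _)))
  constructor
  · have hset : {x | ∀ e ∈ K, f e x = x} = MulAction.orbit (Fx θ K) x0 := by
      ext y
      constructor
      · intro hy
        obtain ⟨c, hc, h⟩ := htr x0 y hx0 hy
        exact ⟨⟨c, hc⟩, h⟩
      · rintro ⟨c, rfl⟩ e he
        change f e ((c : G) • x0) = (c : G) • x0
        rw [hf, c.2 e he, hx0 e he]
    obtain ⟨x, hx, hx'⟩ := pfix_exists hPs f f1 f2 {x | ∀ e ∈ K, f e x = x}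
      (fun a _ x hx => hKinv a x hx) (by
        rw [hset]
        apply hsC
        rw [Nat.card_coe_set_eq, ← MulAction.index_stabilizer]
        exact Subgroup.index_dvd_card _)
    exact ⟨x, hfixE x hx hx'⟩
  · intro x y hx hy
    obtain ⟨c0, hc0, h0⟩ := htr x y (fun e he => hx e (hKE he)) (fun e he => hy e (hKE he))
    let Z : Set G := {c | c ∈ Fx θ K ∧ c • x = y}
    have e : Z ≃ MulAction.stabilizer (Fx θ K) x :=
      { toFun := fun c => ⟨⟨c0⁻¹ * c.1, mul_mem (inv_mem hc0) c.2.1⟩, by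
          change (c0⁻¹ * c.1) • x = x
          rw [mul_smul, c.2.2, ← h0, inv_smul_smul]⟩
        invFun := fun t => ⟨c0 * t.1.1, mul_mem hc0 t.1.2, by
          have : (t.1.1 : G) • x = x := t.2
          rw [mul_smul, this, h0]⟩
        left_inv := fun c => Subtype.ext (by simp)
        right_inv := fun t => Subtype.ext (Subtype.ext (by simp)) }
    obtain ⟨c, ⟨hc, hcx⟩, hc'⟩ := pfix_exists hPs (fun a g => θ a g) (th_one θ) (th_mul θ) Z
      (fun a ha c hc => ⟨Fx_inv hK a c hc.1, by
        have h1 := hf a c x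
        rw [hc.2, hx a (hPE ha), hy a (hPE ha)] at h1
        exact h1.symm⟩) (by
        rw [Nat.card_congr e]
        exact hsC _ (Subgroup.card_subgroup_dvd_card _))
    refine ⟨c, ?_, hcx⟩
    rw [← hPK, Fx_sup]
    exact ⟨hc', hc⟩

/-- minimal normal-in-A subgroup of F acting without fixed points -/
theorem exists_min_E {F : Subgroup A} (hFn : F.Normal) {θ : A →* MulAut G} (hF : Fx θ F = ⊥) :
    ∃ E : Subgroup A, E.Normal ∧ E ≤ F ∧ Fx θ E = ⊥ ∧
      ∀ K : Subgroup A, K.Normal → K < E → Fx θ K ≠ ⊥ := by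
  let T := {E : Subgroup A // E.Normal ∧ E ≤ F ∧ Fx θ E = ⊥}
  haveI : Nonempty T := ⟨⟨F, hFn, le_rfl, hF⟩⟩
  obtain ⟨⟨E, h1, h2, h3⟩, hmin⟩ := Finite.exists_min (fun E : T => Nat.card E.1)
  refine ⟨E, h1, h2, h3, fun K hK hlt h0 => ?_⟩
  exact absurd (hmin ⟨K, hK, hlt.le.trans h2, h0⟩) (not_le.2 (card_lt_of_lt hlt))

theorem isPGroup_two_or {N : Subgroup G} (hnil : Group.IsNilpotent N) {θ : A →* MulAut G}
    (hi : Inv θ N) : IsPGroup 2 N ∨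
      ∃ p : ℕ, p.Prime ∧ 3 ≤ p ∧ ∃ P : Subgroup G, IsPGroup p P ∧ P ≠ ⊥ ∧ Inv θ P := by
  by_cases h : ∃ p : ℕ, p.Prime ∧ 3 ≤ p ∧ p ∣ Nat.card N
  · right
    obtain ⟨p, hp, hp3, hd⟩ := h
    haveI : Fact p.Prime := ⟨hp⟩
    obtain ⟨S⟩ : Nonempty (Sylow p N) := inferInstance
    refine ⟨p, hp, hp3, S.1.map N.subtype, S.2.map _, ?_, hi.map_char (nil_sylow_char hnil S)⟩
    rw [Ne, Subgroup.map_eq_bot_iff_of_injective _ N.subtype_injective]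
    exact S.ne_bot_of_dvd_card hd
  · left
    push Not at h
    haveI : Fact (2 : ℕ).Prime := ⟨Nat.prime_two⟩
    apply isPGroup_of_eq_one
    intro x hx
    by_contra hx1
    have h5 : orderOf x ≠ 1 := by rwa [Ne, orderOf_eq_one_iff]
    have hp := Nat.minFac_prime h5
    refine h _ hp ?_ ((Nat.minFac_dvd _).trans (orderOf_dvd_natCard x))
    rcases hp.two_le.eq_or_lt with h | h
    · exact absurd (h ▸ Nat.minFac_dvd _) hx
    · exact h

open Pointwise in
theorem exists_inv_sylow {F H : Subgroup A} (hA : Frob F H) {θ : A →* MulAut G} (hF : Fx θ F = ⊥)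
    (hprop : ∀ N : Subgroup G, Inv θ N → N ≠ ⊤ → Group.IsNilpotent N)
    (hG : ¬ Group.IsNilpotent G) :
    ∃ p : ℕ, p.Prime ∧ 3 ≤ p ∧ ∃ P : Subgroup G, IsPGroup p P ∧ P ≠ ⊥ ∧ Inv θ P := by
  by_contra hcon
  have h2 : ∀ N : Subgroup G, Inv θ N → N ≠ ⊤ → IsPGroup 2 N := fun N hN hne =>
    (isPGroup_two_or (hprop N hN hne) hN).resolve_right hcon
  apply hcon
  haveI : Fact (2 : ℕ).Prime := ⟨Nat.prime_two⟩
  obtain ⟨E, hE, hEF, hE0, hmin⟩ := exists_min_E hA.normal hF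
  have hEnil := nilp_of_le hEF hA.nil
  have hco : ∀ s : ℕ, s.Prime → s ∣ Nat.card E → ¬ s ∣ Nat.card G := by
    intro s hs hsd
    haveI : Fact s.Prime := ⟨hs⟩
    obtain ⟨P, K, hP, hK, hPs, hKs, hPK⟩ := decomp hE hEnil s
    have hKE : K ≤ E := hPK ▸ le_sup_right
    have hlt := lt_of_decomp hKE hsd hKs
    have hne := hmin K hK hlt
    have hmod := Fx_card_mod (θ := θ) (P := P) hK hPs
    rw [hPK, hE0, Subgroup.card_bot] at hmod
    have hs1 : ¬ s ∣ Nat.card (Fx θ K) := by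
      intro h1
      have h2 := (Nat.ModEq.dvd_iff hmod dvd_rfl).1 h1
      exact hs.one_lt.ne' (Nat.dvd_one.1 h2)
    by_cases htop : Fx θ K = ⊤
    · rwa [htop, Subgroup.card_top] at hs1
    have hC2 := h2 _ (Fx_inv hK) htop
    haveI := (Subgroup.nontrivial_iff_ne_bot _).2 hne
    obtain ⟨k, hk0, hk⟩ := hC2.nontrivial_iff_card.1 inferInstance
    have hsodd : s ≠ 2 := by
      rintro rfl
      apply hs1
      rw [hk]; exact dvd_pow_self 2 hk0.ne'
    have hPtop : Fx θ P ≠ ⊤ := by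
      intro h
      apply hne
      rw [← hE0, ← hPK, Fx_sup, h, top_inf_eq]
    have hmod2 := Fx_card_mod (θ := θ) (P := P) (K := ⊥) inferInstance hPs
    rw [Fx_bot', sup_bot_eq, Subgroup.card_top] at hmod2
    obtain ⟨j, hj⟩ := IsPGroup.iff_card.1 (h2 _ (Fx_inv hP) hPtop)
    intro hsG
    have h3 := (Nat.ModEq.dvd_iff hmod2 dvd_rfl).1 hsG
    rw [hj] at h3
    exact hsodd ((Nat.prime_dvd_prime_iff_eq hs Nat.prime_two).1 (hs.dvd_of_dvd_pow h3))
  obtain ⟨r, hr, hr3, hrd⟩ := exists_odd_prime hG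
  haveI : Fact r.Prime := ⟨hr⟩
  obtain ⟨⟨S, hS⟩, huniq⟩ := glauberman (θ := θ) (Ω := Sylow r G) (fun a S => θ a • S)
    (fun S => by simp) (fun a b S => by simp [mul_smul]) (fun a g S => by
      change θ a • (g • S) = θ a g • θ a • S
      rw [Sylow.smul_def, Sylow.smul_def, ← mul_smul, ← mul_smul]
      congr 1
      ext x
      simp) _ E rfl hE hEnil hco
  refine ⟨r, hr, hr3, S.1, S.2, S.ne_bot_of_dvd_card hrd, ?_⟩
  have hfix : ∀ a, θ a • S = S := by
    intro a
    obtain ⟨c, hc, h⟩ := huniq S (θ a • S) hS (by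
      intro e he
      have h1 := hS (a⁻¹ * e * a) (by simpa using hE.conj_mem e he a⁻¹)
      have h1 : θ (a⁻¹ * e * a) • S = S := h1
      change θ e • θ a • S = θ a • S
      conv_rhs => rw [← h1]
      rw [← mul_smul, ← mul_smul, ← map_mul, ← map_mul]
      congr 2; group)
    rw [hE0] at hc
    rw [← h, mem_bot.1 hc, one_smul]
  intro a x hx
  have h1 : θ a x ∈ (θ a • S : Sylow r G) := by
    change θ a x ∈ θ a • (S : Subgroup G)
    exact Subgroup.smul_mem_pointwise_smul x (θ a) _ hx
  rw [hfix a] at h1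
  exact h1
end
end SS

set_option linter.style.haveILetI false
set_option linter.unusedSectionVars false
namespace SS
open Subgroup
universe u v

theorem exists_root {n k : ℕ} (hk : k ≠ 0) (h : Nat.Coprime n k) :
    ∃ m : ℕ, (n * m) % k = 1 % k := by
  rcases Nat.lt_or_ge 1 k with h1 | h1
  · obtain ⟨m, -, hm⟩ := Nat.exists_mul_mod_eq_one_of_coprime h h1
    exact ⟨m, by rw [hm, Nat.mod_eq_of_lt h1]⟩
  · have : k = 1 := by omega
    subst this
    exact ⟨0, by simp [Nat.mod_one]⟩

theorem pow_eq_self_of_mod {V : Type*} [Group V] {k n : ℕ} {v : V} (hv : v ^ k = 1)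
    (h : n % k = 1 % k) : v ^ n = v := by
  conv_rhs => rw [← pow_one v]
  exact pow_eq_pow_iff_modEq.2 (Nat.ModEq.of_dvd (orderOf_dvd_of_pow_eq_one hv) h)

theorem cocycle_avg {S V : Type*} [Group S] [Finite S] [CommGroup V] (τ : S →* MulAut V) {k : ℕ}
    (hk : k ≠ 0) (hV : ∀ v : V, v ^ k = 1) (hco : Nat.Coprime (Nat.card S) k)
    (d : S → V) (hd : ∀ s t, d (s * t) = d s * τ s (d t)) : ∃ w, ∀ s, d s * τ s w = w := by
  letI := Fintype.ofFinite S
  obtain ⟨m, hm⟩ := exists_root hk hco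
  refine cocycle τ (powMonoidHom m) Finset.univ Finset.mem_univ (fun v => ?_) d hd
  simp only [powMonoidHom_apply, map_pow, th_apply_inv, Finset.prod_const, Finset.card_univ]
  rw [← pow_mul, mul_comm, ← Nat.card_eq_fintype_card]
  exact pow_eq_self_of_mod (hV v) hm

section
variable {A : Type v} [Group A] [Finite A] {F H : Subgroup A}

theorem Frob.coprime (hA : Frob F H) {E : Subgroup A} (hE : E.Normal) (hEF : E ≤ F) :
    Nat.Coprime (Nat.card H) (Nat.card E) := by
  rw [← Nat.isCoprime_iff_coprime, Nat.isCoprime_iff_coprime]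
  by_contra hne
  obtain ⟨s, hs, h1, h2⟩ := Nat.Prime.not_coprime_iff_dvd.1 hne
  haveI : Fact s.Prime := ⟨hs⟩
  obtain ⟨x, hx⟩ := exists_prime_orderOf_dvd_card' s h1
  have hP : IsPGroup s (zpowers (x : A)) := by
    apply IsPGroup.of_card (n := 1)
    rw [Nat.card_zpowers, Subgroup.orderOf_coe, hx, pow_one]
  have h := pfix hP (fun a g => MulAut.conj a g) (fun x => by simp) (fun a b x => by simp)
    (E : Set A) (fun a _ y hy => by simpa using hE.conj_mem y hy a)
  have hx1 : (x : A) ≠ 1 := by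
    intro h
    have : x = 1 := Subtype.ext h
    rw [this, orderOf_one] at hx
    exact hs.one_lt.ne hx
  have e : Nat.card {y // y ∈ (E : Set A) ∧ ∀ a ∈ zpowers (x : A), MulAut.conj a y = y} = 1 := by
    rw [Nat.card_eq_one_iff_unique]
    refine ⟨⟨fun y z => ?_⟩, ⟨⟨1, one_mem E, fun a _ => map_one _⟩⟩⟩
    have : ∀ y : {y // y ∈ (E : Set A) ∧ ∀ a ∈ zpowers (x : A), MulAut.conj a y = y}, y.1 = 1 :=
      fun y => hA.frob x x.2 hx1 y.1 (hEF y.2.1) (by simpa using y.2.2 x (mem_zpowers _))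
    exact Subtype.ext ((this y).trans (this z).symm)
  rw [e] at h
  have h3 := (Nat.ModEq.dvd_iff h dvd_rfl).1 h2
  exact hs.one_lt.ne' (Nat.dvd_one.1 h3)

theorem K2 {E H : Subgroup A} (hE : E.Normal) {X : Type*} [MulAction A X]
    (hcomm : ∀ e ∈ E, ∀ f ∈ E, ∀ x : X, (e * f) • x = (f * e) • x)
    (hco : Nat.Coprime (Nat.card H) (Nat.card E)) (x : X) :
    ∃ w ∈ E, ∀ h ∈ H, (∃ f ∈ E, h • w • x = f • w • x) → h • w • x = w • x := by
  classical
  let E1 : Subgroup E := (MulAction.stabilizer A x).subgroupOf E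
  have hE1 : ∀ f : E, f ∈ E1 ↔ (f : A) • x = x := fun f => Iff.rfl
  have hswap : ∀ e f : E, (e : A) • (f : A) • x = (f : A) • (e : A) • x := by
    intro e f
    rw [← mul_smul, ← mul_smul, hcomm e e.2 f f.2]
  haveI hE1n : E1.Normal := ⟨fun f hf g => by
    rw [hE1] at hf ⊢
    push_cast
    have h1 : (g : A)⁻¹ • (g : A) • x = x := inv_smul_smul _ _
    rw [mul_smul, mul_smul]
    have h2 := hswap f g⁻¹
    push_cast at h2
    rw [h2, hf, smul_inv_smul]⟩
  have hmk : ∀ e f : E, (e : E ⧸ E1) = f ↔ (e : A) • x = (f : A) • x := by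
    intro e f
    rw [QuotientGroup.eq, hE1]
    push_cast
    rw [mul_smul, inv_smul_eq_iff]
    exact eq_comm
  letI : CommGroup (E ⧸ E1) :=
    { (inferInstance : Group (E ⧸ E1)) with
      mul_comm := by
        intro a b
        obtain ⟨a, rfl⟩ := QuotientGroup.mk_surjective a
        obtain ⟨b, rfl⟩ := QuotientGroup.mk_surjective b
        rw [← QuotientGroup.mk_mul, ← QuotientGroup.mk_mul, hmk]
        exact hcomm a a.2 b b.2 x }
  let H' : Subgroup A :=
    { carrier := {h | h ∈ H ∧ ∃ d ∈ E, h • x = d • x}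
      one_mem' := ⟨one_mem _, 1, one_mem _, rfl⟩
      mul_mem' := by
        rintro h k ⟨hh, d, hd, e⟩ ⟨hk, d', hd', e'⟩
        refine ⟨mul_mem hh hk, (h * d' * h⁻¹) * d, mul_mem (hE.conj_mem _ hd' _) hd, ?_⟩
        rw [mul_smul (h * d' * h⁻¹), ← e, mul_smul, e', ← mul_smul, ← mul_smul]
        congr 1; group
      inv_mem' := by
        rintro h ⟨hh, d, hd, e⟩
        refine ⟨inv_mem hh, h⁻¹ * d⁻¹ * h, by
          simpa using hE.conj_mem _ (inv_mem hd) h⁻¹, ?_⟩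
        rw [mul_smul, e, ← mul_smul, mul_assoc, inv_mul_cancel, mul_one] }
  have hH' : ∀ h : H', ∃ d : E, (h : A) • x = (d : A) • x := by
    rintro ⟨h, hh, d, hd, e⟩
    exact ⟨⟨d, hd⟩, e⟩
  choose d hd using hH'
  let κ : H' →* MulAut E := (MulAut.conjNormal : A →* MulAut E).comp H'.subtype
  have hκ : ∀ (h : H') (f : E), ((κ h f : E) : A) = h * f * (h : A)⁻¹ := fun h f => rfl
  have hinv : Inv κ E1 := by
    intro h f hf
    rw [hE1] at hf ⊢
    have h1 := hd h⁻¹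
    push_cast at h1
    rw [hκ, mul_smul, mul_smul, h1, hswap, hf, ← h1, smul_inv_smul]
  obtain ⟨w, hw⟩ := cocycle_avg (quo κ E1 hinv) (k := Nat.card E) Nat.card_pos.ne' (fun v => by
      obtain ⟨v, rfl⟩ := QuotientGroup.mk_surjective v
      rw [← QuotientGroup.mk_pow, pow_card_eq_one']; rfl)
    (Nat.Coprime.coprime_dvd_left (Subgroup.card_dvd_of_le (fun h hh => hh.1 : H' ≤ H)) hco)
    (fun h => (d h : E ⧸ E1)) (fun h k => by
      rw [quo_mk, ← QuotientGroup.mk_mul, hmk]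
      push_cast
      rw [← hd, mul_smul ((d h : E) : A), hswap, ← hd, hκ, ← mul_smul]
      push_cast
      rw [mul_assoc _ _ ((h : A)), inv_mul_cancel, mul_one, mul_smul, mul_smul, hd k])
  obtain ⟨w, rfl⟩ := QuotientGroup.mk_surjective w
  refine ⟨w, w.2, ?_⟩
  rintro h hh ⟨f, hf, e⟩
  have hmem : h ∈ H' := by
    refine ⟨hh, h * (w : A)⁻¹ * h⁻¹ * (f * w), ?_, ?_⟩
    · exact mul_mem (hE.conj_mem _ (inv_mem w.2) _) (mul_mem hf w.2)
    · rw [mul_smul, mul_smul f, ← e, ← mul_smul, ← mul_smul]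
      congr 1; group
  have h1 := hw ⟨h, hmem⟩
  rw [quo_mk, ← QuotientGroup.mk_mul, hmk] at h1
  refine Eq.trans ?_ h1
  push_cast
  rw [mul_smul, hswap, ← hd, hκ, ← mul_smul]
  change (h * (w : A)) • x = (h * w * h⁻¹) • h • x
  rw [← mul_smul]
  congr 1; group

theorem K3 (hA : Frob F H) {E : Subgroup A} (hE : E.Normal) (hEF : E ≤ F) {X : Type*}
    [MulAction A X] {y : X} (hy : ∀ h ∈ H, (∃ f ∈ E, h • y = f • y) → h • y = y)
    {f h : A} (hf : f ∈ E) (hfy : f • y ≠ y) (hh : h ∈ H) (e : h • f • y = f • y) : h = 1 := by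
  by_contra hne
  have hhy : h • y = y := hy h hh ⟨h * f⁻¹ * h⁻¹ * f, mul_mem (hE.conj_mem _ (inv_mem hf) _) hf, by
    rw [mul_smul _ f, ← e, ← mul_smul, ← mul_smul]; congr 1; group⟩
  have hz : ∀ a ∈ zpowers h, a • y = y := by
    have : zpowers h ≤ MulAction.stabilizer A y := zpowers_le.2 hhy
    exact fun a ha => this ha
  have hi : Inv ((MulAut.conj : A →* MulAut A).comp (zpowers h).subtype)
      (MulAction.stabilizer A y ⊓ E) := by
    rintro a n ⟨h1, h2⟩
    refine ⟨?_, ?_⟩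
    · change ((a : A) * n * (a : A)⁻¹) • y = y
      rw [mul_smul, mul_smul, hz _ (inv_mem a.2), (show n • y = y from h1), hz _ a.2]
    · exact hE.conj_mem n h2 a
  have hm : f⁻¹ * (h * f * h⁻¹) ∈ MulAction.stabilizer A y ⊓ E := by
    refine Subgroup.mem_inf.2 ⟨?_, mul_mem (inv_mem hf) (hE.conj_mem _ hf _)⟩
    change (f⁻¹ * (h * f * h⁻¹)) • y = y
    have h2 : h⁻¹ • y = y := by rw [inv_smul_eq_iff, hhy]
    rw [mul_smul, mul_smul, h2, mul_smul, e, inv_smul_smul]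
  obtain ⟨g, hg⟩ := fpf_surj (res _ _ hi ⟨h, mem_zpowers h⟩) (fun n hn => by
      apply Subtype.ext
      exact hA.frob h hh hne n (hEF n.2.2) (congrArg Subtype.val hn))
    ⟨f⁻¹ * (h * f * h⁻¹), hm⟩
  have hg : (g : A)⁻¹ * (h * g * h⁻¹) = f⁻¹ * (h * f * h⁻¹) := congrArg Subtype.val hg
  have h3 : f * (g : A)⁻¹ = 1 := by
    apply hA.frob h hh hne _ (hEF (mul_mem hf (inv_mem g.2.2)))
    have : h * f * h⁻¹ = f * (g : A)⁻¹ * (h * g * h⁻¹) := by rw [mul_assoc f, hg]; group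
    calc h * (f * (g : A)⁻¹) * h⁻¹ = (h * f * h⁻¹) * (h * g * h⁻¹)⁻¹ := by group
      _ = _ := by rw [this]; group
  apply hfy
  rw [mul_inv_eq_one.1 h3]
  exact g.2.1

end
end SS

set_option linter.style.haveILetI false
set_option linter.unusedSectionVars false
namespace SS
open Subgroup
universe u v

section
variable {A : Type v} [Group A] [Finite A] {F H : Subgroup A}
  {U : Type u} [CommGroup U] [Finite U]

theorem K1 (hA : Frob F H) {q : ℕ} [hq : Fact q.Prime] (hU : ∀ u : U, u ^ q = 1)
    {α : A →* MulAut U} (hF : Fx α F = ⊥) (hirr : ∀ N : Subgroup U, Inv α N → N = ⊥ ∨ N = ⊤) :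
    ∃ E : Subgroup A, E.Normal ∧ E ≤ F ∧ ¬ q ∣ Nat.card E ∧ Fx α E = ⊥ ∧
      ∀ e ∈ E, ∀ f ∈ E, ∀ u, α (e * f) u = α (f * e) u := by
  obtain ⟨E, hE, hEF, hE0, hmin⟩ := exists_min_E hA.normal hF
  have hnil : Group.IsNilpotent E := nilp_of_le hEF hA.nil
  have hUp : IsPGroup q (⊤ : Subgroup U) := fun u => ⟨1, by
    apply Subtype.ext; simpa using hU u⟩
  refine ⟨E, hE, hEF, ?_, hE0, ?_⟩
  · intro hd
    obtain ⟨P, K, hP, hK, hPp, hKp, hs⟩ := decomp hE hnil q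
    have h1 := Fx_card_mod (θ := α) (P := P) hK hPp
    rw [hs, hE0, Subgroup.card_bot] at h1
    refine hmin K hK (lt_of_decomp (hs ▸ le_sup_right) hd hKp) (bot_of_mod (hUp.to_le le_top) h1)
  · by_cases hEb : E = ⊥
    · subst hEb
      intro e he f hf u
      rw [mem_bot.1 he, mem_bot.1 hf]
    · haveI := hnil
      haveI : Group.IsSolvable E := inferInstance
      haveI : Nontrivial E := (Subgroup.nontrivial_iff_ne_bot E).2 hEb
      haveI := hE
      have hlt : ⁅E, E⁆ < E := by
        have h1 : commutator E < ⊤ := Group.IsSolvable.commutator_lt_top_of_nontrivial E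
        refine lt_of_le_of_ne (Subgroup.commutator_le_left E E) fun h => ?_
        have h2 : (commutator E).map E.subtype = ⁅E, E⁆ := by
          rw [commutator_def, Subgroup.map_commutator, ← MonoidHom.range_eq_map, Subgroup.range_subtype]
        rw [h] at h2
        apply h1.ne
        rw [eq_top_iff]
        intro x _
        have : (x : A) ∈ (commutator E).map E.subtype := by rw [h2]; exact x.2
        obtain ⟨y, hy, hxy⟩ := this
        rwa [← Subtype.ext hxy]
      have hn : (⁅E, E⁆ : Subgroup A).Normal := inferInstance
      have htop := (hirr _ (Fx_inv (θ := α) hn)).resolve_left (hmin _ hn hlt)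
      intro e he f hf u
      have h3 : u ∈ Fx α ⁅E, E⁆ := htop ▸ mem_top u
      have h4 := h3 _ (Subgroup.commutator_mem_commutator (inv_mem he) (inv_mem hf))
      rw [commutatorElement_def] at h4
      have h5 : f * e * (e⁻¹ * f⁻¹ * e⁻¹⁻¹ * f⁻¹⁻¹) = e * f := by group
      rw [← h5, th_mul, h4]

variable {V : Type u} [CommGroup V] [Finite V]

theorem K4 {p : ℕ} [hp : Fact p.Prime] (hUp : ¬ p ∣ Nat.card U)
    {α : A →* MulAut U} {τ : A →* MulAut V} {ρ : U →* MulAut V}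
    (hc : ∀ a u v, τ a (ρ u v) = ρ (α a u) (τ a v))
    (hH : ∀ u ∈ Fx α H, ∀ v ∈ Fx τ H, ρ u v = v)
    {ψ : U →* (KK p)ˣ} (ho : Occ p ρ ψ) (hst : ∀ h ∈ H, ψ.comp (α h).toMonoidHom = ψ → h = 1)
    {c : U} (hcH : c ∈ Fx α H) : ψ c = 1 := by
  classical
  letI := Fintype.ofFinite H
  obtain ⟨φ, hφ, v0, hv0⟩ := ho
  have h1 : ∃ v, ∑ h : H, φ (τ h v) ≠ 0 := by
    by_contra hcon
    push Not at hcon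
    have := semi_indep (p := p) ρ hUp (fun h : H => ψ.comp (α h).toMonoidHom) (by
      intro h k hhk
      have h2 : (h : A) * (k : A)⁻¹ = 1 := by
        apply hst _ (mul_mem h.2 (inv_mem k.2))
        ext u
        have h3 := DFunLike.congr_fun hhk (α (k : A)⁻¹ u)
        change ψ (α h (α (k : A)⁻¹ u)) = ψ (α k (α (k : A)⁻¹ u)) at h3
        rw [th_apply_inv] at h3
        change ((ψ (α (h * (k : A)⁻¹) u) : (KK p)ˣ) : KK p) = ψ u
        rw [th_mul, h3]
      exact Subtype.ext (mul_inv_eq_one.1 h2))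
      (fun h v => φ (τ h v)) (fun h => hφ.comp hc h)
      (fun h => ⟨τ (h : A)⁻¹ v0, by
        change φ (τ h (τ (h : A)⁻¹ v0)) ≠ 0
        rwa [th_apply_inv]⟩) (fun _ => 1) (by simpa using hcon) 1
    exact one_ne_zero this
  obtain ⟨v, hv⟩ := h1
  have hφp : φ (∏ h : H, τ h v) = ∑ h : H, φ (τ h v) := by
    have h0 : φ 1 = 0 := by
      have := hφ.1 1 1
      rw [mul_one] at this
      simpa using this
    let φ' : V →* Multiplicative (KK p) :=
      { toFun := fun x => Multiplicative.ofAdd (φ x)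
        map_one' := by rw [h0]; rfl
        map_mul' := fun x y => by rw [hφ.1]; rfl }
    have := map_prod φ' (fun h : H => τ h v) Finset.univ
    exact congrArg Multiplicative.toAdd this
  have hw : (∏ h : H, τ h v) ∈ Fx τ H := by
    intro s hs
    rw [map_prod]
    exact Fintype.prod_equiv (Equiv.mulLeft ⟨s, hs⟩) _ _ (fun f => by
      simp [map_mul, MulAut.mul_apply])
  have h2 := hφ.2 c (∏ h : H, τ h v)
  rw [hH c hcH _ hw, hφp] at h2
  apply Units.ext
  have h3 : ((ψ c : (KK p)ˣ) : KK p) * (∑ h : H, φ (τ h v)) = 1 * ∑ h : H, φ (τ h v) := by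
    rw [one_mul]; exact h2.symm
  exact mul_right_cancel₀ hv h3

theorem K5 (hA : Frob F H) {q : ℕ} [hq : Fact q.Prime] (hU : ∀ u : U, u ^ q = 1)
    {α : A →* MulAut U} {E : Subgroup A} (hE : E.Normal) (hEF : E ≤ F) (hqE : ¬ q ∣ Nat.card E)
    (hE0 : Fx α E = ⊥) {C : Type*} [CommGroup C] {χ : U →* C}
    (h : ∀ f ∈ E, ∀ c ∈ Fx α H, χ (α f c) = 1) (x : U) : χ x = 1 := by
  classical
  letI := Fintype.ofFinite H
  letI := Fintype.ofFinite E
  have hN : ∀ y, (∏ s : H, α s y) ∈ Fx α H := by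
    intro y s hs
    rw [map_prod]
    exact Fintype.prod_equiv (Equiv.mulLeft ⟨s, hs⟩) _ _ (fun f => by
      simp [map_mul, MulAut.mul_apply])
  have h1 : ∏ s : H, ∏ f : E, χ (α ((f : A)⁻¹ * s * f) x) = 1 := by
    rw [Finset.prod_comm]
    refine Finset.prod_eq_one fun f _ => ?_
    have := h (f : A)⁻¹ (inv_mem f.2) _ (hN (α f x))
    rw [map_prod, map_prod] at this
    rw [← this]
    refine Finset.prod_congr rfl fun s _ => ?_
    rw [th_mul, th_mul]
  rw [Fintype.prod_eq_single (1 : H)] at h1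
  · simp only [OneMemClass.coe_one, mul_one, inv_mul_cancel, th_one, Finset.prod_const,
      Finset.card_univ, ← Nat.card_eq_fintype_card] at h1
    have h2 : χ x ^ q = 1 := by rw [← map_pow, hU, map_one]
    have h3 : Nat.Coprime (Nat.card E) q := ((Nat.Prime.coprime_iff_not_dvd hq.out).2 hqE).symm
    have h4 := Nat.dvd_gcd (orderOf_dvd_of_pow_eq_one h1) (orderOf_dvd_of_pow_eq_one h2)
    rw [h3.gcd_eq_one] at h4
    exact orderOf_eq_one_iff.1 (Nat.dvd_one.1 h4)
  · intro s hs
    have hs1 : (s : A) ≠ 1 := fun h => hs (Subtype.ext h)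
    haveI := hE
    let κ : MulAut E := MulAut.conjNormal (s : A)
    have hκ : ∀ f : E, ((κ f : E) : A) = s * f * (s : A)⁻¹ := fun f => rfl
    have hfp : ∀ g, κ g = g → g = 1 := fun g hg => Subtype.ext
      (hA.frob s s.2 hs1 g (hEF g.2) (congrArg Subtype.val hg))
    rw [← map_prod]
    have h5 := prod_E_eq_one hE0 (α s x)
    have h6 : ∏ f : E, α ((f : A)⁻¹ * s * f) x = ∏ f : E, α f (α s x) := by
      refine Fintype.prod_bijective (fun g : E => g⁻¹ * κ g) ⟨fpf_inj κ hfp, fpf_surj κ hfp⟩ _ _ ?_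
      intro f
      rw [← th_mul]
      congr 2
      push_cast
      rw [hκ]
      group
    rw [h6, h5, map_one]

theorem lemmaK (hA : Frob F H) {p q : ℕ} [hp : Fact p.Prime] [hq : Fact q.Prime] (hpq : p ≠ q)
    (hU : ∀ u : U, u ^ q = 1) (hV : ∀ v : V, v ^ p = 1)
    {α : A →* MulAut U} {τ : A →* MulAut V} {ρ : U →* MulAut V}
    (hc : ∀ a u v, τ a (ρ u v) = ρ (α a u) (τ a v))
    (hF : Fx α F = ⊥) (hirr : ∀ N : Subgroup U, Inv α N → N = ⊥ ∨ N = ⊤)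
    (hH : ∀ u ∈ Fx α H, ∀ v ∈ Fx τ H, ρ u v = v) (u : U) : ρ u = 1 := by
  classical
  obtain ⟨E, hE, hEF, hqE, hE0, hcomm⟩ := K1 hA hU hF hirr
  have hUq : IsPGroup q U := fun u => ⟨1, by simpa using hU u⟩
  have hUp : ¬ p ∣ Nat.card U := by
    obtain ⟨n, hn⟩ := IsPGroup.iff_card.1 hUq
    rw [hn]
    intro h
    exact hpq ((Nat.prime_dvd_prime_iff_eq hp.out hq.out).1 (hp.out.dvd_of_dvd_pow h))
  apply rho_eq_one (p := p) ρ hV hUp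
  intro χ φ h1 h2
  letI : MulAction A (U →* (KK p)ˣ) :=
    { smul := fun b χ => χ.comp (α b⁻¹).toMonoidHom
      one_smul := fun χ => by
        change χ.comp (α 1⁻¹).toMonoidHom = χ
        ext u; simp
      mul_smul := fun a b χ => by
        change χ.comp (α (a * b)⁻¹).toMonoidHom = (χ.comp (α b⁻¹).toMonoidHom).comp (α a⁻¹).toMonoidHom
        ext u; simp }
  have hsm : ∀ (b : A) (χ : U →* (KK p)ˣ), b • χ = χ.comp (α b⁻¹).toMonoidHom := fun _ _ => rfl
  have hsma : ∀ (b : A) (χ : U →* (KK p)ˣ) u, (b • χ) u = χ (α b⁻¹ u) := fun _ _ _ => rfl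
  obtain ⟨w, hw, hws⟩ := K2 hE (X := U →* (KK p)ˣ) (fun e he f hf χ => by
    ext u
    rw [hsma, hsma, mul_inv_rev, mul_inv_rev, hcomm _ (inv_mem hf) _ (inv_mem he)])
    (hA.coprime hE hEF) χ
  have hocc : ∀ a : A, Occ p ρ (a • χ) := fun a => Occ.comp hc ⟨φ, h1, h2⟩ a⁻¹
  generalize hχ0 : w • χ = χ0 at hws
  have hocc0 : ∀ a : A, Occ p ρ (a • χ0) := fun a => by
    rw [← hχ0, ← mul_smul]; exact hocc _
  have h3 : ∀ f ∈ E, f • χ0 ≠ χ0 → ∀ c ∈ Fx α H, (f • χ0) c = 1 := by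
    intro f hf hne c hcH
    refine K4 hUp hc hH (hocc0 f) (fun h hh e => ?_) hcH
    have := K3 hA hE hEF hws hf hne (inv_mem hh) (by rw [hsm h⁻¹, inv_inv, e])
    exact inv_eq_one.1 this
  have h4 : ∀ c ∈ Fx α H, χ0 c = 1 := by
    intro c hcH
    letI := Fintype.ofFinite E
    have h5 := congrArg χ0 (prod_E_eq_one hE0 c)
    rw [map_prod, map_one] at h5
    have h6 : ∀ f : E, χ0 (α f c) = if (f : A)⁻¹ • χ0 = χ0 then χ0 c else 1 := by
      intro f
      split_ifs with hif
      · conv_rhs => rw [← hif, hsma, inv_inv]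
      · rw [← h3 _ (inv_mem f.2) hif c hcH, hsma, inv_inv]
    simp only [h6] at h5
    rw [Finset.prod_ite, Finset.prod_const, Finset.prod_const_one, mul_one] at h5
    have h7 : χ0 c ^ q = 1 := by rw [← map_pow, hU, map_one]
    let E1 : Subgroup E := (MulAction.stabilizer A χ0).subgroupOf E
    have h8 : (Finset.univ.filter fun f : E => (f : A)⁻¹ • χ0 = χ0).card = Nat.card E1 := by
      rw [Nat.card_eq_fintype_card, Fintype.card_subtype]
      congr 1
      ext f
      simp only [Finset.mem_filter, Finset.mem_univ, true_and]
      change _ ↔ (f : A) • χ0 = χ0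
      rw [inv_smul_eq_iff, eq_comm]
    rw [h8] at h5
    have h9 : Nat.Coprime (Nat.card E1) q := by
      refine ((Nat.Prime.coprime_iff_not_dvd hq.out).2 fun hd => hqE ?_).symm
      exact hd.trans (Subgroup.card_subgroup_dvd_card E1)
    have h10 := Nat.dvd_gcd (orderOf_dvd_of_pow_eq_one h5) (orderOf_dvd_of_pow_eq_one h7)
    rw [h9.gcd_eq_one] at h10
    exact orderOf_eq_one_iff.1 (Nat.dvd_one.1 h10)
  have h5 : ∀ x, χ0 x = 1 := K5 hA hU hE hEF hqE hE0 (χ := χ0) (fun f hf c hcH => by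
    by_cases hif : f⁻¹ • χ0 = χ0
    · rw [← h4 c hcH]
      conv_rhs => rw [← hif, hsma, inv_inv]
    · rw [← h3 _ (inv_mem hf) hif c hcH, hsma, inv_inv])
  have h6 : χ = w⁻¹ • χ0 := by rw [← hχ0, inv_smul_smul]
  rw [h6, hsma, h5]

end
end SS

set_option linter.style.haveILetI false
set_option linter.unusedSectionVars false
namespace SS
open Subgroup
universe u v

theorem pow_mem_H_comm {G : Type*} [Group G] [Finite G] {p : ℕ} [hp : Fact p.Prime] {C V : Subgroup G}
    [V.Normal] (hVp : IsPGroup p V) (hC : Group.IsNilpotent C) {x v : G} (hx : x ∈ C)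
    (ho : ¬ p ∣ orderOf x) (hv : v ∈ V) (hvC : v ∈ C) : x * v = v * x := by
  have h1 : IsPGroup p (V.subgroupOf C) := hVp.comap_of_injective _ Subtype.val_injective
  have h2 := PC.comm (p := p) (PC_of_nilpotent hC) (D := V.subgroupOf C) h1 (x := ⟨x, hx⟩)
    (d := ⟨v, hvC⟩) (by rwa [Subgroup.orderOf_mk]) hv
  exact congrArg Subtype.val h2

theorem theoremC {A : Type v} [Group A] [Finite A] {F H : Subgroup A} (hA : Frob F H)
    (G : Type u) [Group G] [Finite G] (θ : A →* MulAut G)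
    (hF : Fx θ F = ⊥) (hH : Group.IsNilpotent (Fx θ H)) : Group.IsNilpotent G := by
  refine thmX (A := A) (fun G _ _ θ => Fx θ F = ⊥ ∧ Group.IsNilpotent (Fx θ H)) ?_ ?_ ?_ ?_
    _ G θ rfl ⟨hF, hH⟩
  · rintro G _ _ θ ⟨hF, hH⟩ N hN
    refine ⟨Fx_res_bot hN hF, ?_⟩
    refine nilp_of_injective hH (((N.subtype).comp (Fx (res θ N hN) H).subtype).codRestrict
      (Fx θ H) (fun x => (Fx_res hN _).1 x.2)) ?_
    intro x y h
    have h2 : ((x : N) : G) = ((y : N) : G) := congrArg (fun z : Fx θ H => (z : G)) h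
    exact Subtype.ext (Subtype.ext h2)
  · rintro G _ _ θ ⟨hF, hH⟩ p hp V _ hV
    haveI : Fact p.Prime := ⟨hp⟩
    refine ⟨cover_F hA hF hV, ?_⟩
    haveI := hH
    refine Group.nilpotent_of_surjective (G := Fx θ H)
      (((QuotientGroup.mk' V).comp (Fx θ H).subtype).codRestrict (Fx (quo θ V hV.inv) H)
        (fun x s hs => by
          change ((θ s x : G) : G ⧸ V) = ((x : G) : G ⧸ V)
          rw [x.2 s hs])) ?_
    rintro ⟨x, hx⟩
    obtain ⟨g, rfl⟩ := QuotientGroup.mk_surjective x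
    obtain ⟨v, hv, hgv⟩ := cover_H hA hF hV g hx
    refine ⟨⟨g * v, hgv⟩, Subtype.ext ?_⟩
    change ((g * v : G) : G ⧸ V) = (g : G ⧸ V)
    exact QuotientGroup.mk_mul_of_mem g hv
  · rintro G _ _ θ ⟨hF, hH⟩ hprop hG
    exact exists_inv_sylow hA hF hprop hG
  · rintro G _ _ θ ⟨hF, hH⟩ p q hp hq hpq V hV hcomm hpow hirr v hv g
    haveI := hV.normal
    haveI : Fact p.Prime := ⟨hp⟩
    haveI : Fact q.Prime := ⟨hq⟩
    letI := commOf V hV.comm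
    letI : CommGroup (G ⧸ V) :=
      { (inferInstance : Group (G ⧸ V)) with
        mul_comm := by
          intro a b
          obtain ⟨a, rfl⟩ := QuotientGroup.mk_surjective a
          obtain ⟨b, rfl⟩ := QuotientGroup.mk_surjective b
          have := (QuotientGroup.eq_one_iff _).2 (hcomm a b)
          rw [← mul_inv_eq_one, mul_inv_rev, ← mul_assoc]
          exact this }
    have h1 := lemmaK (U := G ⧸ V) (V := V) hA hpq ?_ (fun v => Subtype.ext (hV.exp v v.2))
      (α := quo θ V hV.inv) (τ := res θ V hV.inv) (ρ := cact V hV.comm) ?_ (cover_F hA hF hV) ?_ ?_ (g : G ⧸ V)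
    · have h2 : g * v * g⁻¹ = v := congrArg Subtype.val (DFunLike.congr_fun h1 (⟨v, hv⟩ : V))
      rw [mul_inv_eq_iff_eq_mul] at h2; exact h2
    · intro u
      obtain ⟨g, rfl⟩ := QuotientGroup.mk_surjective u
      exact (QuotientGroup.eq_one_iff _).2 (hpow g)
    · intro a u v
      obtain ⟨g, rfl⟩ := QuotientGroup.mk_surjective u
      apply Subtype.ext
      change θ a (g * v * g⁻¹) = θ a g * θ a v * (θ a g)⁻¹
      simp
    · intro N hN
      have h2 : V ≤ N.comap (QuotientGroup.mk' V) := fun v hv => by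
        have : (v : G ⧸ V) = 1 := (QuotientGroup.eq_one_iff _).2 hv
        change (v : G ⧸ V) ∈ N
        rw [this]; exact one_mem _
      rcases hirr _ (hV.inv.comap_quo hN) h2 with h3 | h3
      · left
        rw [eq_bot_iff]
        intro x hx
        obtain ⟨g, rfl⟩ := QuotientGroup.mk_surjective x
        have : g ∈ V := by rw [← h3]; exact hx
        exact (QuotientGroup.eq_one_iff _).2 this
      · right
        rw [eq_top_iff]
        intro x _
        obtain ⟨g, rfl⟩ := QuotientGroup.mk_surjective x
        have : g ∈ N.comap (QuotientGroup.mk' V) := by rw [h3]; trivial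
        exact this
    · intro u hu v hv
      obtain ⟨g, rfl⟩ := QuotientGroup.mk_surjective u
      obtain ⟨w, hw, hgw⟩ := cover_H hA hF hV g hu
      obtain ⟨k, hk⟩ := exists_pow_not_dvd (p := p) (g * w)
      have h5 := pow_mem_H_comm hV.isPGroup hH (pow_mem hgw (p ^ k)) hk v.2 ((Fx_res _ _).1 hv)
      have h6 : ((g * w : G) : G ⧸ V) = g := QuotientGroup.mk_mul_of_mem g hw
      have h7 : cact V hV.comm (((g : G ⧸ V)) ^ (p ^ k)) v = v := by
        rw [← h6, ← QuotientGroup.mk_pow]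
        apply Subtype.ext
        rw [cact_mk, h5, mul_inv_cancel_right]
      have h8 : (orderOf (g : G ⧸ V)).Coprime (p ^ k) := by
        apply Nat.Coprime.pow_right
        refine Nat.Coprime.coprime_dvd_left (k := q) ?_ ?_
        · apply orderOf_dvd_of_pow_eq_one
          exact (QuotientGroup.eq_one_iff _).2 (hpow g)
        · exact (Nat.coprime_primes hq hp).2 hpq.symm
      obtain ⟨m, hm⟩ := exists_pow_eq_self_of_coprime h8.symm
      rw [← hm]
      generalize ((g : G ⧸ V)) ^ (p ^ k) = z at h7
      clear hm
      induction m with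
      | zero => rw [pow_zero, map_one]; rfl
      | succ m ih => rw [pow_succ, map_mul, MulAut.mul_apply, h7, ih]

end SS

set_option linter.style.haveILetI false
set_option linter.unusedSectionVars false
namespace SS
open Subgroup
universe u v

theorem supersol_surj {X Y : Type*} [Group X] [Group Y] (f : X →* Y) (hf : Function.Surjective f)
    (h : Supersoluble X) : Supersoluble Y := by
  rintro K N ⟨hK, hN, hlt, hmin⟩
  obtain ⟨g, hg, hgen⟩ := h (K.comap f) (N.comap f) ⟨hK.comap f, hN.comap f,
    (Subgroup.comap_lt_comap_of_surjective hf).2 hlt, fun L hL h1 h2 => by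
      have hker : f.ker ≤ L := fun x hx => h1 (by
        change f x ∈ K
        rw [MonoidHom.mem_ker.1 hx]; exact one_mem _)
      have hLe : (L.map f).comap f = L := Subgroup.comap_map_eq_self hker
      rcases hmin (L.map f) (hL.map f hf) (by
          intro y hy
          obtain ⟨x, rfl⟩ := hf y
          exact ⟨x, h1 hy, rfl⟩) (Subgroup.map_le_iff_le_comap.2 h2) with h3 | h3
      · left; rw [← hLe, h3]
      · right; rw [← hLe, h3]⟩
  refine ⟨f g, hg, fun y hy => ?_⟩
  obtain ⟨x, rfl⟩ := hf y
  obtain ⟨n, hn⟩ := hgen x hy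
  exact ⟨n, by simpa using hn⟩

theorem eigen_add {p : ℕ} [hp : Fact p.Prime] {W : Type*} [AddCommGroup W] [Finite W] [Nontrivial W]
    [Module (ZMod p) W] (T : W →+ W) (hT : ∀ v, T^[p] v = T v) :
    ∃ v : W, v ≠ 0 ∧ ∃ j : ℕ, T v = j • v := by
  let T' : Module.End (ZMod p) W := AddMonoidHom.toZModLinearMap p T
  have hT' : ∀ v : W, T' v = T v := fun v => rfl
  have hTp : T' ^ p = T' := by
    ext v
    rw [Module.End.pow_apply, hT', ← hT]
    rfl
  have hfin : Module.Finite (ZMod p) W := Module.Finite.of_finite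
  have hdvd : minpoly (ZMod p) T' ∣ (Polynomial.X ^ p - Polynomial.X : Polynomial (ZMod p)) := by
    apply minpoly.dvd
    simp [hTp]
  have hspl : (Polynomial.X ^ p - Polynomial.X : Polynomial (ZMod p)).Splits := by
    have := FiniteField.splits_X_pow_card_sub_X p (K := ZMod p)
    simpa using this
  have hint : IsIntegral (ZMod p) T' := Algebra.IsIntegral.isIntegral _
  obtain ⟨μ, hμ⟩ := (hspl.of_dvd (FiniteField.X_pow_card_sub_X_ne_zero (ZMod p) hp.out.one_lt)
    hdvd).exists_eval_eq_zero (minpoly.degree_pos hint).ne'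
  obtain ⟨v, hv⟩ := (Module.End.hasEigenvalue_of_isRoot hμ).exists_hasEigenvector
  refine ⟨v, hv.2, μ.val, ?_⟩
  have h1 := hv.apply_eq_smul
  rw [hT'] at h1
  rw [h1]
  conv_lhs => rw [← ZMod.natCast_zmod_val μ]
  rw [Nat.cast_smul_eq_nsmul]

theorem eigen {p : ℕ} [hp : Fact p.Prime] {V : Type*} [CommGroup V] [Finite V] [Nontrivial V]
    (hV : ∀ v : V, v ^ p = 1) (T : MulAut V) (hT : T ^ (p - 1) = 1) :
    ∃ v : V, v ≠ 1 ∧ ∃ j : ℕ, T v = v ^ j := by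
  haveI : Finite (Additive V) := ‹Finite V›
  have hn : ∀ n : ℕ, ∀ v : V, (T ^ n) v = T^[n] v := by
    intro n
    induction n with
    | zero => intro v; rfl
    | succ n ih => intro v; rw [pow_succ, MulAut.mul_apply, ih, Function.iterate_succ_apply]
  letI : Module (ZMod p) (Additive V) := AddCommGroup.zmodModule (fun v => hV v.toMul)
  obtain ⟨v, hv, j, hj⟩ := eigen_add (p := p) (W := Additive V)
    (MonoidHom.toAdditive T.toMonoidHom) (fun v => by
      have h1 : T^[p] v.toMul = T v.toMul := by
        rw [← hn, ← Nat.sub_add_cancel hp.out.one_le, pow_succ, hT, one_mul]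
      exact h1)
  exact ⟨v.toMul, hv, j, hj⟩

/-- irreducible module with abelian action of exponent dividing p-1 is cyclic -/
theorem cyc_min {p : ℕ} [hp : Fact p.Prime] {Q : Type*} [Group Q] [Finite Q] {N : Subgroup Q}
    (hN : N.Normal) (hne : N ≠ ⊥) (hmin : ∀ L : Subgroup Q, L.Normal → L ≤ N → L = ⊥ ∨ L = N)
    (hcomm : ∀ x ∈ N, ∀ y ∈ N, x * y = y * x) (hexp : ∀ x ∈ N, x ^ p = 1)
    (hab : ∀ g h : Q, ∀ x ∈ N, (g * h) * x * (g * h)⁻¹ = (h * g) * x * (h * g)⁻¹)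
    (hpow : ∀ g : Q, ∀ x ∈ N, g ^ (p - 1) * x = x * g ^ (p - 1)) :
    ∃ x ∈ N, N ≤ zpowers x := by
  letI := commOf N hcomm
  haveI : Nontrivial N := (Subgroup.nontrivial_iff_ne_bot N).2 hne
  have key : ∀ g : Q, ∃ j : ℕ, ∀ x ∈ N, g * x * g⁻¹ = x ^ j := by
    intro g
    obtain ⟨v, hv, j, hj⟩ := eigen (p := p) (fun v : N => Subtype.ext (hexp v v.2))
      (MulAut.conjNormal g : MulAut N) (by
        rw [← map_pow]
        ext x
        change g ^ (p - 1) * x * (g ^ (p - 1))⁻¹ = x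
        rw [hpow g x x.2, mul_inv_cancel_right])
    refine ⟨j, ?_⟩
    let L : Subgroup Q :=
      { carrier := {x | x ∈ N ∧ g * x * g⁻¹ = x ^ j}
        one_mem' := ⟨one_mem _, by simp⟩
        mul_mem' := by
          rintro x y ⟨hx, hx'⟩ ⟨hy, hy'⟩
          refine ⟨mul_mem hx hy, ?_⟩
          rw [Commute.mul_pow (hcomm x hx y hy), ← hx', ← hy']; group
        inv_mem' := by
          rintro x ⟨hx, hx'⟩
          refine ⟨inv_mem hx, ?_⟩
          rw [inv_pow, ← hx']; group }
    have hLn : L.Normal := by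
      constructor
      rintro x ⟨hx, hx'⟩ y
      refine ⟨hN.conj_mem x hx y, ?_⟩
      have h1 := hab g y x hx
      rw [conj_pow, ← hx']
      calc g * (y * x * y⁻¹) * g⁻¹ = g * y * x * (g * y)⁻¹ := by group
        _ = _ := by rw [h1]; group
    have hL := (hmin L hLn (fun x hx => hx.1)).resolve_left (fun h => hv (Subtype.ext (by
      have : (v : Q) ∈ L := ⟨v.2, congrArg Subtype.val hj⟩
      rw [h] at this
      exact mem_bot.1 this)))
    intro x hx
    rw [← hL] at hx
    exact hx.2
  obtain ⟨⟨x, hx⟩, hx0⟩ := exists_ne (1 : N)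
  have hx1 : x ≠ 1 := fun h => hx0 (Subtype.ext h)
  refine ⟨x, hx, ?_⟩
  have hn : (zpowers x).Normal := by
    constructor
    intro y hy g
    obtain ⟨j, hj⟩ := key g
    rw [hj y ((zpowers_le.2 hx) hy)]
    exact pow_mem hy j
  rcases hmin _ hn (zpowers_le.2 hx) with h | h
  · exact absurd (zpowers_eq_bot.1 h) hx1
  · rw [h]

theorem exists_max_normal {C : Type*} [Group C] [Finite C] {Y : Subgroup C} (hY : Y.Normal)
    (hne : Y ≠ ⊥) : ∃ Y1 : Subgroup C, IsChiefFactor C Y1 Y := by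
  let T := {K : Subgroup C // K.Normal ∧ K < Y}
  haveI : Nonempty T := ⟨⟨⊥, inferInstance, bot_lt_iff_ne_bot.2 hne⟩⟩
  obtain ⟨⟨K, h1, h2⟩, hmax⟩ := Finite.exists_max (fun K : T => Nat.card K.1)
  refine ⟨K, h1, hY, h2, fun L hL hKL hLY => ?_⟩
  by_contra hcon
  push Not at hcon
  have := hmax ⟨L, hL, lt_of_le_of_ne hLY hcon.2⟩
  exact absurd (card_lt_of_lt (lt_of_le_of_ne hKL hcon.1.symm)) (not_lt.2 this)

theorem supersol_pow {p q : ℕ} (hp : p.Prime) (hq : q.Prime) (hpq : p ≠ q) {C : Type*} [Group C]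
    [Finite C] (hC : Supersoluble C) (c : C) : ∀ n : ℕ, ∀ Y : Subgroup C, Nat.card Y = n → Y.Normal →
    (∀ x ∈ Y, ∀ y ∈ Y, x * y = y * x) → (∀ x ∈ Y, x ^ p = 1) →
    (∀ y ∈ Y, (c ^ (p - 1)) ^ q * y = y * (c ^ (p - 1)) ^ q) →
    ∀ y ∈ Y, c ^ (p - 1) * y = y * c ^ (p - 1) := by
  intro n
  induction n using Nat.strong_induction_on with
  | _ n ih =>
  intro Y hn hY hcomm hexp hdq
  by_cases hb : Y = ⊥
  · subst hb
    intro y hy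
    rw [mem_bot.1 hy, mul_one, one_mul]
  obtain ⟨Y1, hch⟩ := exists_max_normal hY hb
  obtain ⟨g, hg, hgen⟩ := hC _ _ hch
  obtain ⟨h1, -, hlt, -⟩ := hch
  have hle := hlt.le
  have h2 := ih _ (hn ▸ card_lt_of_lt hlt) Y1 rfl h1 (fun x hx y hy => hcomm x (hle hx) y (hle hy))
    (fun x hx => hexp x (hle hx)) (fun y hy => hdq y (hle hy))
  haveI := h1
  -- work modulo Y1
  have hgY1 : g ∉ Y1 := by
    intro hgY
    apply hlt.not_ge
    intro x hx
    obtain ⟨m, hm⟩ := hgen x hx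
    have := mul_mem (zpow_mem hgY m) hm
    rwa [mul_inv_cancel_left] at this
  obtain ⟨j, hj⟩ := hgen _ (hY.conj_mem g hg c)
  have hj' : ((c : C ⧸ Y1)) * g * (c : C ⧸ Y1)⁻¹ = (g : C ⧸ Y1) ^ j := by
    have := QuotientGroup.eq.2 hj
    simpa using this.symm
  have hk : ∀ k : ℕ, (c : C ⧸ Y1) ^ k * g * ((c : C ⧸ Y1) ^ k)⁻¹ = (g : C ⧸ Y1) ^ (j ^ k) := by
    intro k
    induction k with
    | zero => simp
    | succ k ihk =>
      rw [pow_succ' (c : C ⧸ Y1), pow_succ' j, zpow_mul, ← hj', conj_zpow, ← ihk]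
      group
  have hgp : (g : C ⧸ Y1) ^ (p : ℤ) = 1 := by
    rw [zpow_natCast, ← QuotientGroup.mk_pow, hexp g hg]; rfl
  have hjp : ¬ (p : ℤ) ∣ j := by
    rintro ⟨i, rfl⟩
    rw [zpow_mul, hgp, one_zpow] at hj'
    apply hgY1
    rw [← QuotientGroup.eq_one_iff]
    have : (g : C ⧸ Y1) = (c : C ⧸ Y1)⁻¹ * (c * g * (c : C ⧸ Y1)⁻¹) * c := by group
    rw [this, hj']; group
  have hmod := Int.ModEq.pow_card_sub_one_eq_one hp (n := j)
    ((Nat.prime_iff_prime_int.1 hp).coprime_iff_not_dvd.2 hjp).symm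
  have h3 : (g : C ⧸ Y1) ^ (j ^ (p - 1)) = g := by
    obtain ⟨i, hi⟩ := hmod.symm.dvd
    have : j ^ (p - 1) = 1 + p * i := by rw [← hi]; ring
    rw [this, zpow_add, zpow_mul, hgp, one_zpow, mul_one, zpow_one]
  have h4 := hk (p - 1)
  rw [h3] at h4
  generalize hd : c ^ (p - 1) = d at *
  have hz : g⁻¹ * (d * g * d⁻¹) ∈ Y1 := by
    rw [← QuotientGroup.eq, ← hd]
    simpa using h4.symm
  obtain ⟨z, hz1, hz2⟩ : ∃ z ∈ Y1, d * g * d⁻¹ = g * z := ⟨_, hz, by group⟩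
  have h5 : ∀ k : ℕ, d ^ k * g = g * z ^ k * d ^ k := by
    intro k
    induction k with
    | zero => simp
    | succ k ihk =>
      have h6 : d * z ^ k = z ^ k * d := h2 _ (pow_mem hz1 k)
      have h7 : d * g = g * z * d := by rw [← hz2]; group
      calc d ^ (k+1) * g = d * (d ^ k * g) := by rw [pow_succ', mul_assoc]
        _ = (d * g) * z ^ k * d ^ k := by rw [ihk]; group
        _ = g * z * (d * z ^ k) * d ^ k := by rw [h7]; group
        _ = _ := by rw [h6, pow_succ' z, pow_succ' d]; group
  have h6 := h5 q
  rw [hdq g hg] at h6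
  have h7 : z ^ q = 1 := by
    have := mul_right_cancel h6
    exact (mul_eq_left.1 this.symm)
  have h8 : z = 1 := by
    have h9 := Nat.dvd_gcd (orderOf_dvd_of_pow_eq_one h7) (orderOf_dvd_of_pow_eq_one (hexp z (hle hz1)))
    rw [((Nat.coprime_primes hq hp).2 hpq.symm).gcd_eq_one] at h9
    exact orderOf_eq_one_iff.1 (Nat.dvd_one.1 h9)
  have h9 : Commute d g := by
    rw [h8, mul_one, mul_inv_eq_iff_eq_mul] at hz2
    exact hz2
  intro y hy
  obtain ⟨m, hm⟩ := hgen y hy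
  have h10 : Commute d ((g ^ m)⁻¹ * y) := h2 _ hm
  have h11 := (h9.zpow_right m).mul_right h10
  rwa [mul_inv_cancel_left] at h11

end SS

set_option linter.style.haveILetI false
set_option linter.unusedSectionVars false
namespace SS
open Subgroup
universe u v w

theorem comm_nil_surj {X Y : Type*} [Group X] [Group Y] (f : X →* Y) (hf : Function.Surjective f)
    (h : Group.IsNilpotent (commutator X)) : Group.IsNilpotent (commutator Y) := by
  have e : (commutator X).map f = commutator Y := by
    rw [commutator_def, Subgroup.map_commutator, ← MonoidHom.range_eq_map,
      MonoidHom.range_eq_top.2 hf, commutator_def]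
  rw [← e]
  haveI := h
  exact Group.nilpotent_of_surjective (f.subgroupMap (commutator X)) (f.subgroupMap_surjective _)

section
variable {A : Type v} [Group A] {G : Type u} [Group G] [Finite G]

theorem exists_Elem {θ : A →* MulAut G} (hnil : Group.IsNilpotent (commutator G)) {N : Subgroup G}
    (hN : N.Normal) (hi : Inv θ N) (hne : N ≠ ⊥) :
    ∃ p : ℕ, p.Prime ∧ ∃ V : Subgroup G, Elem p θ V ∧ V ≠ ⊥ ∧ V ≤ N := by
  have key : ∀ N : Subgroup G, N.Normal → Inv θ N → N ≠ ⊥ → Group.IsNilpotent N →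
      ∃ p : ℕ, p.Prime ∧ ∃ V : Subgroup G, Elem p θ V ∧ V ≠ ⊥ ∧ V ≤ N := by
    intro N hN hi hne hnil
    obtain ⟨q, hq, hd⟩ := exists_prime_dvd_of_ne_bot hne
    haveI : Fact q.Prime := ⟨hq⟩
    obtain ⟨Q, h1, h2, h3, h4, h5⟩ := exists_normal_q hN hi hnil hd
    exact ⟨q, hq, OmZ q Q, Elem_OmZ h1 h2, OmZ_ne_bot h3 h4, fun x hx => h5 hx.1⟩
  by_cases h : N ⊓ commutator G = ⊥
  · refine key N hN hi hne ?_
    have hc : ∀ x ∈ N, ∀ y : G, x * y = y * x := by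
      intro x hx y
      have h1 : x * y * x⁻¹ * y⁻¹ ∈ N ⊓ commutator G := by
        refine mem_inf.2 ⟨?_, ?_⟩
        · have := mul_mem hx (hN.conj_mem _ (inv_mem hx) y)
          convert this using 1
          group
        · exact Subgroup.commutator_mem_commutator (mem_top x) (mem_top y)
      rw [h, mem_bot] at h1
      rw [mul_inv_eq_one, mul_inv_eq_iff_eq_mul] at h1
      exact h1
    letI := commOf N (fun x hx y _ => hc x hx y)
    infer_instance
  · obtain ⟨p, hp, V, h1, h2, h3⟩ := key (N ⊓ commutator G) inferInstance (fun a n hn =>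
      mem_inf.2 ⟨hi a n (mem_inf.1 hn).1, Inv_char (θ := θ) (K := commutator G) inferInstance a n (mem_inf.1 hn).2⟩) h
      (nilp_of_le inf_le_right hnil)
    exact ⟨p, hp, V, h1, h2, h3.trans inf_le_left⟩

end

theorem covering {A : Type v} [Group A] [Finite A] {F H : Subgroup A} (hA : Frob F H)
    {Q : Type w} [Group Q] (σ : A →* MulAut Q) : ∀ n : ℕ, ∀ (G : Type u) [Group G] [Finite G]
      (θ : A →* MulAut G), Nat.card G = n → Fx θ F = ⊥ → Group.IsNilpotent (commutator G) →
      ∀ f : G →* Q, Function.Surjective f → (∀ a g, f (θ a g) = σ a (f g)) →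
      Fx σ F = ⊥ ∧ ∀ x ∈ Fx σ H, ∃ g ∈ Fx θ H, f g = x := by
  intro n
  induction n using Nat.strong_induction_on with
  | _ n ih =>
  intro G _ _ θ hn hF hnil f hf hfe
  by_cases hker : f.ker = ⊥
  · have hinj := (MonoidHom.ker_eq_bot_iff f).1 hker
    have h1 : ∀ (S : Subgroup A) g, f g ∈ Fx σ S → g ∈ Fx θ S := fun S g hg s hs => hinj (by
      rw [hfe, hg s hs])
    constructor
    · rw [eq_bot_iff]
      intro x hx
      obtain ⟨g, rfl⟩ := hf x
      have := h1 F g hx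
      rw [hF, mem_bot] at this
      rw [this, map_one]; exact one_mem _
    · intro x hx
      obtain ⟨g, rfl⟩ := hf x
      exact ⟨g, h1 H g hx, rfl⟩
  · have hki : Inv θ f.ker := fun a g hg => by
      rw [MonoidHom.mem_ker] at hg ⊢
      rw [hfe, hg, map_one]
    obtain ⟨p, hp, V, hV, hV0, hVk⟩ := exists_Elem hnil (MonoidHom.normal_ker f) hki hker
    haveI := hV.normal
    haveI : Fact p.Prime := ⟨hp⟩
    obtain ⟨h1, h2⟩ := ih _ (hn ▸ card_quot_lt hV0) (G ⧸ V) (quo θ V hV.inv) rfl (cover_F hA hF hV)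
      (comm_nil_surj (QuotientGroup.mk' V) (QuotientGroup.mk'_surjective V) hnil)
      (QuotientGroup.lift V f hVk) (fun x => by
        obtain ⟨g, rfl⟩ := hf x
        exact ⟨(g : G ⧸ V), rfl⟩) (fun a g => by
        obtain ⟨g, rfl⟩ := QuotientGroup.mk_surjective g
        exact hfe a g)
    refine ⟨h1, fun x hx => ?_⟩
    obtain ⟨y, hy, hyx⟩ := h2 x hx
    obtain ⟨g, rfl⟩ := QuotientGroup.mk_surjective y
    obtain ⟨v, hv, hgv⟩ := cover_H hA hF hV g hy
    refine ⟨g * v, hgv, ?_⟩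
    rw [map_mul, MonoidHom.mem_ker.1 (hVk hv), mul_one]
    exact hyx

theorem exists_min_inv {A : Type v} [Group A] {G : Type u} [Group G] [Finite G] {θ : A →* MulAut G}
    {D : Subgroup G} (hD : D.Normal) (hi : Inv θ D) (hne : D ≠ ⊥) :
    ∃ M : Subgroup G, M.Normal ∧ Inv θ M ∧ M ≠ ⊥ ∧ M ≤ D ∧
      ∀ L : Subgroup G, L.Normal → Inv θ L → L ≤ M → L = ⊥ ∨ L = M := by
  let T := {K : Subgroup G // K.Normal ∧ Inv θ K ∧ K ≠ ⊥ ∧ K ≤ D}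
  haveI : Nonempty T := ⟨⟨D, hD, hi, hne, le_rfl⟩⟩
  obtain ⟨⟨K, h1, h2, h3, h4⟩, hmin⟩ := Finite.exists_min (fun K : T => Nat.card K.1)
  refine ⟨K, h1, h2, h3, h4, fun L hL hLi hLK => ?_⟩
  by_contra hcon
  push Not at hcon
  have := hmin ⟨L, hL, hLi, hcon.1, hLK.trans h4⟩
  exact absurd (card_lt_of_lt (lt_of_le_of_ne hLK hcon.2)) (not_lt.2 this)

theorem D1 {A : Type v} [Group A] [Finite A] {F H : Subgroup A} (hA : Frob F H) {p : ℕ}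
    [hp : Fact p.Prime] {B M : Type u} [CommGroup B] [Finite B] [CommGroup M] [Finite M] [Nontrivial M]
    {β : A →* MulAut B} {τ : A →* MulAut M} {σ : B →* MulAut M}
    (hc : ∀ a b m, τ a (σ b m) = σ (β a b) (τ a m)) (hσ : Function.Injective σ)
    (hM : ∀ m : M, m ^ p = 1) (hirr : ∀ L : Subgroup M, Inv τ L → Inv σ L → L = ⊥ ∨ L = ⊤)
    (hF : Fx β F = ⊥) {D : Subgroup B} (hDi : Inv β D)
    (hD : ∀ q : ℕ, q.Prime → p ≠ q → ∀ x ∈ D, x ∈ Fx β H → x ^ q = 1 →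
      ∀ m ∈ Fx τ H, σ x m = m) : D = ⊥ := by
  by_contra hne
  obtain ⟨U, -, hUi, hU0, hUD, hmin⟩ := exists_min_inv (θ := β) (D := D) inferInstance hDi hne
  obtain ⟨q, hq, hqU⟩ := exists_prime_dvd_of_ne_bot hU0
  haveI : Fact q.Prime := ⟨hq⟩
  have hUq : ∀ x ∈ U, x ^ q = 1 := by
    let L : Subgroup B := U ⊓ (powMonoidHom q : B →* B).ker
    have hL : ∀ x, x ∈ L ↔ x ∈ U ∧ x ^ q = 1 := fun x => by
      rw [mem_inf, MonoidHom.mem_ker]; rfl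
    rcases hmin L inferInstance (fun a x hx => by
      rw [hL] at hx ⊢
      exact ⟨hUi a x hx.1, by rw [← map_pow, hx.2, map_one]⟩) inf_le_left with h | h
    · obtain ⟨x, hx⟩ := exists_prime_orderOf_dvd_card' q hqU
      have h1 : (x : B) ∈ L := (hL _).2 ⟨x.2, by
        rw [← hx]; exact congrArg Subtype.val (pow_orderOf_eq_one x)⟩
      rw [h, mem_bot] at h1
      have : x = 1 := Subtype.ext h1
      rw [this, orderOf_one] at hx
      exact absurd hx hq.one_lt.ne
    · intro x hx
      rw [← h, hL] at hx
      exact hx.2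
  have hnt : ∀ x ∈ U, σ x = 1 → x = 1 := fun x _ h => hσ (by rw [h, map_one])
  suffices h : ∀ x ∈ U, σ x = 1 from hU0 (by
    rw [eq_bot_iff]; exact fun x hx => mem_bot.2 (hnt x hx (h x hx)))
  by_cases hpq : p = q
  · subst hpq
    have hMp : IsPGroup p (⊤ : Subgroup M) := fun m => ⟨1, Subtype.ext (by simpa using hM m)⟩
    have hUp : IsPGroup p U := fun x => ⟨1, Subtype.ext (by simpa using hUq x x.2)⟩
    have h1 := Fx_card_mod (θ := σ) (P := U) (K := ⊥) inferInstance hUp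
    rw [sup_bot_eq, Fx_bot'] at h1
    rcases hirr (Fx σ U) (by
      intro a m hm s hs
      have h2 := hc a (β a⁻¹ s) m
      rw [th_apply_inv, hm _ (hUi _ _ hs)] at h2
      exact h2.symm) (Fx_inv inferInstance) with h2 | h2
    · rw [h2, Subgroup.card_bot] at h1
      exact absurd (bot_of_mod hMp h1) top_ne_bot
    · intro x hx
      ext m
      have : m ∈ Fx σ U := h2 ▸ mem_top m
      exact this x hx
  · intro x hx
    refine lemmaK (U := U) (V := M) hA hpq (fun u => Subtype.ext (hUq u u.2)) hM
      (α := res β U hUi) (τ := τ) (ρ := σ.comp U.subtype) (fun a u m => hc a u m)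
      (Fx_res_bot hUi hF) ?_ ?_ ⟨x, hx⟩
    · intro N hN
      have h1 : N.map U.subtype ≤ U := by
        rintro _ ⟨y, _, rfl⟩; exact y.2
      rcases hmin (N.map U.subtype) inferInstance (by
        rintro a _ ⟨y, hy, rfl⟩
        exact ⟨_, hN a y hy, rfl⟩) h1 with h2 | h2
      · left
        exact (Subgroup.map_eq_bot_iff_of_injective _ U.subtype_injective).1 h2
      · right
        rw [eq_top_iff]
        intro y _
        have : (y : B) ∈ N.map U.subtype := by rw [h2]; exact y.2
        obtain ⟨z, hz, hzy⟩ := this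
        rwa [← Subtype.ext hzy]
    · intro u hu m hm
      exact hD q hq hpq u (hUD u.2) ((Fx_res hUi u).1 hu) (hUq u u.2) m hm

end SS

set_option linter.style.haveILetI false
set_option linter.unusedSectionVars false
namespace SS
open Subgroup
universe u v w

theorem cent_min {A : Type v} [Group A] {G : Type u} [Group G] {θ : A →* MulAut G}
    (hnil : Group.IsNilpotent (commutator G)) {M : Subgroup G} (hM : M.Normal) (hi : Inv θ M)
    (hne : M ≠ ⊥) (hmin : ∀ L : Subgroup G, L.Normal → Inv θ L → L ≤ M → L = ⊥ ∨ L = M) :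
    ∀ x ∈ commutator G, ∀ m ∈ M, x * m = m * x := by
  have hLi : Inv θ ⁅M, commutator G⁆ := by
    intro a x hx
    have h1 : ⁅M, commutator G⁆ ≤ (⁅M, commutator G⁆).comap (θ a).toMonoidHom := by
      rw [Subgroup.commutator_le]
      intro m hm c hc
      change θ a (m * c * m⁻¹ * c⁻¹) ∈ ⁅M, commutator G⁆
      rw [map_mul, map_mul, map_mul, map_inv, map_inv]
      exact Subgroup.commutator_mem_commutator (hi a m hm)
        (Inv_char (θ := θ) (K := commutator G) inferInstance a c hc)
    exact h1 hx
  have hLM : ⁅M, commutator G⁆ ≤ M := Subgroup.commutator_le_left _ _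
  rcases hmin _ (Subgroup.commutator_normal _ _) hLi hLM with h | h
  · rw [Subgroup.commutator_eq_bot_iff_le_centralizer] at h
    intro x hx m hm
    exact (mem_centralizer_iff.1 (h hm)) x hx
  · exfalso
    have h0 : M ≤ commutator G := by
      rw [← h]; exact Subgroup.commutator_le_right _ _
    have h1 : ∀ n, M ≤ (commutator G).lowerCentralSeries n := by
      intro n
      induction n with
      | zero => simpa using h0
      | succ n ih =>
        rw [Subgroup.lowerCentralSeries_succ]
        calc M = ⁅M, commutator G⁆ := h.symm
          _ ≤ _ := Subgroup.commutator_mono ih le_rfl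
    obtain ⟨n, hn⟩ := (Subgroup.isNilpotent_iff_lowerCentralSeries (commutator G)).1 hnil
    exact hne (le_bot_iff.1 (hn ▸ h1 n))

theorem chief_case {p : ℕ} [hp : Fact p.Prime] {G : Type u} [Group G] [Finite G] {M : Subgroup G}
    [hM : M.Normal] (hcomm : ∀ x ∈ M, ∀ y ∈ M, x * y = y * x) (hexp : ∀ x ∈ M, x ^ p = 1)
    (hcen : ∀ x ∈ commutator G, ∀ m ∈ M, x * m = m * x)
    (hpow : ∀ g : G, ∀ x ∈ M, g ^ (p - 1) * x = x * g ^ (p - 1))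
    (hQ : Supersoluble (G ⧸ M)) : Supersoluble G := by
  rintro K N ⟨hK, hN, hlt, hmin⟩
  have hdec : ∀ x ∈ K ⊔ M, ∃ k ∈ K, ∃ m ∈ M, k * m = x := by
    intro x hx
    rw [← SetLike.mem_coe, Subgroup.mul_normal] at hx
    exact Set.mem_mul.1 hx
  rcases hmin (N ⊓ (K ⊔ M)) inferInstance (le_inf hlt.le le_sup_left) inf_le_left with h | h
  · have hb : ∀ x ∈ N, (x : G ⧸ M) ∈ K.map (QuotientGroup.mk' M) → x ∈ K := by
      rintro x hx ⟨k, hk, hkx⟩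
      have h1 : k⁻¹ * x ∈ M := QuotientGroup.eq.1 hkx
      rw [← h]
      refine mem_inf.2 ⟨hx, ?_⟩
      have := mul_mem (mem_sup_left hk : k ∈ K ⊔ M) (mem_sup_right h1 : k⁻¹ * x ∈ K ⊔ M)
      rwa [mul_inv_cancel_left] at this
    have hs := QuotientGroup.mk'_surjective M
    obtain ⟨g, ⟨n, hn, rfl⟩, hg⟩ := hQ (K.map (QuotientGroup.mk' M)) (N.map (QuotientGroup.mk' M))
      ⟨hK.map _ hs, hN.map _ hs, lt_of_le_of_ne (Subgroup.map_mono hlt.le) (fun e => by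
        refine not_le_of_gt hlt (fun x hx => hb x hx ?_)
        rw [e]; exact ⟨x, hx, rfl⟩), fun L hL h1 h2 => by
        rcases hmin (N ⊓ L.comap (QuotientGroup.mk' M)) inferInstance
          (le_inf hlt.le (Subgroup.map_le_iff_le_comap.1 h1)) inf_le_left with h3 | h3
        · left
          refine le_antisymm (fun y hy => ?_) h1
          obtain ⟨x, hx, rfl⟩ := h2 hy
          exact ⟨x, h3 ▸ mem_inf.2 ⟨hx, hy⟩, rfl⟩
        · right
          refine le_antisymm h2 ?_
          rw [Subgroup.map_le_iff_le_comap, ← h3]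
          exact inf_le_right⟩
    refine ⟨n, hn, fun x hx => ?_⟩
    obtain ⟨j, hj⟩ := hg _ ⟨x, hx, rfl⟩
    exact ⟨j, hb _ (mul_mem (inv_mem (zpow_mem hn j)) hx) hj⟩
  · have hm : ∀ x ∈ N.map (QuotientGroup.mk' K), ∃ m ∈ M, (m : G ⧸ K) = x := by
      rintro _ ⟨x, hx, rfl⟩
      rw [← h] at hx
      obtain ⟨k, hk, m, hm, rfl⟩ := hdec x (mem_inf.1 hx).2
      refine ⟨m, hm, ?_⟩
      change (m : G ⧸ K) = ((k * m : G) : G ⧸ K)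
      rw [QuotientGroup.mk_mul, (QuotientGroup.eq_one_iff k).2 hk, one_mul]
    have hs := QuotientGroup.mk'_surjective K
    obtain ⟨x, ⟨n, hn, rfl⟩, hx⟩ := cyc_min (p := p) (N := N.map (QuotientGroup.mk' K)) (hN.map _ hs)
      (fun e => by
        refine not_le_of_gt hlt (fun x hx => ?_)
        have : (x : G ⧸ K) ∈ N.map (QuotientGroup.mk' K) := ⟨x, hx, rfl⟩
        rw [e, mem_bot] at this
        exact (QuotientGroup.eq_one_iff x).1 this)
      (fun L hL h1 => by
        have hKL : K ≤ L.comap (QuotientGroup.mk' K) := fun x hx => by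
          change (x : G ⧸ K) ∈ L
          rw [(QuotientGroup.eq_one_iff x).2 hx]; exact one_mem _
        have hLN : L.comap (QuotientGroup.mk' K) ≤ N := fun x hx => by
          obtain ⟨y, hy, hyx⟩ := h1 hx
          have := mul_mem hy (hlt.le (QuotientGroup.eq.1 hyx))
          rwa [mul_inv_cancel_left] at this
        rcases hmin _ (hL.comap _) hKL hLN with h3 | h3
        · left
          rw [eq_bot_iff]
          intro y hy
          obtain ⟨x, rfl⟩ := QuotientGroup.mk_surjective y
          exact mem_bot.2 ((QuotientGroup.eq_one_iff x).2 (h3 ▸ hy))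
        · right
          refine le_antisymm h1 ?_
          rw [Subgroup.map_le_iff_le_comap, h3])
      (fun x hx y hy => by
        obtain ⟨x, hx2, rfl⟩ := hm x hx
        obtain ⟨y, hy2, rfl⟩ := hm y hy
        rw [← QuotientGroup.mk_mul, hcomm x hx2 y hy2, QuotientGroup.mk_mul])
      (fun x hx => by
        obtain ⟨x, hx2, rfl⟩ := hm x hx
        rw [← QuotientGroup.mk_pow, hexp x hx2, QuotientGroup.mk_one])
      (fun g t x hx => by
        obtain ⟨x, hx2, rfl⟩ := hm x hx
        obtain ⟨g, rfl⟩ := QuotientGroup.mk_surjective g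
        obtain ⟨t, rfl⟩ := QuotientGroup.mk_surjective t
        have hc : g⁻¹ * t⁻¹ * g * t ∈ commutator G := by
          have := Subgroup.commutator_mem_commutator (mem_top g⁻¹) (mem_top t⁻¹)
          rw [commutatorElement_def, inv_inv, inv_inv] at this
          exact this
        have h1 := hcen _ hc x hx2
        have h2 : (g * t) * x * (g * t)⁻¹ = (t * g) * x * (t * g)⁻¹ := by
          have e1 : g * t = (t * g) * (g⁻¹ * t⁻¹ * g * t) := by group
          generalize g⁻¹ * t⁻¹ * g * t = c at *
          rw [e1, mul_assoc (t * g) c x, h1]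
          group
        exact congrArg (QuotientGroup.mk' K) h2)
      (fun g x hx => by
        obtain ⟨x, hx2, rfl⟩ := hm x hx
        obtain ⟨g, rfl⟩ := QuotientGroup.mk_surjective g
        exact congrArg (QuotientGroup.mk' K) (hpow g x hx2))
    refine ⟨n, hn, fun y hy => ?_⟩
    obtain ⟨j, hj⟩ := hx ⟨y, hy, rfl⟩
    exact ⟨j, QuotientGroup.eq.1 hj⟩

theorem pow_cent {A : Type v} [Group A] [Finite A] {F H : Subgroup A} (hA : Frob F H) {p : ℕ}
    [hp : Fact p.Prime] {G : Type u} [Group G] [Finite G] {θ : A →* MulAut G} (hF : Fx θ F = ⊥)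
    (hnil : Group.IsNilpotent (commutator G)) (hH : Supersoluble (Fx θ H)) {M : Subgroup G}
    (hV : Elem p θ M) (hne : M ≠ ⊥)
    (hmin : ∀ L : Subgroup G, L.Normal → Inv θ L → L ≤ M → L = ⊥ ∨ L = M)
    (hcen : ∀ x ∈ commutator G, ∀ m ∈ M, x * m = m * x) :
    ∀ g : G, ∀ x ∈ M, g ^ (p - 1) * x = x * g ^ (p - 1) := by
  haveI := hV.normal
  letI := commOf M hV.comm
  haveI : Nontrivial M := (Subgroup.nontrivial_iff_ne_bot M).2 hne
  let cj : G →* MulAut M := MulAut.conjNormal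
  have hcj : ∀ g (m : M), ((cj g m : M) : G) = g * m * g⁻¹ := fun g m => MulAut.conjNormal_apply g m
  have hker : ∀ g, g ∈ cj.ker ↔ ∀ m ∈ M, g * m = m * g := by
    intro g
    rw [MonoidHom.mem_ker]
    constructor
    · intro h m hm
      have := congrArg Subtype.val (DFunLike.congr_fun h (⟨m, hm⟩ : M))
      rw [hcj] at this
      exact mul_inv_eq_iff_eq_mul.1 this
    · intro h
      ext m
      rw [hcj, h m m.2, mul_inv_cancel_right]; rfl
  have hki : Inv θ cj.ker := by
    intro a g hg
    rw [hker] at hg ⊢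
    intro m hm
    have := congrArg (θ a) (hg _ (hV.inv a⁻¹ m hm))
    rwa [map_mul, map_mul, th_apply_inv] at this
  letI : CommGroup (G ⧸ cj.ker) :=
    { (inferInstance : Group (G ⧸ cj.ker)) with
      mul_comm := by
        intro a b
        obtain ⟨a, rfl⟩ := QuotientGroup.mk_surjective a
        obtain ⟨b, rfl⟩ := QuotientGroup.mk_surjective b
        refine QuotientGroup.eq.2 ((hker _).2 (hcen _ ?_))
        have := Subgroup.commutator_mem_commutator (mem_top b⁻¹) (mem_top a⁻¹)
        rw [commutatorElement_def, inv_inv, inv_inv] at this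
        rw [mul_inv_rev, ← mul_assoc]
        exact this }
  let β := quo θ cj.ker hki
  have hcov := covering hA β _ G θ rfl hF hnil (QuotientGroup.mk' cj.ker)
    (QuotientGroup.mk'_surjective _) (fun a g => rfl)
  let D : Subgroup (G ⧸ cj.ker) := (powMonoidHom (p - 1) : (G ⧸ cj.ker) →* (G ⧸ cj.ker)).range
  have hDi : Inv β D := by
    rintro a _ ⟨b, rfl⟩
    refine ⟨β a b, ?_⟩
    simp only [powMonoidHom_apply]
    rw [map_pow]
  let f : G →* D := ((powMonoidHom (p - 1) : (G ⧸ cj.ker) →* (G ⧸ cj.ker)).rangeRestrict).comp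
    (QuotientGroup.mk' cj.ker)
  have hf : ∀ g, ((f g : D) : G ⧸ cj.ker) = (g : G ⧸ cj.ker) ^ (p - 1) := fun g => rfl
  have hcov2 := covering hA (res β D hDi) _ G θ rfl hF hnil f
    ((MonoidHom.rangeRestrict_surjective _).comp (QuotientGroup.mk'_surjective _)) (fun a g => by
      apply Subtype.ext
      rw [res_coe, hf, hf, map_pow]; rfl)
  have hD := D1 (B := G ⧸ cj.ker) (M := M) (p := p) hA (β := β) (τ := res θ M hV.inv)
    (σ := QuotientGroup.kerLift cj) (by
      intro a b m
      obtain ⟨g, rfl⟩ := QuotientGroup.mk_surjective b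
      apply Subtype.ext
      change θ a (cj g m : M) = ((cj (θ a g) (res θ M hV.inv a m) : M) : G)
      rw [hcj, hcj]
      simp) (QuotientGroup.kerLift_injective cj) (fun m => Subtype.ext (hV.exp m m.2)) (by
      intro L h1 h2
      rcases hmin (L.map M.subtype) ⟨by
        rintro _ ⟨m, hm, rfl⟩ g
        exact ⟨cj g m, h2 (g : G ⧸ cj.ker) m hm, hcj g m⟩⟩ (hV.inv.map_res h1)
        (Subgroup.map_subtype_le _) with h3 | h3
      · left
        exact (Subgroup.map_eq_bot_iff_of_injective _ M.subtype_injective).1 h3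
      · right
        rw [eq_top_iff]
        intro y _
        have : (y : G) ∈ L.map M.subtype := by rw [h3]; exact y.2
        obtain ⟨z, hz, hzy⟩ := this
        rwa [← Subtype.ext hzy]) hcov.1 hDi (by
      intro q hq hpq x hxD hx hxq m hm
      obtain ⟨c, hc, hcx⟩ := hcov2.2 ⟨x, hxD⟩ ((Fx_res hDi _).2 hx)
      have hcx' : ((c ^ (p - 1) : G) : G ⧸ cj.ker) = x := by
        have := congrArg Subtype.val hcx
        exact this
      have hcq : (c ^ (p - 1)) ^ q ∈ cj.ker := by
        rw [← QuotientGroup.eq_one_iff, QuotientGroup.mk_pow, hcx', hxq]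
      rw [hker] at hcq
      have := supersol_pow hp.out hq hpq hH ⟨c, hc⟩ _ (M.subgroupOf (Fx θ H)) rfl inferInstance
        (fun x hx y hy => Subtype.ext (hV.comm x hx y hy))
        (fun x hx => Subtype.ext (hV.exp x hx)) (fun y hy => Subtype.ext (hcq y hy))
        ⟨m, (Fx_res _ _).1 hm⟩ m.2
      have h5 : c ^ (p - 1) * m = m * c ^ (p - 1) := congrArg Subtype.val this
      rw [← hcx']
      apply Subtype.ext
      change ((cj (c ^ (p - 1)) m : M) : G) = m
      rw [hcj, h5, mul_inv_cancel_right])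
  intro g
  have h1 : (g : G ⧸ cj.ker) ^ (p - 1) ∈ D := ⟨g, rfl⟩
  rw [hD, mem_bot, ← QuotientGroup.mk_pow, QuotientGroup.eq_one_iff, hker] at h1
  exact h1

theorem theoremD {A : Type v} [Group A] [Finite A] {F H : Subgroup A} (hA : Frob F H) :
    ∀ n : ℕ, ∀ (G : Type u) [Group G] [Finite G] (θ : A →* MulAut G), Nat.card G = n →
      Fx θ F = ⊥ → Group.IsNilpotent (commutator G) → Supersoluble (Fx θ H) → Supersoluble G := by
  intro n
  induction n using Nat.strong_induction_on with
  | _ n ih =>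
  intro G _ _ θ hn hF hnil hH
  by_cases ht : (⊤ : Subgroup G) = ⊥
  · rintro K N ⟨_, _, hlt, _⟩
    have : N ≤ K := (le_top.trans ht.le).trans bot_le
    exact absurd hlt (not_lt_of_ge this)
  obtain ⟨M, hM, hi, hne, -, hmin⟩ := exists_min_inv (θ := θ) (D := ⊤) inferInstance
    (fun _ _ _ => mem_top _) ht
  obtain ⟨p, hp, V, hV, hV0, hVM⟩ := exists_Elem hnil hM hi hne
  obtain rfl : V = M := (hmin V hV.normal hV.inv hVM).resolve_left hV0
  haveI : Fact p.Prime := ⟨hp⟩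
  have hcen := cent_min hnil hM hi hne hmin
  refine chief_case (p := p) hV.comm hV.exp hcen (pow_cent hA hF hnil hH hV hne hmin hcen) ?_
  refine ih _ (hn ▸ card_quot_lt hV0) (G ⧸ V) (quo θ V hV.inv) rfl (cover_F hA hF hV)
      (comm_nil_surj (QuotientGroup.mk' V) (QuotientGroup.mk'_surjective V) hnil) ?_
  refine supersol_surj (X := Fx θ H)
      (((QuotientGroup.mk' V).comp (Fx θ H).subtype).codRestrict (Fx (quo θ V hV.inv) H)
        (fun x s hs => by
          change ((θ s x : G) : G ⧸ V) = ((x : G) : G ⧸ V)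
          rw [x.2 s hs])) ?_ hH
  rintro ⟨x, hx⟩
  obtain ⟨g, rfl⟩ := QuotientGroup.mk_surjective x
  obtain ⟨v, hv, hgv⟩ := cover_H hA hF hV g hx
  refine ⟨⟨g * v, hgv⟩, Subtype.ext ?_⟩
  change ((g * v : G) : G ⧸ V) = (g : G ⧸ V)
  exact QuotientGroup.mk_mul_of_mem g hv

end SS

/-- If a finite group `G` admits a Frobenius group of automorphisms `FH` with
`C_G(F) = 1`, `C_{G'}(H)` is nilpotent and `C_G(H)` is supersoluble, then `G`
is supersoluble. -/
theorem stmt16 {A G : Type*} [Group A] [Group G] [Finite A] [Finite G]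
    [MulDistribMulAction A G]
    (F H : Subgroup A) (hFnorm : F.Normal) (hsup : F ⊔ H = ⊤) (hinf : F ⊓ H = ⊥)
    (hHne : H ≠ ⊥)
    (hfrob : ∀ h ∈ H, h ≠ 1 → ∀ f ∈ F, h * f * h⁻¹ = f → f = 1)
    (hfpf : autFixed (G := G) F = ⊥)
    (h1 : Group.IsNilpotent (↥((commutator G) ⊓ autFixed (G := G) H)))
    (h2 : Supersoluble (autFixed (G := G) H)) :
    Supersoluble G := by
  let θ : A →* MulAut G := MulDistribMulAction.toMulAut A G
  have hA : SS.Frob F H := ⟨hFnorm, hsup, hfrob, SS.frob_kernel_nilp F H hFnorm hHne hfrob⟩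
  have hF : SS.Fx θ F = ⊥ := hfpf
  have hi : SS.Inv θ (commutator G) := SS.Inv_char inferInstance
  have hnil : Group.IsNilpotent (commutator G) := by
    refine SS.theoremC hA (commutator G) (SS.res θ (commutator G) hi) (SS.Fx_res_bot hi hF) ?_
    refine SS.nilp_of_injective h1 (((commutator G).subtype.comp
      (SS.Fx (SS.res θ (commutator G) hi) H).subtype).codRestrict
      ((commutator G) ⊓ autFixed (G := G) H)
      (fun x => Subgroup.mem_inf.2 ⟨x.1.2, (SS.Fx_res hi _).1 x.2⟩)) ?_
    intro x y h
    exact Subtype.ext (Subtype.ext (congrArg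
      (fun z : ↥((commutator G) ⊓ autFixed (G := G) H) => (z : G)) h))
  exact SS.theoremD hA _ G θ rfl hF hnil h2
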